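/- arXiv:2201.08232 — 4 statements merged into one kernel-verified Lean document; each statement's English description precedes it below -/
import Mathlib

section
/- (Far-field expansion of the half-plane potential of a concentrated vorticity.) For all constants c₁, c₂, κ₀ > 0 and L ≥ 2 there exists C > 0 with the following property. Let ε > 0, σ ∈ (0, min(c₁/2, 1)], p = (p₁, 0) with c₁ ≤ p₁ ≤ c₂, and let A ⊆ B_σ(p) be a measurable set with κ := ε^{−2} ∫_A x₁ dx ≤ κ₀. Define ψ₁(x) := (p₁²/(2π ε²)) ∫_A ln(|x − x̄'|/|x − x'|) dx' for x ∈ Π. Then for every x ∈ Π with |x − p| ≥ L σ: |ψ₁(x) − (κ p₁/(2π)) ln(|x − p̄|/|x − p|)| ≤ C σ/|x − p|, and |∇ψ₁(x) + (κ p₁/(2π))[(x − p)/|x − p|² − (x − p̄)/|x − p̄|²]| ≤ C σ/|x − p|². -/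
open MeasureTheory Real Filter
open scoped RealInnerProductSpace

noncomputable section

/-- The plane `ℝ²` with the Euclidean norm. -/
abbrev Plane : Type := EuclideanSpace ℝ (Fin 2)

/-- The point `(a, b)` of the plane. -/
def mk2 (a b : ℝ) : Plane := (WithLp.equiv 2 (Fin 2 → ℝ)).symm ![a, b]

/-- The open right half plane `Π = {x : x₁ > 0}`. -/
def halfPlane : Set Plane := {x : Plane | 0 < x 0}

/-- The reflection `x̄ = (−x₁, x₂)` of a point `x = (x₁, x₂)`. -/
def reflPt (x : Plane) : Plane := mk2 (-(x 0)) (x 1)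

/-- The Green function `G_*` on the half plane of the operator `−(1/x₁)div((1/x₁)∇)`. -/
def Gstar (x x' : Plane) : ℝ :=
  x 0 * (x' 0) ^ 2 / (4 * π) *
    ∫ θ in (-π)..π, Real.cos θ /
      Real.sqrt ((x 1 - x' 1) ^ 2 + (x 0) ^ 2 + (x' 0) ^ 2 - 2 * x 0 * x' 0 * Real.cos θ)

/-- The Green function of `−Δ` on the half plane. -/
def Gfun (x x' : Plane) : ℝ :=
  (1 / (4 * π)) * Real.log
    (((x 0 + x' 0) ^ 2 + (x 1 - x' 1) ^ 2) / ((x 0 - x' 0) ^ 2 + (x 1 - x' 1) ^ 2))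

/-- The regular part `H_c(x,x') = G_*(x,x') − c² G(x,x')`. -/
def Hker (c : ℝ) (x x' : Plane) : ℝ := Gstar x x' - c ^ 2 * Gfun x x'

/-- The regular part `H_c`, extended continuously to the diagonal. -/
def HkerExt (c : ℝ) (x x' : Plane) : ℝ := by
  classical
  exact if x = x' then limUnder (nhdsWithin x' {x'}ᶜ) (fun y => Hker c y x')
    else Hker c x x'

/-- The cross-section `A = {x ∈ Π : ψ(x) − (W/2) x₁² ln(1/ε) > μ}`. -/
def crossSection (ψ : Plane → ℝ) (ε W μ : ℝ) : Set Plane :=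
  {x : Plane | x ∈ halfPlane ∧ μ < ψ x - W / 2 * (x 0) ^ 2 * Real.log (1 / ε)}

/-- `ψ` is a stream function of a steady vortex ring with parameters `(ε, W, μ)`. -/
structure IsVortexRingStream (ψ : Plane → ℝ) (ε W μ : ℝ) : Prop where
  continuousOn : ContinuousOn ψ halfPlane
  bounded : Bornology.IsBounded (crossSection ψ ε W μ)
  closure_subset : closure (crossSection ψ ε W μ) ⊆ halfPlane
  repr : ∀ x ∈ halfPlane, ψ x = (∫ x' in crossSection ψ ε W μ, Gstar x x') / ε ^ 2

/-- The circulation `ε⁻² ∫_A x₁ dx` of a vortex ring. -/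
def circulation (ψ : Plane → ℝ) (ε W μ : ℝ) : ℝ :=
  (∫ x in crossSection ψ ε W μ, x 0) / ε ^ 2

/-- `ψ` is centralized: it is even in the second variable. -/
def Centralized (ψ : Plane → ℝ) : Prop :=
  ∀ a b : ℝ, ψ (mk2 a (-b)) = ψ (mk2 a b)
theorem abs_log_sub_log_le {s t m : ℝ} (hm : 0 < m) (hs : m ≤ s) (ht : m ≤ t) :
    |Real.log s - Real.log t| ≤ |s - t| / m := by
  have key : ∀ {u v : ℝ}, m ≤ u → m ≤ v → Real.log u - Real.log v ≤ |u - v| / m := by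
    intro u v hu hv
    have hu0 := hm.trans_le hu
    have hv0 := hm.trans_le hv
    rw [← Real.log_div hu0.ne' hv0.ne']
    calc Real.log (u / v) ≤ u / v - 1 := Real.log_le_sub_one_of_pos (by positivity)
      _ = (u - v) / v := by field_simp
      _ ≤ |u - v| / v := by gcongr; exact le_abs_self _
      _ ≤ |u - v| / m := by gcongr
  rw [abs_le]
  have h1 := key hs ht
  have h2 := key ht hs
  rw [abs_sub_comm] at h2
  constructor <;> linarith

theorem abs_log_ratio_sub_le {E : Type*} [SeminormedAddCommGroup E] {a b a' b' y : E} {m σ : ℝ} (hm : 0 < m) (ha : m ≤ ‖y - a‖)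
    (hb : m ≤ ‖y - b‖) (ha' : m ≤ ‖y - a'‖) (hb' : m ≤ ‖y - b'‖) (haa : ‖a - a'‖ ≤ σ)
    (hbb : ‖b - b'‖ ≤ σ) :
    |Real.log (‖y - a‖ / ‖y - b‖) - Real.log (‖y - a'‖ / ‖y - b'‖)| ≤ 2 * σ / m := by
  have key : ∀ {u v : E}, m ≤ ‖y - u‖ → m ≤ ‖y - v‖ → ‖u - v‖ ≤ σ →
      |Real.log ‖y - u‖ - Real.log ‖y - v‖| ≤ σ / m := by
    intro u v hu hv huv
    refine (abs_log_sub_log_le hm hu hv).trans ?_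
    gcongr
    refine (abs_norm_sub_norm_le _ _).trans ?_
    rwa [sub_sub_sub_cancel_left, norm_sub_rev]
  rw [Real.log_div (hm.trans_le ha).ne' (hm.trans_le hb).ne',
    Real.log_div (hm.trans_le ha').ne' (hm.trans_le hb').ne', sub_sub_sub_comm]
  refine (abs_sub _ _).trans ?_
  have h1 := key ha ha' haa
  have h2 := key hb hb' hbb
  rw [mul_div_assoc]
  linarith

section InnerProductSpace

variable {E : Type*} [NormedAddCommGroup E] [InnerProductSpace ℝ E]

/-- The gradient at `y` of `log (‖· - a‖ / ‖· - b‖)`. -/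
def gradLogRatio (a b y : E) : E :=
  (‖y - a‖ ^ 2)⁻¹ • (y - a) - (‖y - b‖ ^ 2)⁻¹ • (y - b)

theorem norm_inversion_sub_le {a b : E} {m : ℝ} (hm : 0 < m) (ha : m ≤ ‖a‖) (hb : m ≤ ‖b‖) :
    ‖(‖a‖ ^ 2)⁻¹ • a - (‖b‖ ^ 2)⁻¹ • b‖ ≤ ‖a - b‖ / m ^ 2 := by
  have ha0 : a ≠ 0 := norm_pos_iff.1 (hm.trans_le ha)
  have hb0 : b ≠ 0 := norm_pos_iff.1 (hm.trans_le hb)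
  have h := dist_div_norm_sq_smul ha0 hb0 1
  simp only [one_div, inv_pow, one_pow, dist_eq_norm] at h
  rw [h, inv_mul_eq_div, sq]
  gcongr

theorem norm_inversion (a : E) : ‖(‖a‖ ^ 2)⁻¹ • a‖ = ‖a‖⁻¹ := by
  rw [norm_smul, norm_inv, norm_pow, norm_norm]
  rcases eq_or_ne ‖a‖ 0 with h | h
  · simp [h]
  · field_simp

theorem norm_gradLogRatio_le {a b y : E} {m : ℝ} (hm : 0 < m) (ha : m ≤ ‖y - a‖)
    (hb : m ≤ ‖y - b‖) : ‖gradLogRatio a b y‖ ≤ 2 / m := by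
  refine (norm_sub_le _ _).trans ?_
  rw [norm_inversion, norm_inversion]
  have h1 : ‖y - a‖⁻¹ ≤ m⁻¹ := by gcongr
  have h2 : ‖y - b‖⁻¹ ≤ m⁻¹ := by gcongr
  rw [div_eq_mul_inv]
  linarith

theorem hasFDerivAt_log_norm_sub {a y : E} (h : y ≠ a) :
    HasFDerivAt (fun z => Real.log ‖z - a‖) (innerSL ℝ ((‖y - a‖ ^ 2)⁻¹ • (y - a))) y := by
  have hy : ‖y - a‖ ^ 2 ≠ 0 := by simpa [sub_eq_zero] using h
  have h1 : HasFDerivAt (fun z => ‖z - a‖ ^ 2) (2 • innerSL ℝ (y - a)) y := by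
    simpa using ((hasFDerivAt_id y).sub_const a).norm_sq
  have h2 := (h1.log hy).const_mul (1 / 2 : ℝ)
  refine (h2.congr_fderiv ?_).congr_of_eventuallyEq (Eventually.of_forall fun z => ?_)
  · ext v
    simp
    ring
  · simp

theorem hasFDerivAt_log_ratio {a b y : E} (ha : y ≠ a) (hb : y ≠ b) :
    HasFDerivAt (fun z => Real.log (‖z - a‖ / ‖z - b‖)) (innerSL ℝ (gradLogRatio a b y)) y := by
  have h := (hasFDerivAt_log_norm_sub ha).sub (hasFDerivAt_log_norm_sub hb)
  rw [← map_sub] at h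
  refine h.congr_of_eventuallyEq ?_
  filter_upwards [isOpen_ne.mem_nhds ha, isOpen_ne.mem_nhds hb] with z hza hzb
  exact Real.log_div (norm_ne_zero_iff.2 (sub_ne_zero.2 hza))
    (norm_ne_zero_iff.2 (sub_ne_zero.2 hzb))

theorem norm_gradLogRatio_sub_le {a b a' b' y : E} {m σ : ℝ} (hm : 0 < m) (ha : m ≤ ‖y - a‖)
    (hb : m ≤ ‖y - b‖) (ha' : m ≤ ‖y - a'‖) (hb' : m ≤ ‖y - b'‖) (haa : ‖a - a'‖ ≤ σ)
    (hbb : ‖b - b'‖ ≤ σ) :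
    ‖gradLogRatio a b y - gradLogRatio a' b' y‖ ≤ 2 * σ / m ^ 2 := by
  have key : ∀ {u v : E}, m ≤ ‖y - u‖ → m ≤ ‖y - v‖ → ‖u - v‖ ≤ σ →
      ‖(‖y - u‖ ^ 2)⁻¹ • (y - u) - (‖y - v‖ ^ 2)⁻¹ • (y - v)‖ ≤ σ / m ^ 2 := by
    intro u v hu hv huv
    refine (norm_inversion_sub_le hm hu hv).trans ?_
    gcongr
    rwa [sub_sub_sub_cancel_left, norm_sub_rev]
  rw [gradLogRatio, gradLogRatio, sub_sub_sub_comm]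
  refine (norm_sub_le _ _).trans ?_
  have h1 := key ha ha' haa
  have h2 := key hb hb' hbb
  rw [mul_div_assoc]
  linarith

end InnerProductSpace

theorem norm_reflPt_sub_reflPt (x y : Plane) : ‖reflPt x - reflPt y‖ = ‖x - y‖ := by
  simp only [EuclideanSpace.norm_eq, Fin.sum_univ_two, reflPt, mk2, PiLp.sub_apply]
  congr 1
  simp
  ring

theorem continuous_reflPt : Continuous reflPt :=
  (LipschitzWith.of_dist_le_mul (K := 1) fun x y => by
    simp [dist_eq_norm, norm_reflPt_sub_reflPt]).continuous

theorem norm_sub_le_norm_sub_reflPt {x y : Plane} (hx : 0 ≤ x 0) (hy : 0 ≤ y 0) :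
    ‖x - y‖ ≤ ‖x - reflPt y‖ := by
  simp only [EuclideanSpace.norm_eq, Fin.sum_univ_two, reflPt, mk2, PiLp.sub_apply]
  apply Real.sqrt_le_sqrt
  simp
  nlinarith [mul_nonneg hx hy]

theorem norm_sub_reflPt_self (y : Plane) : ‖y - reflPt y‖ = 2 * |y 0| := by
  simp only [EuclideanSpace.norm_eq, Fin.sum_univ_two, reflPt, mk2, PiLp.sub_apply]
  rw [Real.sqrt_eq_iff_mul_self_eq (by positivity) (by positivity)]
  simp
  nlinarith [abs_mul_abs_self (y 0)]

theorem abs_log_ratio_reflPt_le {x p : Plane} (hx : 0 ≤ x 0) (hp : 0 ≤ p 0) (hxp : x ≠ p) :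
    |Real.log (‖x - reflPt p‖ / ‖x - p‖)| ≤ 2 * p 0 / ‖x - p‖ := by
  have hd : 0 < ‖x - p‖ := norm_pos_iff.2 (sub_ne_zero.2 hxp)
  have hle := norm_sub_le_norm_sub_reflPt hx hp
  rw [Real.log_div (hd.trans_le hle).ne' hd.ne']
  refine (abs_log_sub_log_le hd hle le_rfl).trans ?_
  gcongr
  refine (abs_norm_sub_norm_le _ _).trans ?_
  rw [sub_sub_sub_cancel_left, norm_sub_reflPt_self, abs_of_nonneg hp]

theorem norm_gradLogRatio_reflPt_le {x p : Plane} (hx : 0 ≤ x 0) (hp : 0 ≤ p 0) (hxp : x ≠ p) :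
    ‖gradLogRatio (reflPt p) p x‖ ≤ 2 * p 0 / ‖x - p‖ ^ 2 := by
  have hd : 0 < ‖x - p‖ := norm_pos_iff.2 (sub_ne_zero.2 hxp)
  have hle := norm_sub_le_norm_sub_reflPt hx hp
  refine (norm_inversion_sub_le hd hle le_rfl).trans ?_
  rw [sub_sub_sub_cancel_left, norm_sub_reflPt_self, abs_of_nonneg hp]

theorem abs_coord_sub_le_norm (x y : Plane) (i : Fin 2) : |x i - y i| ≤ ‖x - y‖ := by
  simpa using PiLp.norm_apply_le (x - y) i

/-- Weighted averages over a small set against their value at the centre. -/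
theorem norm_setIntegral_sub_le {V : Type*} [NormedAddCommGroup V] [NormedSpace ℝ V]
    [CompleteSpace V] {c₁ c₂ κ₀ ε σ D : ℝ} (hc₁ : 0 < c₁) (hκ₀ : 0 < κ₀) (hε : 0 < ε)
    (hσ : 0 < σ) (hσc : σ ≤ c₁ / 2) (hD : 0 < D) {p : Plane} (hp₁ : c₁ ≤ p 0) (hp₂ : p 0 ≤ c₂)
    {A : Set Plane} (hA : MeasurableSet A) (hAp : A ⊆ Metric.ball p σ)
    (hκ : (∫ x in A, x 0) / ε ^ 2 ≤ κ₀) {f : Plane → V} (hf : IntegrableOn f A) {f₀ : V}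
    (hff : ∀ y ∈ A, ‖f y - f₀‖ ≤ 8 * σ / D) (hf₀ : ‖f₀‖ ≤ 2 * p 0 / D) :
    ‖((p 0) ^ 2 / (2 * π * ε ^ 2)) • (∫ y in A, f y) -
        ((∫ y in A, y 0) / ε ^ 2 * p 0 / (2 * π)) • f₀‖ ≤
      10 * c₂ ^ 2 * κ₀ / (c₁ * π) * σ / D := by
  have hp0 : 0 < p 0 := hc₁.trans_le hp₁
  have hAfin : volume A < ⊤ := (measure_mono hAp).trans_lt measure_ball_lt_top
  have hcoord : ∀ y ∈ A, |y 0 - p 0| ≤ σ := fun y hy =>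
    (abs_coord_sub_le_norm y p 0).trans (by simpa [dist_eq_norm] using (hAp hy).le)
  have hint0 : IntegrableOn (fun y : Plane => y 0) A := by
    refine Measure.integrableOn_of_bounded (M := p 0 + σ) hAfin.ne (by fun_prop) ?_
    refine (ae_restrict_mem hA).mono fun y hy => ?_
    have := abs_le.1 (hcoord y hy)
    rw [Real.norm_eq_abs, abs_le]
    constructor <;> linarith
  have hm : c₁ / 2 * volume.real A ≤ κ₀ * ε ^ 2 := by
    rw [div_le_iff₀ (by positivity)] at hκ
    refine le_trans ?_ hκ
    have : ∫ _ in A, c₁ / 2 ≤ ∫ y in A, y 0 := by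
      refine setIntegral_mono_on (integrableOn_const hAfin.ne) hint0 hA fun y hy => ?_
      have := abs_le.1 (hcoord y hy)
      linarith
    rw [setIntegral_const, smul_eq_mul] at this
    linarith
  have hB : ‖∫ y in A, (p 0 • f y - y 0 • f₀)‖ ≤ 10 * p 0 * σ / D * volume.real A := by
    refine norm_setIntegral_le_of_norm_le_const hAfin fun y hy => ?_
    have : p 0 • f y - y 0 • f₀ = p 0 • (f y - f₀) - (y 0 - p 0) • f₀ := by module
    rw [this]
    refine (norm_sub_le _ _).trans ?_
    rw [norm_smul, norm_smul, Real.norm_eq_abs, Real.norm_eq_abs, abs_of_pos hp0]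
    calc p 0 * ‖f y - f₀‖ + |y 0 - p 0| * ‖f₀‖ ≤ p 0 * (8 * σ / D) + σ * (2 * p 0 / D) := by
          gcongr
          · exact hff y hy
          · exact hcoord y hy
      _ = 10 * p 0 * σ / D := by ring
  have heq : ((p 0) ^ 2 / (2 * π * ε ^ 2)) • (∫ y in A, f y) -
        ((∫ y in A, y 0) / ε ^ 2 * p 0 / (2 * π)) • f₀ =
      (p 0 / (2 * π * ε ^ 2)) • ∫ y in A, (p 0 • f y - y 0 • f₀) := by
    rw [integral_sub (f := fun y => p 0 • f y) (hf.smul (p 0)) (hint0.smul_const f₀), integral_smul,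
      integral_smul_const, smul_sub, smul_smul, smul_smul]
    congr 2
    · ring
    · field_simp
  rw [heq, norm_smul, Real.norm_eq_abs, abs_of_pos (by positivity)]
  calc p 0 / (2 * π * ε ^ 2) * ‖∫ y in A, (p 0 • f y - y 0 • f₀)‖
      ≤ p 0 / (2 * π * ε ^ 2) * (10 * p 0 * σ / D * volume.real A) := by gcongr
    _ = 10 * (p 0) ^ 2 / (c₁ * π) * σ / D / ε ^ 2 * (c₁ / 2 * volume.real A) := by
        field_simp
    _ ≤ 10 * (p 0) ^ 2 / (c₁ * π) * σ / D / ε ^ 2 * (κ₀ * ε ^ 2) := by gcongr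
    _ = 10 * (p 0) ^ 2 * κ₀ / (c₁ * π) * σ / D := by field_simp
    _ ≤ 10 * c₂ ^ 2 * κ₀ / (c₁ * π) * σ / D := by gcongr

/-- Differentiation under the integral sign for the logarithmic potential of a set of finite
measure, away from that set and its reflection. -/
theorem hasGradientAt_setIntegral_log_ratio {A : Set Plane} (hA : MeasurableSet A)
    (hAfin : volume A < ⊤) {x : Plane} {σ : ℝ} (hσ : 0 < σ) (h₁ : ∀ y ∈ A, σ ≤ ‖x - y‖)
    (h₂ : ∀ y ∈ A, σ ≤ ‖x - reflPt y‖)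
    (hint : IntegrableOn (fun y => Real.log (‖x - reflPt y‖ / ‖x - y‖)) A) :
    IntegrableOn (fun y => gradLogRatio (reflPt y) y x) A ∧
      HasGradientAt (fun z => ∫ y in A, Real.log (‖z - reflPt y‖ / ‖z - y‖))
        (∫ y in A, gradLogRatio (reflPt y) y x) x := by
  have hrm : Measurable reflPt := continuous_reflPt.measurable
  have hmeas : ∀ z : Plane, Measurable fun y => Real.log (‖z - reflPt y‖ / ‖z - y‖) := by
    intro z
    fun_prop
  have hgmeas : Measurable fun y => gradLogRatio (reflPt y) y x := by
    unfold gradLogRatio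
    fun_prop
  have hfar : ∀ {z w : Plane}, z ∈ Metric.ball x (σ / 2) → σ ≤ ‖x - w‖ → σ / 2 ≤ ‖z - w‖ := by
    intro z w hz hw
    have := norm_sub_le_norm_sub_add_norm_sub x z w
    rw [Metric.mem_ball, dist_eq_norm, norm_sub_rev] at hz
    linarith
  have hgint : IntegrableOn (fun y => gradLogRatio (reflPt y) y x) A :=
    Measure.integrableOn_of_bounded (M := 2 / σ) hAfin.ne hgmeas.aestronglyMeasurable
      ((ae_restrict_mem hA).mono fun y hy => norm_gradLogRatio_le hσ (h₂ y hy) (h₁ y hy))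
  refine ⟨hgint, ?_⟩
  have hσ2 : 0 < σ / 2 := by positivity
  have hne : ∀ {u : Plane}, σ / 2 ≤ ‖u‖ → u ≠ 0 := fun h => norm_pos_iff.1 (hσ2.trans_le h)
  have hD := hasFDerivAt_integral_of_dominated_of_fderiv_le (𝕜 := ℝ) (μ := volume.restrict A)
    (F := fun z y => Real.log (‖z - reflPt y‖ / ‖z - y‖))
    (F' := fun z y => innerSL ℝ (gradLogRatio (reflPt y) y z)) (x₀ := x)
    (bound := fun _ => 2 / (σ / 2)) (Metric.ball_mem_nhds x hσ2)
    (Eventually.of_forall fun z => (hmeas z).aestronglyMeasurable) hint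
    ((innerSL ℝ).continuous.measurable.comp hgmeas).aestronglyMeasurable
    ((ae_restrict_mem hA).mono fun y hy z hz => by
      rw [innerSL_apply_norm]
      exact norm_gradLogRatio_le hσ2 (hfar hz (h₂ y hy)) (hfar hz (h₁ y hy)))
    (integrableOn_const hAfin.ne)
    ((ae_restrict_mem hA).mono fun y hy z hz =>
      hasFDerivAt_log_ratio (sub_ne_zero.1 (hne (hfar hz (h₂ y hy))))
        (sub_ne_zero.1 (hne (hfar hz (h₁ y hy)))))
  rw [hasGradientAt_iff_hasFDerivAt]
  refine hD.congr_fderiv ?_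
  exact (innerSL ℝ).integral_comp_comm hgint

/-- **Far-field expansion of the half-plane potential of a concentrated vorticity**
(Lemma 3.4). If `A ⊆ B_σ(p)` with `p = (p₁,0)`, `c₁ ≤ p₁ ≤ c₂`, and circulation
`κ = ε⁻² ∫_A x₁ ≤ κ₀`, then for `|x − p| ≥ Lσ` the potential
`ψ₁(x) = (p₁²/2πε²) ∫_A ln(|x−x̄'|/|x−x'|)` equals `(κp₁/2π) ln(|x−p̄|/|x−p|)` up to
`O(σ/|x−p|)`, and its gradient equals `−(κp₁/2π)[(x−p)/|x−p|² − (x−p̄)/|x−p̄|²]` up to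
`O(σ/|x−p|²)`. -/
theorem far_field_expansion (c₁ c₂ κ₀ L : ℝ)
    (hc₁ : 0 < c₁) (hc₂ : 0 < c₂) (hκ₀ : 0 < κ₀) (hL : 2 ≤ L) :
    ∃ C > (0 : ℝ), ∀ ε : ℝ, 0 < ε → ∀ σ : ℝ, 0 < σ → σ ≤ min (c₁ / 2) 1 →
      ∀ p₁ : ℝ, c₁ ≤ p₁ → p₁ ≤ c₂ →
        ∀ A : Set Plane, MeasurableSet A → A ⊆ Metric.ball (mk2 p₁ 0) σ →
          (∫ x in A, x 0) / ε ^ 2 ≤ κ₀ →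
          ∀ x ∈ halfPlane, L * σ ≤ ‖x - mk2 p₁ 0‖ →
            let p : Plane := mk2 p₁ 0
            let κ : ℝ := (∫ x' in A, x' 0) / ε ^ 2
            let ψ₁ : Plane → ℝ := fun y =>
              p₁ ^ 2 / (2 * π * ε ^ 2) * ∫ x' in A, Real.log (‖y - reflPt x'‖ / ‖y - x'‖)
            |ψ₁ x - κ * p₁ / (2 * π) * Real.log (‖x - reflPt p‖ / ‖x - p‖)|
                ≤ C * σ / ‖x - p‖ ∧
            DifferentiableAt ℝ ψ₁ x ∧
            ‖gradient ψ₁ x + (κ * p₁ / (2 * π)) •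
                ((‖x - p‖ ^ 2)⁻¹ • (x - p) - (‖x - reflPt p‖ ^ 2)⁻¹ • (x - reflPt p))‖
              ≤ C * σ / ‖x - p‖ ^ 2 := by
  refine ⟨10 * c₂ ^ 2 * κ₀ / (c₁ * π), by positivity, ?_⟩
  intro ε hε σ hσ hσle p₁ hp₁ hp₂ A hA hAp hκ x hx hxp
  dsimp only
  have hp : (mk2 p₁ 0) 0 = p₁ := by simp [mk2]
  generalize mk2 p₁ 0 = p at *
  obtain rfl : p 0 = p₁ := hp
  have hσc : σ ≤ c₁ / 2 := hσle.trans (min_le_left _ _)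
  have hp0 : 0 ≤ p 0 := hc₁.le.trans hp₁
  have hx0 : 0 ≤ x 0 := le_of_lt hx
  have hd : 2 * σ ≤ ‖x - p‖ := le_trans (by gcongr) hxp
  have hd0 : 0 < ‖x - p‖ := lt_of_lt_of_le (by positivity) hd
  have hne : x ≠ p := sub_ne_zero.1 (norm_pos_iff.1 hd0)
  have hAfin : volume A < ⊤ := (measure_mono hAp).trans_lt measure_ball_lt_top
  have hnear : ∀ y ∈ A, ‖y - p‖ ≤ σ := fun y hy => by
    simpa [dist_eq_norm] using (hAp hy).le
  have hy0 : ∀ y ∈ A, 0 ≤ y 0 := fun y hy => by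
    have := abs_le.1 ((abs_coord_sub_le_norm y p 0).trans (hnear y hy))
    linarith
  have hhalf : ∀ y ∈ A, ‖x - p‖ / 2 ≤ ‖x - y‖ := fun y hy => by
    have := norm_sub_le_norm_sub_add_norm_sub x y p
    have := hnear y hy
    linarith
  have hhalf' : ∀ y ∈ A, ‖x - p‖ / 2 ≤ ‖x - reflPt y‖ := fun y hy =>
    (hhalf y hy).trans (norm_sub_le_norm_sub_reflPt hx0 (hy0 y hy))
  have hpp : ‖x - p‖ / 2 ≤ ‖x - p‖ := by linarith
  have hpp' : ‖x - p‖ / 2 ≤ ‖x - reflPt p‖ := hpp.trans (norm_sub_le_norm_sub_reflPt hx0 hp0)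
  have hlog : ∀ y ∈ A, ‖Real.log (‖x - reflPt y‖ / ‖x - y‖) -
      Real.log (‖x - reflPt p‖ / ‖x - p‖)‖ ≤ 4 * σ / ‖x - p‖ := fun y hy =>
    (abs_log_ratio_sub_le (half_pos hd0) (hhalf' y hy) (hhalf y hy) hpp' hpp
      ((norm_reflPt_sub_reflPt y p).trans_le (hnear y hy)) (hnear y hy)).trans_eq
      (by field_simp; norm_num)
  have hgrad : ∀ y ∈ A, ‖gradLogRatio (reflPt y) y x - gradLogRatio (reflPt p) p x‖ ≤
      8 * σ / ‖x - p‖ ^ 2 := fun y hy =>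
    (norm_gradLogRatio_sub_le (half_pos hd0) (hhalf' y hy) (hhalf y hy) hpp' hpp
      ((norm_reflPt_sub_reflPt y p).trans_le (hnear y hy)) (hnear y hy)).trans_eq
      (by field_simp; norm_num)
  have hlogint : IntegrableOn (fun y => Real.log (‖x - reflPt y‖ / ‖x - y‖)) A := by
    have hrm : Measurable reflPt := continuous_reflPt.measurable
    refine Measure.integrableOn_of_bounded
      (M := ‖Real.log (‖x - reflPt p‖ / ‖x - p‖)‖ + 4 * σ / ‖x - p‖) hAfin.ne
      (by fun_prop : Measurable _).aestronglyMeasurable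
      ((ae_restrict_mem hA).mono fun y hy => ?_)
    exact (norm_le_norm_add_norm_sub' _ _).trans (by gcongr; exact hlog y hy)
  obtain ⟨hgint, hG⟩ := hasGradientAt_setIntegral_log_ratio hA hAfin hσ
    (fun y hy => le_trans (by linarith) (hhalf y hy))
    (fun y hy => le_trans (by linarith) (hhalf' y hy)) hlogint
  have hG' := hasGradientAt_iff_hasFDerivAt.2
    ((hG.hasFDerivAt.const_mul ((p 0) ^ 2 / (2 * π * ε ^ 2))).congr_fderiv
      (map_smul (innerSL ℝ) _ _).symm)
  refine ⟨?_, hG'.differentiableAt, ?_⟩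
  · exact norm_setIntegral_sub_le hc₁ hκ₀ hε hσ hσc hd0 hp₁ hp₂ hA hAp hκ hlogint
      (fun y hy => (hlog y hy).trans (by gcongr; norm_num))
      (abs_log_ratio_reflPt_le hx0 hp0 hne)
  · have h := norm_setIntegral_sub_le hc₁ hκ₀ hε hσ hσc (by positivity) hp₁ hp₂ hA hAp hκ hgint
      hgrad (norm_gradLogRatio_reflPt_le hx0 hp0 hne)
    rw [hG'.gradient]
    convert h using 1
    congr 1
    simp only [gradLogRatio]
    module
end
end

section
/- (Uniform bound on the kinetic energy of the vortex core.) For all κ₀, δ₀ > 0 there exists C > 0 such that for every ε ∈ (0, 1], every W > 0, every μ > 0, and every stream function ψ of a steady vortex ring with parameters (ε, W, μ) whose cross-section A is contained in {x ∈ ℝ² : δ₀ ≤ x₁ ≤ 1/δ₀} and whose circulation is at most κ₀, one has ε^{−2} ∫_A x₁ (ψ(x) − (W/2) x₁² ln(1/ε) − μ) dx ≤ C (note the integrand is positive on A). -/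
open MeasureTheory Real Filter
open scoped RealInnerProductSpace

noncomputable section

/-- The Newtonian kernel `1/|p|` on `ℂ × ℝ ≅ ℝ³`. -/
def newtonKer (p : ℂ × ℝ) : ℝ := 1 / √(‖p.1‖ ^ 2 + p.2 ^ 2)

/-- The open Euclidean ball of radius `ρ` about the origin of `ℂ × ℝ ≅ ℝ³`. -/
def eBall (ρ : ℝ) : Set (ℂ × ℝ) := {p | ‖p.1‖ ^ 2 + p.2 ^ 2 < ρ ^ 2}

lemma newtonKer_nonneg (p : ℂ × ℝ) : 0 ≤ newtonKer p := by
  unfold newtonKer; positivity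

lemma measurable_newtonKer : Measurable newtonKer := by
  unfold newtonKer; fun_prop

lemma measurableSet_eBall (ρ : ℝ) : MeasurableSet (eBall ρ) :=
  measurableSet_lt (by fun_prop) (by fun_prop)

lemma newtonKer_le_inv_norm_fst (p : ℂ × ℝ) (hp : p.1 ≠ 0) : newtonKer p ≤ ‖p.1‖⁻¹ := by
  unfold newtonKer
  rw [one_div]
  have : 0 < ‖p.1‖ := norm_pos_iff.2 hp
  gcongr
  exact Real.le_sqrt_of_sq_le (by nlinarith [sq_nonneg p.2])

lemma eBall_subset_prod {ρ : ℝ} (hρ : 0 < ρ) :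
    eBall ρ ⊆ Metric.ball (0 : ℂ) ρ ×ˢ Set.Icc (-ρ) ρ := by
  intro p hp
  have hp : ‖p.1‖ ^ 2 + p.2 ^ 2 < ρ ^ 2 := hp
  refine ⟨?_, ?_⟩
  · rw [mem_ball_zero_iff]
    exact lt_of_pow_lt_pow_left₀ 2 hρ.le (by nlinarith [sq_nonneg p.2])
  · exact abs_le.1 (abs_le_of_sq_le_sq (by nlinarith [sq_nonneg ‖p.1‖]) hρ.le)

lemma volume_eBall_lt_top {ρ : ℝ} (hρ : 0 < ρ) : volume (eBall ρ) < ⊤ := by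
  refine (measure_mono (eBall_subset_prod hρ)).trans_lt ?_
  rw [Measure.volume_eq_prod, Measure.prod_prod]
  exact ENNReal.mul_lt_top Metric.isBounded_ball.measure_lt_top (by simp)

lemma lintegral_inv_norm_ball {E : Type*} [NormedAddCommGroup E] [NormedSpace ℝ E]
    [FiniteDimensional ℝ E] [MeasurableSpace E] [BorelSpace E] (μ : Measure E) [μ.IsAddHaarMeasure]
    (hE : Module.finrank ℝ E = 2) {ρ : ℝ} (hρ : 0 < ρ) :
    ∫⁻ y in Metric.ball (0 : E) ρ, ENNReal.ofReal ‖y‖⁻¹ ∂μ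
      = ENNReal.ofReal (2 * μ.real (Metric.ball 0 1) * ρ) := by
  have : Nontrivial E := Module.nontrivial_of_finrank_pos (R := ℝ) (by omega)
  have hint : IntegrableOn (fun y : E => ‖y‖⁻¹) (Metric.ball 0 ρ) μ := by
    rw [integrableOn_fun_norm_addHaar μ (f := fun r => r⁻¹), hE]
    refine (integrableOn_const (C := (1 : ℝ)) (s := Set.Ioo 0 ρ) (by simp) (by simp)).congr_fun
      ?_ measurableSet_Ioo
    intro r hr
    have : r ≠ 0 := hr.1.ne'
    simp [this]
  rw [← ofReal_integral_eq_lintegral_ofReal hint (ae_of_all _ fun y => by positivity)]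
  congr 1
  have := integral_fun_norm_addHaar μ (fun r => (Set.Iio ρ).indicator (fun r => r⁻¹) r)
  rw [← integral_indicator Metric.isOpen_ball.measurableSet]
  calc _ = ∫ x, (Set.Iio ρ).indicator (fun r => r⁻¹) ‖x‖ ∂μ := by
        congr 1 with x
        simp [Set.indicator]
    _ = _ := by
        rw [this, hE]
        have h1 : ∀ y ∈ Set.Ioi (0 : ℝ), y ^ (2 - 1) • (Set.Iio ρ).indicator (fun r => r⁻¹) y
            = (Set.Iio ρ).indicator (fun _ => 1) y := by
          intro y hy
          have : y ≠ 0 := (Set.mem_Ioi.1 hy).ne'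
          by_cases h : y < ρ <;> simp [h, this]
        rw [setIntegral_congr_fun measurableSet_Ioi h1, setIntegral_indicator measurableSet_Iio]
        simp [Set.Ioi_inter_Iio, hρ.le]
        ring

lemma lintegral_inv_norm_sub_ball {E : Type*} [NormedAddCommGroup E] [NormedSpace ℝ E]
    [FiniteDimensional ℝ E] [MeasurableSpace E] [BorelSpace E] (μ : Measure E) [μ.IsAddHaarMeasure]
    (hE : Module.finrank ℝ E = 2) {ρ : ℝ} (hρ : 0 < ρ) (x : E) :
    ∫⁻ y in Metric.ball x ρ, ENNReal.ofReal ‖y - x‖⁻¹ ∂μ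
      = ENNReal.ofReal (2 * μ.real (Metric.ball 0 1) * ρ) := by
  rw [← lintegral_inv_norm_ball μ hE hρ, ← lintegral_indicator Metric.isOpen_ball.measurableSet,
    ← lintegral_indicator Metric.isOpen_ball.measurableSet,
    ← lintegral_sub_right_eq_self
      (fun y => (Metric.ball (0 : E) ρ).indicator (fun y => ENNReal.ofReal ‖y‖⁻¹) y) x]
  congr 1 with y
  simp [Set.indicator, dist_eq_norm]

lemma exists_lintegral_inv_norm_sub_le {E : Type*} [NormedAddCommGroup E] [NormedSpace ℝ E]
    [FiniteDimensional ℝ E] [MeasurableSpace E] [BorelSpace E] (μ : Measure E) [μ.IsAddHaarMeasure]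
    (hE : Module.finrank ℝ E = 2) (S : Set E) (x : E) :
    ∫⁻ y in S, ENNReal.ofReal ‖y - x‖⁻¹ ∂μ
      ≤ ENNReal.ofReal (2 * μ.real (Metric.ball 0 1)) + μ S := by
  calc ∫⁻ y in S, ENNReal.ofReal ‖y - x‖⁻¹ ∂μ
      ≤ ∫⁻ y in S, ((Metric.ball x 1).indicator (fun y => ENNReal.ofReal ‖y - x‖⁻¹) y + 1) ∂μ := by
        refine lintegral_mono fun y => ?_
        by_cases h : y ∈ Metric.ball x 1
        · simp only [Set.indicator_of_mem h]; exact le_self_add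
        · simp only [Set.indicator_of_notMem h, zero_add]
          rw [ENNReal.ofReal_le_one]
          rw [Metric.mem_ball, dist_eq_norm, not_lt] at h
          exact inv_le_one_of_one_le₀ h
    _ ≤ _ := by
        rw [lintegral_add_right _ measurable_const]
        gcongr
        · refine (setLIntegral_le_lintegral _ _).trans ?_
          rw [lintegral_indicator Metric.isOpen_ball.measurableSet,
            lintegral_inv_norm_sub_ball μ hE one_pos, mul_one]
        · simp

/-- The integral of the Newtonian kernel over a ball is bounded, uniformly in the pole. -/
lemma exists_lintegral_newtonKer_le {ρ : ℝ} (hρ : 0 < ρ) :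
    ∃ K : NNReal, ∀ y : ℂ × ℝ, ∫⁻ p in eBall ρ, ENNReal.ofReal (newtonKer (p - y)) ≤ K := by
  have hfin : (ENNReal.ofReal (2 * volume.real (Metric.ball (0 : ℂ) 1))
      + volume (Metric.ball (0 : ℂ) ρ)) * volume (Set.Icc (-ρ) ρ) < ⊤ :=
    ENNReal.mul_lt_top (ENNReal.add_lt_top.2
      ⟨ENNReal.ofReal_lt_top, Metric.isBounded_ball.measure_lt_top⟩) (by simp)
  refine ⟨((ENNReal.ofReal (2 * volume.real (Metric.ball (0 : ℂ) 1))
      + volume (Metric.ball (0 : ℂ) ρ)) * volume (Set.Icc (-ρ) ρ)).toNNReal, fun y => ?_⟩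
  rw [ENNReal.coe_toNNReal hfin.ne]
  calc _ ≤ ∫⁻ p in Metric.ball (0 : ℂ) ρ ×ˢ Set.Icc (-ρ) ρ, ENNReal.ofReal (newtonKer (p - y)) :=
        lintegral_mono_set (eBall_subset_prod hρ)
    _ = ∫⁻ z in Set.Icc (-ρ) ρ, ∫⁻ w in Metric.ball (0 : ℂ) ρ,
          ENNReal.ofReal (newtonKer ((w, z) - y)) := by
        rw [Measure.volume_eq_prod, ← Measure.prod_restrict, lintegral_prod_symm]
        exact (measurable_newtonKer.comp (by fun_prop)).ennreal_ofReal.aemeasurable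
    _ ≤ ∫⁻ z in Set.Icc (-ρ) ρ, (ENNReal.ofReal (2 * volume.real (Metric.ball (0 : ℂ) 1))
          + volume (Metric.ball (0 : ℂ) ρ)) := by
        refine lintegral_mono fun z => ?_
        refine le_trans ?_ (exists_lintegral_inv_norm_sub_le volume Complex.finrank_real_complex
          (Metric.ball (0 : ℂ) ρ) y.1)
        refine lintegral_mono_ae (ae_restrict_of_ae ?_)
        filter_upwards [compl_mem_ae_iff.2 (measure_singleton (μ := volume) y.1)] with w hw
        exact ENNReal.ofReal_le_ofReal
          (newtonKer_le_inv_norm_fst ((w, z) - y) (sub_ne_zero.2 hw))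
    _ = _ := by simp

lemma integrableOn_newtonKer_sub {ρ : ℝ} (hρ : 0 < ρ) (y : ℂ × ℝ) :
    IntegrableOn (fun p => newtonKer (p - y)) (eBall ρ) := by
  obtain ⟨K, hK⟩ := exists_lintegral_newtonKer_le hρ
  refine ⟨(measurable_newtonKer.comp (by fun_prop)).aestronglyMeasurable, ?_⟩
  rw [hasFiniteIntegral_iff_ofReal (ae_of_all _ fun p => newtonKer_nonneg _)]
  exact (hK y).trans_lt ENNReal.coe_lt_top

lemma integral_eBall_axial {ρ : ℝ} (hρ : 0 < ρ) (F : ℝ → ℝ → ℝ)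
    (hF : IntegrableOn (fun p : ℂ × ℝ => F ‖p.1‖ p.2) (eBall ρ)) :
    ∫ p in eBall ρ, F ‖p.1‖ p.2
      = ∫ z in (-ρ)..ρ, 2 * π * ∫ r in (0 : ℝ)..√(ρ ^ 2 - z ^ 2), r * F r z := by
  have hmeas := measurableSet_eBall ρ
  rw [← integral_indicator hmeas, Measure.volume_eq_prod, integral_prod_symm _
    ((integrable_indicator_iff hmeas).2 hF), intervalIntegral.integral_of_le (by linarith),
    ← integral_indicator measurableSet_Ioc]
  congr 1 with z
  have h1 : ∀ w : ℂ, (eBall ρ).indicator (fun p : ℂ × ℝ => F ‖p.1‖ p.2) (w, z)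
      = ({r : ℝ | r ^ 2 + z ^ 2 < ρ ^ 2}.indicator (fun r => F r z)) ‖w‖ := by
    intro w
    by_cases h : ‖w‖ ^ 2 + z ^ 2 < ρ ^ 2
    · rw [Set.indicator_of_mem (show (w, z) ∈ eBall ρ from h),
        Set.indicator_of_mem (show ‖w‖ ∈ {r : ℝ | r ^ 2 + z ^ 2 < ρ ^ 2} from h)]
    · rw [Set.indicator_of_notMem (show (w, z) ∉ eBall ρ from h),
        Set.indicator_of_notMem (show ‖w‖ ∉ {r : ℝ | r ^ 2 + z ^ 2 < ρ ^ 2} from h)]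
  simp_rw [h1]
  rw [integral_fun_norm_addHaar volume, Complex.finrank_real_complex]
  have hvol : volume.real (Metric.ball (0 : ℂ) 1) = π := by
    simp [Measure.real, Complex.volume_ball]
  rw [hvol]
  have hset : MeasurableSet {r : ℝ | r ^ 2 + z ^ 2 < ρ ^ 2} :=
    measurableSet_lt (by fun_prop) (by fun_prop)
  have h2 : ∀ y : ℝ, y ^ (2 - 1) • ({r : ℝ | r ^ 2 + z ^ 2 < ρ ^ 2}.indicator (fun r => F r z)) y
      = ({r : ℝ | r ^ 2 + z ^ 2 < ρ ^ 2}.indicator (fun r => r * F r z)) y := by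
    intro y; by_cases h : y ^ 2 + z ^ 2 < ρ ^ 2 <;> simp [h]
  simp_rw [h2]
  rw [setIntegral_indicator hset]
  have h3 : Set.Ioi 0 ∩ {r : ℝ | r ^ 2 + z ^ 2 < ρ ^ 2} = Set.Ioo 0 √(ρ ^ 2 - z ^ 2) := by
    ext r
    simp only [Set.mem_inter_iff, Set.mem_Ioi, Set.mem_ofPred_eq, Set.mem_Ioo]
    refine and_congr_right fun hr => ?_
    rw [Real.lt_sqrt hr.le]
    exact (lt_sub_iff_add_lt).symm
  rw [h3, ← integral_Ioc_eq_integral_Ioo, ← intervalIntegral.integral_of_le (Real.sqrt_nonneg _)]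
  by_cases hz : z ∈ Set.Ioc (-ρ) ρ
  · rw [Set.indicator_of_mem hz]; simp; ring
  · rw [Set.indicator_of_notMem hz]
    have : ρ ^ 2 - z ^ 2 ≤ 0 := by
      by_contra! h
      have := abs_lt.1 (abs_lt_of_sq_lt_sq (by linarith : z ^ 2 < ρ ^ 2) hρ.le)
      exact hz ⟨this.1, this.2.le⟩
    rw [Real.sqrt_eq_zero_of_nonpos this]
    simp

lemma integral_eBall_one {ρ : ℝ} (hρ : 0 < ρ) :
    ∫ _p in eBall ρ, (1 : ℝ) = 4 * π / 3 * ρ ^ 3 := by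
  rw [integral_eBall_axial hρ (fun _ _ => 1)
    (integrableOn_const (volume_eBall_lt_top hρ).ne)]
  have h : ∀ z ∈ Set.uIcc (-ρ) ρ, 2 * π * ∫ r in (0 : ℝ)..√(ρ ^ 2 - z ^ 2), r * 1
      = π * (ρ ^ 2 - z ^ 2) := by
    intro z hz
    rw [Set.uIcc_of_le (by linarith)] at hz
    have : 0 ≤ ρ ^ 2 - z ^ 2 := by nlinarith [hz.1, hz.2]
    simp [Real.sq_sqrt this]
    ring
  rw [intervalIntegral.integral_congr h]
  simp
  ring

lemma volume_real_eBall {ρ : ℝ} (hρ : 0 < ρ) : volume.real (eBall ρ) = 4 * π / 3 * ρ ^ 3 := by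
  rw [← integral_eBall_one hρ]; simp

lemma integral_id_div_sqrt (R : ℝ) {c : ℝ} (hc : 0 < c) :
    ∫ r in (0 : ℝ)..R, r * (1 / √(r ^ 2 + c ^ 2)) = √(R ^ 2 + c ^ 2) - c := by
  have hpos : ∀ r : ℝ, 0 < r ^ 2 + c ^ 2 := fun r => by positivity
  rw [intervalIntegral.integral_eq_sub_of_hasDerivAt (f := fun r => √(r ^ 2 + c ^ 2))]
  · simp [Real.sqrt_sq hc.le]
  · intro r _
    have := (((hasDerivAt_pow 2 r).add_const (c ^ 2)).sqrt (hpos r).ne')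
    refine this.congr_deriv ?_
    have := (Real.sqrt_pos.2 (hpos r)).ne'
    simp only [Nat.cast_ofNat]
    field_simp
    norm_num
  · refine Continuous.intervalIntegrable ?_ _ _
    refine continuous_id.mul (continuous_const.div (by fun_prop) fun r => ?_)
    exact (Real.sqrt_pos.2 (hpos r)).ne'

lemma integral_sqrt_sub_mul {ρ d : ℝ} (hρ : 0 < ρ) (hd : ρ ≤ d) :
    ∫ z in (-ρ)..ρ, √(ρ ^ 2 + d ^ 2 - 2 * z * d) = ((d + ρ) ^ 3 - (d - ρ) ^ 3) / (3 * d) := by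
  have hd0 : 0 < d := hρ.trans_le hd
  have hs1 : √(ρ ^ 2 + d ^ 2 - 2 * ρ * d) = d - ρ := by
    rw [show ρ ^ 2 + d ^ 2 - 2 * ρ * d = (d - ρ) ^ 2 by ring, Real.sqrt_sq (by linarith)]
  have hs2 : √(ρ ^ 2 + d ^ 2 - 2 * (-ρ) * d) = d + ρ := by
    rw [show ρ ^ 2 + d ^ 2 - 2 * (-ρ) * d = (d + ρ) ^ 2 by ring, Real.sqrt_sq (by linarith)]
  rw [intervalIntegral.integral_eq_sub_of_hasDerivAt_of_le (by linarith)
    (f := fun z => -(1 / (3 * d)) * ((ρ ^ 2 + d ^ 2 - 2 * z * d) * √(ρ ^ 2 + d ^ 2 - 2 * z * d)))]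
  · rw [hs1, hs2]
    field_simp
    ring
  · fun_prop
  · intro z hz
    have hu : 0 < ρ ^ 2 + d ^ 2 - 2 * z * d := by nlinarith [hz.2, sq_nonneg (d - ρ)]
    have h1 : HasDerivAt (fun z => ρ ^ 2 + d ^ 2 - 2 * z * d) (-(2 * d)) z := by
      have := (((hasDerivAt_id z).const_mul 2).mul_const d).const_sub (ρ ^ 2 + d ^ 2)
      simpa using this
    refine ((h1.mul (h1.sqrt hu.ne')).const_mul (-(1 / (3 * d)))).congr_deriv ?_
    have hsq := Real.sq_sqrt hu.le
    have hp := Real.sqrt_pos.2 hu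
    set s := √(ρ ^ 2 + d ^ 2 - 2 * z * d)
    rw [← hsq]
    field_simp
    norm_num
  · exact (Continuous.intervalIntegrable (by fun_prop) _ _)

lemma integral_newtonKer_sub_axis {ρ d : ℝ} (hρ : 0 < ρ) (hd : ρ ≤ d) :
    ∫ p in eBall ρ, newtonKer (p - ((0 : ℂ), d)) = 4 * π / 3 * ρ ^ 3 * newtonKer ((0 : ℂ), d) := by
  have hd0 : 0 < d := hρ.trans_le hd
  have hint := integrableOn_newtonKer_sub hρ ((0 : ℂ), d)
  have h0 : ∀ p : ℂ × ℝ, newtonKer (p - ((0 : ℂ), d))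
      = (fun r z => 1 / √(r ^ 2 + (d - z) ^ 2)) ‖p.1‖ p.2 := by
    intro p; simp only [newtonKer, Prod.fst_sub, Prod.snd_sub, sub_zero]
    rw [← neg_sub d p.2, neg_sq]
  simp_rw [h0] at hint ⊢
  rw [integral_eBall_axial hρ (fun r z => 1 / √(r ^ 2 + (d - z) ^ 2)) hint]
  have h1 : ∀ z ∈ Set.uIcc (-ρ) ρ,
      2 * π * ∫ r in (0 : ℝ)..√(ρ ^ 2 - z ^ 2), r * (1 / √(r ^ 2 + (d - z) ^ 2))
      = 2 * π * (√(ρ ^ 2 + d ^ 2 - 2 * z * d) - (d - z)) := by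
    intro z hz
    rw [Set.uIcc_of_le (by linarith)] at hz
    have h2 : 0 ≤ ρ ^ 2 - z ^ 2 := by nlinarith [hz.1, hz.2]
    congr 1
    rcases (sub_nonneg.2 (hz.2.trans hd)).eq_or_lt with h | h
    · have : d = z := by linarith
      have : ρ = z := le_antisymm (by linarith) hz.2
      subst this
      subst_vars
      have : d ^ 2 + d ^ 2 - 2 * d * d = 0 := by ring
      simp [this]
    · rw [integral_id_div_sqrt _ h, Real.sq_sqrt h2]
      congr 2; ring
  rw [intervalIntegral.integral_congr h1, intervalIntegral.integral_const_mul,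
    intervalIntegral.integral_sub (Continuous.intervalIntegrable (by fun_prop) _ _)
      (Continuous.intervalIntegrable (by fun_prop) _ _), integral_sqrt_sub_mul hρ hd,
    intervalIntegral.integral_sub (by simp) (by simp)]
  simp [newtonKer, Real.sqrt_sq hd0.le]
  field_simp
  ring

/-- Rotation invariance of the potential of a ball. -/
lemma integral_newtonKer_sub_eq_of_norm_eq {ρ : ℝ} (y y' : ℂ × ℝ)
    (h : ‖y.1‖ ^ 2 + y.2 ^ 2 = ‖y'.1‖ ^ 2 + y'.2 ^ 2) :
    ∫ p in eBall ρ, newtonKer (p - y) = ∫ p in eBall ρ, newtonKer (p - y') := by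
  have hn : ∀ p : WithLp 2 (ℂ × ℝ), ‖p‖ ^ 2 = ‖p.ofLp.1‖ ^ 2 + p.ofLp.2 ^ 2 := by
    intro p; rw [WithLp.prod_norm_sq_eq_of_L2]; simp
  have key : ∀ y : ℂ × ℝ, ∫ p in eBall ρ, newtonKer (p - y)
      = ∫ q : WithLp 2 (ℂ × ℝ), (Set.Iio (ρ ^ 2)).indicator
          (fun _ => 1 / √(‖q - WithLp.toLp 2 y‖ ^ 2)) (‖q‖ ^ 2) := by
    intro y
    rw [← integral_indicator (measurableSet_eBall ρ),
      ← (WithLp.volume_preserving_ofLp ℂ ℝ).integral_comp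
        (MeasurableEquiv.toLp 2 (ℂ × ℝ)).symm.measurableEmbedding]
    congr 1 with q
    simp only [Set.indicator, eBall, Set.mem_ofPred_eq, Set.mem_Iio, hn, newtonKer]
    rfl
  have hyy : ‖WithLp.toLp 2 y‖ = ‖WithLp.toLp 2 y'‖ := by
    rw [← sq_eq_sq₀ (norm_nonneg _) (norm_nonneg _), hn, hn]; exact h
  rw [key, key]
  set T := (Submodule.span ℝ {WithLp.toLp 2 y' - WithLp.toLp 2 y})ᗮ.reflection
  have hT : T (WithLp.toLp 2 y') = WithLp.toLp 2 y := Submodule.reflection_sub hyy.symm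
  rw [← (T.measurePreserving).integral_comp T.toMeasurableEquiv.measurableEmbedding]
  congr 1 with q
  rw [← hT, ← map_sub, T.norm_map, T.norm_map]

/-- Newton's theorem: the mean over a ball of the Newtonian kernel with pole outside the ball is
the value at the centre. -/
lemma integral_newtonKer_sub {ρ : ℝ} (hρ : 0 < ρ) (y : ℂ × ℝ)
    (hy : ρ ^ 2 ≤ ‖y.1‖ ^ 2 + y.2 ^ 2) :
    ∫ p in eBall ρ, newtonKer (p - y) = 4 * π / 3 * ρ ^ 3 * newtonKer y := by
  have h0 : 0 ≤ ‖y.1‖ ^ 2 + y.2 ^ 2 := by positivity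
  rw [integral_newtonKer_sub_eq_of_norm_eq y ((0 : ℂ), √(‖y.1‖ ^ 2 + y.2 ^ 2))
    (by simp [Real.sq_sqrt h0]), integral_newtonKer_sub_axis hρ (Real.le_sqrt_of_sq_le hy)]
  simp [newtonKer, Real.sq_sqrt h0]

lemma measurePreserving_rotate_fst (c : Circle) :
    MeasurePreserving (fun p : ℂ × ℝ => ((c : ℂ) * p.1, p.2)) :=
  ((rotation c).measurePreserving).prod (MeasurePreserving.id (volume : Measure ℝ))

lemma norm_fst_lt_of_mem_eBall {ρ : ℝ} (hρ : 0 < ρ) {p : ℂ × ℝ} (hp : p ∈ eBall ρ) :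
    ‖p.1‖ < ρ := by
  simpa using (eBall_subset_prod hρ hp).1

lemma integrableOn_eBall_fst {ρ a : ℝ} (hρ : 0 < ρ) (ha : ρ < a) {g : ℂ → ℂ}
    (hg : ContinuousOn g (Metric.ball 0 a)) :
    IntegrableOn (fun p => g p.1) (eBall ρ) := by
  obtain ⟨K, hK⟩ := (isCompact_closedBall (0 : ℂ) ρ).exists_bound_of_continuousOn
    (hg.mono (Metric.closedBall_subset_ball ha))
  refine IntegrableOn.of_bound (volume_eBall_lt_top hρ) ?_ K ?_
  · refine ContinuousOn.aestronglyMeasurable ?_ (measurableSet_eBall ρ)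
    refine hg.comp continuousOn_fst fun p hp => ?_
    simpa using (norm_fst_lt_of_mem_eBall hρ hp).trans ha
  · filter_upwards [ae_restrict_mem (measurableSet_eBall ρ)] with p hp
    exact hK _ (by simpa using (norm_fst_lt_of_mem_eBall hρ hp).le)

/-- The mean over a ball of a function holomorphic in the horizontal complex variable. -/
lemma integral_eBall_holomorphic {ρ a : ℝ} (hρ : 0 < ρ) (ha : ρ < a) {g : ℂ → ℂ}
    (hg : DifferentiableOn ℂ g (Metric.ball 0 a)) :
    ∫ p in eBall ρ, g p.1 = ((4 * π / 3 * ρ ^ 3 : ℝ) : ℂ) * g 0 := by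
  have hrot : ∀ φ : ℝ, ∫ p in eBall ρ, g (circleMap 0 1 φ * p.1) = ∫ p in eBall ρ, g p.1 := by
    intro φ
    have h := (measurePreserving_rotate_fst (Circle.exp φ)).setIntegral_preimage_emb
      (MeasurableEquiv.measurableEmbedding
        ((rotation (Circle.exp φ)).toMeasurableEquiv.prodCongr (MeasurableEquiv.refl ℝ)))
      (fun p => g p.1) (eBall ρ)
    have hpre : (fun p : ℂ × ℝ => ((Circle.exp φ : ℂ) * p.1, p.2)) ⁻¹' eBall ρ = eBall ρ := by
      ext p; simp [eBall]
    rw [hpre] at h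
    rw [← h]
    simp [circleMap, Circle.coe_exp]
  have hcircle : ∀ p ∈ eBall ρ,
      ∫ φ in (0 : ℝ)..(2 * π), g (circleMap 0 1 φ * p.1) = (2 * π : ℝ) • g 0 := by
    intro p hp
    have hd : DiffContOnCl ℂ (fun ζ => g (ζ * p.1)) (Metric.ball 0 |1|) := by
      refine DifferentiableOn.diffContOnCl ?_
      refine hg.comp (by fun_prop) fun ζ hζ => ?_
      have hζ := Metric.closure_ball_subset_closedBall hζ
      simp only [abs_one, Metric.mem_closedBall, dist_zero_right] at hζ
      have := norm_fst_lt_of_mem_eBall hρ hp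
      simp only [Metric.mem_ball, dist_zero_right, norm_mul]
      nlinarith [norm_nonneg p.1]
    have := hd.circleAverage
    rw [Real.circleAverage, inv_smul_eq_iff₀ (by positivity)] at this
    simpa using this
  have hfub := integral_integral_swap (μ := volume.restrict (Set.Ioc 0 (2 * π)))
    (ν := volume.restrict (eBall ρ)) (f := fun φ p => g (circleMap 0 1 φ * p.1)) ?_
  · rw [setIntegral_congr_fun (g := fun _ => ∫ p in eBall ρ, g p.1) measurableSet_Ioc
      fun φ _ => hrot φ] at hfub
    simp_rw [← intervalIntegral.integral_of_le Real.two_pi_pos.le] at hfub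
    rw [setIntegral_congr_fun (measurableSet_eBall ρ) hcircle] at hfub
    rw [intervalIntegral.integral_const, setIntegral_const, volume_real_eBall hρ, sub_zero,
      smul_comm] at hfub
    have := smul_right_injective ℂ (show (2 * π : ℝ) ≠ 0 by positivity) hfub
    rw [this, Complex.real_smul]
  · obtain ⟨K, hK⟩ := (isCompact_closedBall (0 : ℂ) ρ).exists_bound_of_continuousOn
      (hg.continuousOn.mono (Metric.closedBall_subset_ball ha))
    have hm : MeasurableSet (Set.Ioc 0 (2 * π) ×ˢ eBall ρ) :=
      measurableSet_Ioc.prod (measurableSet_eBall ρ)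
    rw [Measure.prod_restrict]
    refine IntegrableOn.of_bound ?_ ?_ K ?_
    · rw [Measure.prod_prod]
      exact ENNReal.mul_lt_top measure_Ioc_lt_top (volume_eBall_lt_top hρ)
    · refine ContinuousOn.aestronglyMeasurable ?_ hm
      refine hg.continuousOn.comp (by fun_prop) fun q hq => ?_
      simpa using (norm_fst_lt_of_mem_eBall hρ hq.2).trans ha
    · filter_upwards [ae_restrict_mem hm] with q hq
      exact hK _ (by simpa using (norm_fst_lt_of_mem_eBall hρ hq.2).le)

lemma integrableOn_eBall_re {ρ a : ℝ} (hρ : 0 < ρ) (ha : ρ < a) {g : ℂ → ℂ}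
    (hg : ContinuousOn g (Metric.ball 0 a)) :
    IntegrableOn (fun p => (g p.1).re) (eBall ρ) :=
  (integrableOn_eBall_fst hρ ha hg).re

lemma integral_eBall_re {ρ a : ℝ} (hρ : 0 < ρ) (ha : ρ < a) {g : ℂ → ℂ}
    (hg : DifferentiableOn ℂ g (Metric.ball 0 a)) :
    ∫ p in eBall ρ, (g p.1).re = 4 * π / 3 * ρ ^ 3 * (g 0).re := by
  have h := integral_re (integrableOn_eBall_fst hρ ha hg.continuousOn)
  have h2 := integral_eBall_holomorphic hρ ha hg
  simp only [RCLike.re_eq_complex_re] at h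
  rw [h, h2, Complex.re_ofReal_mul]

lemma add_ne_zero_of_mem_ball {a : ℝ} {w : ℂ} (hw : w ∈ Metric.ball (0 : ℂ) a) :
    (a : ℂ) + w ≠ 0 := by
  intro h
  rw [mem_ball_zero_iff, ← norm_neg, ← eq_neg_of_add_eq_zero_left h, Complex.norm_real] at hw
  exact absurd (le_abs_self a) (not_le.2 hw)

lemma differentiableOn_inv_add (a : ℝ) :
    DifferentiableOn ℂ (fun w : ℂ => ((a : ℂ) + w)⁻¹) (Metric.ball 0 a) := by
  refine DifferentiableOn.inv (by fun_prop) fun w hw => add_ne_zero_of_mem_ball hw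

@[simp] lemma mk2_zero (a b : ℝ) : mk2 a b 0 = a := rfl

@[simp] lemma mk2_one (a b : ℝ) : mk2 a b 1 = b := rfl

lemma mk2_self (x : Plane) : mk2 (x 0) (x 1) = x := by
  ext i; fin_cases i <;> rfl

lemma measurePreserving_mk2 : MeasurePreserving (fun p : ℝ × ℝ => mk2 p.1 p.2) := by
  have h := (PiLp.volume_preserving_toLp (Fin 2)).comp
    ((volume_preserving_finTwoArrow ℝ).symm)
  exact h

lemma plane_norm_sub_sq (x y : Plane) : ‖x - y‖ ^ 2 = (x 0 - y 0) ^ 2 + (x 1 - y 1) ^ 2 := by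
  rw [EuclideanSpace.real_norm_sq_eq, Fin.sum_univ_two]; simp

/-- The point of `ℂ × ℝ ≅ ℝ³` obtained by rotating a point of the meridional half plane. -/
def ringPt (x : Plane) (θ : ℝ) : ℂ × ℝ := ((x 0 : ℂ) * Complex.exp (θ * Complex.I), x 1)

lemma measurable_ringPt : Measurable fun y : Plane × ℝ => ringPt y.1 y.2 := by
  have : Continuous fun y : Plane × ℝ => ringPt y.1 y.2 := by
    unfold ringPt; fun_prop
  exact this.measurable

lemma norm_sq_sub_mul_exp (r s θ : ℝ) :
    ‖(r : ℂ) - s * Complex.exp (θ * Complex.I)‖ ^ 2 = r ^ 2 + s ^ 2 - 2 * r * s * Real.cos θ := by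
  rw [← Complex.normSq_eq_norm_sq, Complex.normSq_apply]
  simp only [Complex.sub_re, Complex.sub_im, Complex.ofReal_re, Complex.ofReal_im,
    Complex.re_ofReal_mul, Complex.im_ofReal_mul, Complex.exp_ofReal_mul_I_re,
    Complex.exp_ofReal_mul_I_im]
  nlinarith [Real.sin_sq_add_cos_sq θ]

lemma le_norm_sq_sub_mul_exp {δ r s θ : ℝ} (hδ : 0 < δ) (hr : δ ≤ r) (hs : δ ≤ s)
    (hθ : |θ| ≤ π) :
    (r - s) ^ 2 + 4 * δ ^ 2 / π ^ 2 * θ ^ 2 ≤ ‖(r : ℂ) - s * Complex.exp (θ * Complex.I)‖ ^ 2 := by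
  rw [norm_sq_sub_mul_exp]
  have h1 := Real.cos_le_one_sub_mul_cos_sq hθ
  have h2 : δ ^ 2 ≤ r * s := by nlinarith
  have h3 : 0 ≤ 2 / π ^ 2 * θ ^ 2 := by positivity
  have h4 : 4 * δ ^ 2 / π ^ 2 * θ ^ 2 = 2 * δ ^ 2 * (2 / π ^ 2 * θ ^ 2) := by ring
  rw [h4]
  nlinarith [mul_le_mul_of_nonneg_right h2 h3, hδ.le.trans hr, hδ.le.trans hs,
    mul_le_mul_of_nonneg_left h1 (mul_nonneg (hδ.le.trans hr) (hδ.le.trans hs))]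

lemma abs_le_of_norm_sq_sub_lt {δ r s θ ρ : ℝ} (hδ : 0 < δ) (hr : δ ≤ r) (hs : δ ≤ s)
    (hθ : |θ| ≤ π) (hρ : 0 < ρ)
    (h : ‖(r : ℂ) - s * Complex.exp (θ * Complex.I)‖ ^ 2 < ρ ^ 2) :
    |θ| ≤ π * ρ / (2 * δ) := by
  have h1 := le_norm_sq_sub_mul_exp hδ hr hs hθ
  have h2 : 4 * δ ^ 2 / π ^ 2 * θ ^ 2 < ρ ^ 2 := by nlinarith [sq_nonneg (r - s)]
  refine abs_le_of_sq_le_sq ?_ (by positivity)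
  rw [div_pow, mul_pow, le_div_iff₀ (by positivity)]
  rw [div_mul_eq_mul_div, div_lt_iff₀ (by positivity)] at h2
  nlinarith

lemma newtonKer_ringPt_sub_le {δ : ℝ} {x y : Plane} {θ : ℝ} (hδ : 0 < δ) (hx : δ ≤ x 0)
    (hy : δ ≤ y 0) (hθ : |θ| ≤ π) (hxy : y ≠ x) :
    newtonKer (((x 0 : ℂ), x 1) - ringPt y θ) ≤ ‖y - x‖⁻¹ := by
  have : 0 < ‖y - x‖ := norm_pos_iff.2 (sub_ne_zero.2 hxy)
  have h1 := le_norm_sq_sub_mul_exp hδ hx hy hθ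
  have h2 : 0 ≤ 4 * δ ^ 2 / π ^ 2 * θ ^ 2 := by positivity
  unfold newtonKer ringPt
  rw [one_div]
  gcongr
  refine Real.le_sqrt_of_sq_le ?_
  rw [plane_norm_sub_sq]
  simp only [Prod.mk_sub_mk]
  nlinarith

lemma sub_mem_ball_of_mem_eBall {δ ρ : ℝ} {x y : Plane} {θ : ℝ} (hδ : 0 < δ) (hx : δ ≤ x 0)
    (hy : δ ≤ y 0) (hθ : |θ| ≤ π) (hρ : 0 < ρ)
    (h : ((x 0 : ℂ), x 1) - ringPt y θ ∈ eBall ρ) :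
    y ∈ Metric.ball x ρ ∧ |θ| ≤ π * ρ / (2 * δ) := by
  have h : ‖(x 0 : ℂ) - y 0 * Complex.exp (θ * Complex.I)‖ ^ 2 + (x 1 - y 1) ^ 2 < ρ ^ 2 := h
  refine ⟨?_, abs_le_of_norm_sq_sub_lt hδ hx hy hθ hρ (by nlinarith [sq_nonneg (x 1 - y 1)])⟩
  rw [mem_ball_iff_norm]
  refine lt_of_pow_lt_pow_left₀ 2 hρ.le ?_
  have h1 := le_norm_sq_sub_mul_exp hδ hx hy hθ
  have h2 : 0 ≤ 4 * δ ^ 2 / π ^ 2 * θ ^ 2 := by positivity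
  rw [plane_norm_sub_sq]
  nlinarith

/-- The constant in the estimate of the part of the potential near the pole. -/
def nearConst (δ : ℝ) : ℝ := 2 * volume.real (Metric.ball (0 : Plane) 1) * (π / δ)

lemma nearConst_nonneg {δ : ℝ} (hδ : 0 < δ) : 0 ≤ nearConst δ := by
  unfold nearConst; positivity

/-- The measure on the solid of revolution of `A`, in cylindrical coordinates. -/
def ringMeasure (A : Set Plane) : Measure (Plane × ℝ) :=
  (volume.restrict A).prod (volume.restrict (Set.Ioc (-π) π))

lemma ae_ringMeasure {A : Set Plane} (hA : MeasurableSet A) :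
    ∀ᵐ y ∂ringMeasure A, y.1 ∈ A ∧ |y.2| ≤ π := by
  unfold ringMeasure
  rw [Measure.prod_restrict]
  filter_upwards [ae_restrict_mem (hA.prod measurableSet_Ioc)] with y hy
  exact ⟨hy.1, abs_le.2 ⟨hy.2.1.le, hy.2.2⟩⟩

lemma ringMeasure_univ (A : Set Plane) :
    ringMeasure A Set.univ = volume A * ENNReal.ofReal (2 * π) := by
  unfold ringMeasure
  rw [← Set.univ_prod_univ, Measure.prod_prod]
  rw [Measure.restrict_apply_univ, Measure.restrict_apply_univ, Real.volume_Ioc]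
  ring_nf

lemma lintegral_newtonKer_near_le {δ ρ : ℝ} (hδ : 0 < δ) (hρ : 0 < ρ) {A : Set Plane}
    (hA : MeasurableSet A) (hAδ : ∀ y ∈ A, δ ≤ y 0) {x : Plane} (hx : δ ≤ x 0) :
    ∫⁻ y, ENNReal.ofReal ((eBall ρ).indicator newtonKer (((x 0 : ℂ), x 1) - ringPt y.1 y.2))
      ∂ringMeasure A ≤ ENNReal.ofReal (nearConst δ * ρ ^ 2) := by
  have hne : ∀ᵐ y ∂ringMeasure A, y.1 ≠ x := by
    have h0 : ∀ᵐ y ∂(volume.restrict A : Measure Plane), y ≠ x :=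
      ae_restrict_of_ae (compl_mem_ae_iff.2 (measure_singleton (μ := volume) x))
    exact Measure.quasiMeasurePreserving_fst.ae h0
  calc _ ≤ ∫⁻ y, (Metric.ball x ρ).indicator (fun y => ENNReal.ofReal ‖y - x‖⁻¹) y.1 *
          (Set.Icc (-(π * ρ / (2 * δ))) (π * ρ / (2 * δ))).indicator 1 y.2 ∂ringMeasure A := by
        refine lintegral_mono_ae ?_
        filter_upwards [ae_ringMeasure hA, hne] with y hy hyx
        by_cases h : ((x 0 : ℂ), x 1) - ringPt y.1 y.2 ∈ eBall ρ
        · have h2 := sub_mem_ball_of_mem_eBall hδ hx (hAδ _ hy.1) hy.2 hρ h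
          rw [Set.indicator_of_mem h, Set.indicator_of_mem h2.1,
            Set.indicator_of_mem (Set.mem_Icc.2 (abs_le.1 h2.2)), Pi.one_apply, mul_one]
          exact ENNReal.ofReal_le_ofReal
            (newtonKer_ringPt_sub_le hδ hx (hAδ _ hy.1) hy.2 hyx)
        · rw [Set.indicator_of_notMem h]; simp
    _ = (∫⁻ y in A, (Metric.ball x ρ).indicator (fun y => ENNReal.ofReal ‖y - x‖⁻¹) y) *
          ∫⁻ θ in Set.Ioc (-π) π,
            (Set.Icc (-(π * ρ / (2 * δ))) (π * ρ / (2 * δ))).indicator 1 θ := by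
        unfold ringMeasure
        refine lintegral_prod_mul ?_ ?_
        · refine (Measurable.indicator ?_ Metric.isOpen_ball.measurableSet).aemeasurable
          fun_prop
        · exact (measurable_one.indicator measurableSet_Icc).aemeasurable
    _ ≤ ENNReal.ofReal (2 * volume.real (Metric.ball (0 : Plane) 1) * ρ) *
          ENNReal.ofReal (π * ρ / δ) := by
        gcongr
        · refine (setLIntegral_le_lintegral _ _).trans ?_
          rw [lintegral_indicator Metric.isOpen_ball.measurableSet,
            lintegral_inv_norm_sub_ball volume (by simp) hρ]
        · refine (setLIntegral_le_lintegral _ _).trans ?_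
          rw [lintegral_indicator_one measurableSet_Icc, Real.volume_Icc]
          apply le_of_eq; congr 1; field_simp; ring
    _ = _ := by
        rw [← ENNReal.ofReal_mul (by positivity)]
        congr 1; unfold nearConst; ring

lemma lintegral_newtonKer_ring_le {δ : ℝ} (hδ : 0 < δ) {A : Set Plane}
    (hA : MeasurableSet A) (hAδ : ∀ y ∈ A, δ ≤ y 0) {x : Plane} (hx : δ ≤ x 0) :
    ∫⁻ y, ENNReal.ofReal (newtonKer (((x 0 : ℂ), x 1) - ringPt y.1 y.2)) ∂ringMeasure A
      ≤ ENNReal.ofReal (nearConst δ) + volume A * ENNReal.ofReal (2 * π) := by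
  calc _ ≤ ∫⁻ y, (ENNReal.ofReal
          ((eBall 1).indicator newtonKer (((x 0 : ℂ), x 1) - ringPt y.1 y.2)) + 1)
          ∂ringMeasure A := by
        refine lintegral_mono fun y => ?_
        by_cases h : ((x 0 : ℂ), x 1) - ringPt y.1 y.2 ∈ eBall 1
        · simp only [Set.indicator_of_mem h]; exact le_self_add
        · simp only [Set.indicator_of_notMem h, ENNReal.ofReal_zero, zero_add]
          rw [ENNReal.ofReal_le_one]
          simp only [eBall, one_pow, Set.mem_ofPred_eq, not_lt] at h
          unfold newtonKer
          rw [one_div]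
          exact inv_le_one_of_one_le₀ (Real.one_le_sqrt.2 h)
    _ ≤ _ := by
        rw [lintegral_add_right _ measurable_const]
        gcongr
        · simpa using lintegral_newtonKer_near_le hδ one_pos hA hAδ hx
        · rw [lintegral_one, ringMeasure_univ]

/-- The solid of revolution of `A` meets a ball of radius `ρ` centred in the half plane `{δ ≤ x₁}`
in a set of volume `O(ρ |A|)`. -/
lemma volume_eBall_inter_revolution_le {δ ρ : ℝ} (hδ : 0 < δ) (hρ : 0 < ρ) {A : Set Plane}
    (hA : MeasurableSet A) (hAδ : ∀ y ∈ A, δ ≤ y 0 ∧ y 0 ≤ 1 / δ) {x : Plane} (hx : δ ≤ x 0) :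
    volume {p ∈ eBall ρ | mk2 ‖(x 0 : ℂ) + p.1‖ (x 1 + p.2) ∈ A}
      ≤ ENNReal.ofReal (π * ρ / δ ^ 2) * volume A := by
  set S : Set (ℂ × ℝ) := {q | q - ((x 0 : ℂ), x 1) ∈ eBall ρ ∧ mk2 ‖q.1‖ q.2 ∈ A}
  have hmk : Measurable fun q : ℂ × ℝ => mk2 ‖q.1‖ q.2 :=
    measurePreserving_mk2.measurable.comp (by fun_prop : Measurable fun q : ℂ × ℝ => (‖q.1‖, q.2))
  have hS : MeasurableSet S :=
    ((measurableSet_eBall ρ).preimage (by fun_prop)).inter (hA.preimage hmk)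
  have h1 : {p ∈ eBall ρ | mk2 ‖(x 0 : ℂ) + p.1‖ (x 1 + p.2) ∈ A}
      = (fun p => ((x 0 : ℂ), x 1) + p) ⁻¹' S := by
    ext p; simp [S]
  set I : Set ℝ := Set.Icc (-(π * ρ / (2 * δ))) (π * ρ / (2 * δ))
  have hAm : Measurable fun q : ℝ × ℝ => A.indicator (1 : Plane → ENNReal) (mk2 q.1 q.2) :=
    (measurable_one.indicator hA).comp measurePreserving_mk2.measurable
  rw [h1, Measure.volume_eq_prod ℂ ℝ, measure_preimage_add, ← lintegral_indicator_one hS,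
    lintegral_prod_symm _ (measurable_one.indicator hS).aemeasurable]
  calc _ ≤ ∫⁻ z : ℝ, ∫⁻ q : ℝ × ℝ, (ENNReal.ofReal (1 / δ) *
          A.indicator 1 (mk2 q.1 z)) * I.indicator 1 q.2 := by
        refine lintegral_mono fun z => ?_
        rw [← Complex.lintegral_comp_polarCoord_symm]
        refine le_trans ?_ (setLIntegral_le_lintegral polarCoord.target _)
        refine setLIntegral_mono' polarCoord.open_target.measurableSet fun q hq => ?_
        have hq1 : 0 < q.1 := hq.1
        have hq2 : |q.2| ≤ π := abs_le.2 ⟨hq.2.1.le, hq.2.2.le⟩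
        by_cases hm : (Complex.polarCoord.symm q, z) ∈ S
        · have e1 : Complex.polarCoord.symm q = (q.1 : ℂ) * Complex.exp (q.2 * Complex.I) := by
            rw [Complex.polarCoord_symm_apply, Complex.exp_mul_I]; push_cast; rfl
          have e2 : ‖Complex.polarCoord.symm q‖ = q.1 := by
            rw [Complex.norm_polarCoord_symm, abs_of_pos hq1]
          have hmA : mk2 q.1 z ∈ A := by have := hm.2; simpa only [e2] using this
          have hq3 := hAδ _ hmA
          simp only [mk2_zero] at hq3
          have hmI : q.2 ∈ I := by
            have h2 : ‖Complex.polarCoord.symm q - (x 0 : ℂ)‖ ^ 2 + (z - x 1) ^ 2 < ρ ^ 2 := hm.1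
            rw [e1, norm_sub_rev] at h2
            exact abs_le.1 (abs_le_of_norm_sq_sub_lt hδ hx hq3.1 hq2 hρ
              (by nlinarith [sq_nonneg (z - x 1)]))
          rw [Set.indicator_of_mem hm, Set.indicator_of_mem hmA, Set.indicator_of_mem hmI]
          simp only [Pi.one_apply, smul_eq_mul, mul_one]
          exact ENNReal.ofReal_le_ofReal hq3.2
        · rw [Set.indicator_of_notMem hm]; simp
    _ = ∫⁻ z : ℝ, (ENNReal.ofReal (1 / δ) * ∫⁻ r, A.indicator 1 (mk2 r z)) * volume I := by
        congr 1 with z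
        have hr : Measurable fun r : ℝ => A.indicator (1 : Plane → ENNReal) (mk2 r z) :=
          hAm.comp (by fun_prop : Measurable fun r : ℝ => (r, z))
        rw [Measure.volume_eq_prod, lintegral_prod_mul (hr.const_mul _).aemeasurable
          (measurable_one.indicator measurableSet_Icc).aemeasurable,
          lintegral_const_mul _ hr, lintegral_indicator_one measurableSet_Icc]
    _ = ENNReal.ofReal (1 / δ) * volume A * volume I := by
        have h2 : volume A = ∫⁻ z : ℝ, ∫⁻ r : ℝ, A.indicator 1 (mk2 r z) := by
          rw [← lintegral_indicator_one hA, ← measurePreserving_mk2.lintegral_comp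
            (measurable_one.indicator hA), Measure.volume_eq_prod,
            lintegral_prod_symm _ hAm.aemeasurable]
        have hz : Measurable fun z : ℝ => ∫⁻ r : ℝ, A.indicator (1 : Plane → ENNReal) (mk2 r z) :=
          hAm.lintegral_prod_left
        rw [lintegral_mul_const _ (hz.const_mul _), lintegral_const_mul _ hz, ← h2]
    _ = _ := by
        rw [Real.volume_Icc, mul_right_comm, ← ENNReal.ofReal_mul (by positivity)]
        congr 2; field_simp; ring

lemma integral_cos_mul_comp_sub {g : ℝ → ℝ} (hg : Continuous g) (hper : Function.Periodic g (2 * π))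
    (heven : ∀ t, g (-t) = g t) (φ : ℝ) :
    ∫ θ in (-π)..π, Real.cos θ * g (θ - φ) = Real.cos φ * ∫ θ in (-π)..π, Real.cos θ * g θ := by
  have hodd : ∫ t in (-π)..π, Real.sin t * g t = 0 := by
    have h := intervalIntegral.integral_comp_neg (a := -π) (b := π) (fun t => Real.sin t * g t)
    simp only [Real.sin_neg, heven, neg_mul, intervalIntegral.integral_neg, neg_neg] at h
    linarith
  have hper2 : Function.Periodic (fun t => Real.cos (t + φ) * g t) (2 * π) := by
    intro t
    simp only [hper t, add_right_comm t (2 * π) φ, Real.cos_add_two_pi]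
  calc ∫ θ in (-π)..π, Real.cos θ * g (θ - φ)
      = ∫ θ in (-π)..π, (fun t => Real.cos (t + φ) * g t) (θ - φ) := by simp
    _ = ∫ t in (-π - φ)..(π - φ), Real.cos (t + φ) * g t :=
        intervalIntegral.integral_comp_sub_right (fun t => Real.cos (t + φ) * g t) φ
    _ = ∫ t in (-π)..π, Real.cos (t + φ) * g t := by
        have h := hper2.intervalIntegral_add_eq (-π - φ) (-π)
        rwa [show -π - φ + 2 * π = π - φ by ring, show -π + 2 * π = π by ring] at h
    _ = ∫ t in (-π)..π, (Real.cos φ * (Real.cos t * g t) - Real.sin φ * (Real.sin t * g t)) := by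
        congr 1 with t; rw [Real.cos_add]; ring
    _ = _ := by
        rw [intervalIntegral.integral_sub
          (Continuous.intervalIntegrable (by fun_prop) _ _)
          (Continuous.intervalIntegrable (by fun_prop) _ _),
          intervalIntegral.integral_const_mul, intervalIntegral.integral_const_mul, hodd]
        ring

lemma norm_sq_sub_mul_exp' (w : ℂ) (s θ : ℝ) :
    ‖w - s * Complex.exp (θ * Complex.I)‖ ^ 2
      = ‖w‖ ^ 2 + s ^ 2 - 2 * ‖w‖ * s * Real.cos (θ - w.arg) := by
  rw [← norm_sq_sub_mul_exp]
  have h : w - s * Complex.exp (θ * Complex.I) = Complex.exp (w.arg * Complex.I) *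
      ((‖w‖ : ℂ) - s * Complex.exp ((θ - w.arg : ℝ) * Complex.I)) := by
    have h1 : Complex.exp (θ * Complex.I) = Complex.exp (w.arg * Complex.I) *
        Complex.exp ((θ - w.arg : ℝ) * Complex.I) := by
      rw [← Complex.exp_add]; congr 1; push_cast; ring
    rw [h1]
    nth_rewrite 1 [← Complex.norm_mul_exp_arg_mul_I w]
    ring
  rw [h, norm_mul, Complex.norm_exp_ofReal_mul_I, one_mul]

lemma integral_cos_mul_newtonKer {w : ℂ} (hw : w ≠ 0) (z : ℝ) {x : Plane} (hx : 0 < x 0)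
    (hne : x ≠ mk2 ‖w‖ z) :
    ∫ θ in (-π)..π, Real.cos θ * newtonKer ((w, z) - ringPt x θ)
      = w.re / ‖w‖ * ∫ θ in (-π)..π, Real.cos θ /
        √((z - x 1) ^ 2 + ‖w‖ ^ 2 + (x 0) ^ 2 - 2 * ‖w‖ * x 0 * Real.cos θ) := by
  have hr : 0 < ‖w‖ := norm_pos_iff.2 hw
  have hpos : ∀ t : ℝ,
      0 < (z - x 1) ^ 2 + ‖w‖ ^ 2 + (x 0) ^ 2 - 2 * ‖w‖ * x 0 * Real.cos t := by
    intro t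
    have h1 : 0 < (‖w‖ - x 0) ^ 2 + (z - x 1) ^ 2 := by
      have := plane_norm_sub_sq (mk2 ‖w‖ z) x
      simp only [mk2_zero, mk2_one] at this
      rw [← this]
      have : 0 < ‖mk2 ‖w‖ z - x‖ := norm_pos_iff.2 (sub_ne_zero.2 hne.symm)
      positivity
    nlinarith [mul_nonneg (mul_pos hr hx).le (sub_nonneg.2 (Real.cos_le_one t))]
  have h := integral_cos_mul_comp_sub
    (g := fun t => 1 / √((z - x 1) ^ 2 + ‖w‖ ^ 2 + (x 0) ^ 2 - 2 * ‖w‖ * x 0 * Real.cos t))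
    (continuous_const.div (by fun_prop) fun t => (Real.sqrt_pos.2 (hpos t)).ne')
    (fun t => by simp only [Real.cos_add_two_pi]) (fun t => by simp only [Real.cos_neg]) w.arg
  rw [Complex.cos_arg hw] at h
  convert h using 3 with θ
  · simp only [newtonKer, ringPt, Prod.mk_sub_mk, norm_sq_sub_mul_exp']
    congr 3; ring
  · congr 1 with θ
    rw [mul_one_div]

/-- The angular weight of the potential of a vortex ring. -/
def ringWeight (y : Plane × ℝ) : ℝ := (y.1 0) ^ 2 / (4 * π) * Real.cos y.2

/-- The component of the vector potential of the solid of revolution of `A`. -/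
def ringPotential (A : Set Plane) (q : ℂ × ℝ) : ℝ :=
  ∫ y, ringWeight y * newtonKer (q - ringPt y.1 y.2) ∂ringMeasure A

lemma measurable_ringWeight : Measurable ringWeight := by
  have : Continuous ringWeight := by unfold ringWeight; fun_prop
  exact this.measurable

lemma abs_ringWeight_le {δ : ℝ} (hδ : 0 < δ) {y : Plane × ℝ} (hy : δ ≤ y.1 0 ∧ y.1 0 ≤ 1 / δ) :
    |ringWeight y| ≤ 1 / δ ^ 2 := by
  have h0 : 0 ≤ y.1 0 := hδ.le.trans hy.1
  unfold ringWeight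
  rw [abs_mul, abs_of_nonneg (by positivity)]
  calc (y.1 0) ^ 2 / (4 * π) * |Real.cos y.2| ≤ (1 / δ) ^ 2 / 1 * 1 := by
        gcongr
        · exact hy.2
        · linarith [Real.pi_gt_three]
        · exact Real.abs_cos_le_one _
    _ = _ := by ring

lemma ringPotential_eq {A : Set Plane} (hA : MeasurableSet A) (hA0 : ∀ y ∈ A, 0 < y 0)
    {w : ℂ} (hw : w ≠ 0) (z : ℝ)
    (hint : Integrable (fun y => ringWeight y * newtonKer ((w, z) - ringPt y.1 y.2))
      (ringMeasure A)) :
    ringPotential A (w, z) = w.re / ‖w‖ ^ 2 * ∫ x in A, Gstar (mk2 ‖w‖ z) x := by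
  have hr : 0 < ‖w‖ := norm_pos_iff.2 hw
  unfold ringPotential ringMeasure
  rw [integral_prod _ hint, ← integral_const_mul]
  refine integral_congr_ae ?_
  filter_upwards [ae_restrict_mem hA, ae_restrict_of_ae
    (compl_mem_ae_iff.2 (measure_singleton (μ := volume) (mk2 ‖w‖ z)))] with x hx hne
  have h := integral_cos_mul_newtonKer hw z (hA0 x hx) hne
  rw [intervalIntegral.integral_of_le (by linarith [Real.pi_pos])] at h
  simp only [ringWeight, mul_assoc]
  rw [integral_const_mul, h]
  unfold Gstar
  simp only [mk2_zero, mk2_one]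
  generalize (∫ θ in (-π)..π, Real.cos θ /
    √((z - x 1) ^ 2 + ‖w‖ ^ 2 + (x 0) ^ 2 - 2 * ‖w‖ * x 0 * Real.cos θ)) = J
  field_simp

section Mean

variable {δ : ℝ} {A : Set Plane}

lemma isFiniteMeasure_ringMeasure (hfin : volume A < ⊤) : IsFiniteMeasure (ringMeasure A) :=
  ⟨by rw [ringMeasure_univ]; exact ENNReal.mul_lt_top hfin ENNReal.ofReal_lt_top⟩

lemma integrable_newtonKer_ring (hδ : 0 < δ) (hA : MeasurableSet A) (hfin : volume A < ⊤)
    (hAδ : ∀ y ∈ A, δ ≤ y 0 ∧ y 0 ≤ 1 / δ) {x : Plane} (hx : δ ≤ x 0) :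
    Integrable (fun y => newtonKer (((x 0 : ℂ), x 1) - ringPt y.1 y.2)) (ringMeasure A) := by
  refine ⟨(measurable_newtonKer.comp (measurable_const.sub measurable_ringPt)).aestronglyMeasurable,
    ?_⟩
  rw [hasFiniteIntegral_iff_ofReal (ae_of_all _ fun p => newtonKer_nonneg _)]
  refine (lintegral_newtonKer_ring_le hδ hA (fun y hy => (hAδ y hy).1) hx).trans_lt ?_
  exact ENNReal.add_lt_top.2 ⟨ENNReal.ofReal_lt_top, ENNReal.mul_lt_top hfin ENNReal.ofReal_lt_top⟩

lemma integrable_ringWeight_mul (hδ : 0 < δ) (hA : MeasurableSet A)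
    (hAδ : ∀ y ∈ A, δ ≤ y 0 ∧ y 0 ≤ 1 / δ) {f : Plane × ℝ → ℝ}
    (hf : Integrable f (ringMeasure A)) :
    Integrable (fun y => ringWeight y * f y) (ringMeasure A) := by
  refine hf.bdd_mul (c := 1 / δ ^ 2) measurable_ringWeight.aestronglyMeasurable ?_
  filter_upwards [ae_ringMeasure hA] with y hy
  exact abs_ringWeight_le hδ (hAδ _ hy.1)

lemma integrable_prod_newtonKer_ring {ρ : ℝ} (hρ : 0 < ρ) (hδ : 0 < δ) (hA : MeasurableSet A)
    (hfin : volume A < ⊤) (hAδ : ∀ y ∈ A, δ ≤ y 0 ∧ y 0 ≤ 1 / δ) (c : ℂ × ℝ) :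
    Integrable (fun q : (ℂ × ℝ) × (Plane × ℝ) =>
        ringWeight q.2 * newtonKer (c + q.1 - ringPt q.2.1 q.2.2))
      ((volume.restrict (eBall ρ)).prod (ringMeasure A)) := by
  have := isFiniteMeasure_ringMeasure hfin
  have hker : Measurable fun q : (ℂ × ℝ) × (Plane × ℝ) =>
      newtonKer (c + q.1 - ringPt q.2.1 q.2.2) :=
    measurable_newtonKer.comp
      ((measurable_fst.const_add c).sub (measurable_ringPt.comp measurable_snd))
  have hint : Integrable (fun q : (ℂ × ℝ) × (Plane × ℝ) =>
      newtonKer (c + q.1 - ringPt q.2.1 q.2.2))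
      ((volume.restrict (eBall ρ)).prod (ringMeasure A)) := by
    refine ⟨hker.aestronglyMeasurable, ?_⟩
    rw [hasFiniteIntegral_iff_ofReal (ae_of_all _ fun p => newtonKer_nonneg _),
      lintegral_prod_symm _ hker.ennreal_ofReal.aemeasurable]
    obtain ⟨K, hK⟩ := exists_lintegral_newtonKer_le hρ
    calc _ ≤ ∫⁻ _y, (K : ENNReal) ∂ringMeasure A := by
          refine lintegral_mono fun y => ?_
          refine le_trans (le_of_eq ?_) (hK (ringPt y.1 y.2 - c))
          congr 1 with p
          congr 2; abel
      _ < ⊤ := by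
          rw [lintegral_const]
          exact ENNReal.mul_lt_top ENNReal.coe_lt_top (measure_lt_top _ _)
  refine hint.bdd_mul (c := 1 / δ ^ 2)
    (measurable_ringWeight.comp measurable_snd).aestronglyMeasurable ?_
  filter_upwards [Measure.quasiMeasurePreserving_snd.ae (ae_ringMeasure hA)] with q hq
  exact abs_ringWeight_le hδ (hAδ _ hq.1)

lemma integrableOn_ringPotential {ρ : ℝ} (hρ : 0 < ρ) (hδ : 0 < δ) (hA : MeasurableSet A)
    (hfin : volume A < ⊤) (hAδ : ∀ y ∈ A, δ ≤ y 0 ∧ y 0 ≤ 1 / δ) (c : ℂ × ℝ) :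
    IntegrableOn (fun p => ringPotential A (c + p)) (eBall ρ) := by
  have := isFiniteMeasure_ringMeasure hfin
  exact (integrable_prod_newtonKer_ring hρ hδ hA hfin hAδ c).integral_prod_left

/-- The potential exceeds its mean over a ball of radius `ρ` by `O(ρ²)`. -/
lemma ringPotential_le_mean {ρ : ℝ} (hρ : 0 < ρ) (hδ : 0 < δ) (hA : MeasurableSet A)
    (hfin : volume A < ⊤) (hAδ : ∀ y ∈ A, δ ≤ y 0 ∧ y 0 ≤ 1 / δ) {x : Plane} (hx : δ ≤ x 0)
    (hρδ : ρ < δ) :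
    4 * π / 3 * ρ ^ 3 * ringPotential A ((x 0 : ℂ), x 1)
      ≤ (∫ p in eBall ρ, ringPotential A (((x 0 : ℂ), x 1) + p))
        + 4 * π / 3 * ρ ^ 3 * (1 / δ ^ 2 * (nearConst δ * ρ ^ 2)) := by
  have := isFiniteMeasure_ringMeasure hfin
  set c : ℂ × ℝ := ((x 0 : ℂ), x 1) with hc
  have hV : 0 ≤ 4 * π / 3 * ρ ^ 3 := by positivity
  have hprod := integrable_prod_newtonKer_ring hρ hδ hA hfin hAδ c
  have hswap : ∫ p in eBall ρ, ringPotential A (c + p)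
      = ∫ y, ringWeight y * (∫ p in eBall ρ, newtonKer (c + p - ringPt y.1 y.2)) ∂ringMeasure A := by
    unfold ringPotential
    rw [integral_integral_swap hprod]
    simp_rw [integral_const_mul]
  have hker := integrable_newtonKer_ring hδ hA hfin hAδ hx
  have hnear : Integrable
      (fun y => (eBall ρ).indicator newtonKer (c - ringPt y.1 y.2)) (ringMeasure A) := by
    have := hker.indicator
      (((measurable_const.sub measurable_ringPt : Measurable fun y : Plane × ℝ =>
        c - ringPt y.1 y.2)) (measurableSet_eBall ρ))
    exact this
  have hnear_le : ∫ y, (eBall ρ).indicator newtonKer (c - ringPt y.1 y.2) ∂ringMeasure A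
      ≤ nearConst δ * ρ ^ 2 := by
    have h0 : 0 ≤ nearConst δ * ρ ^ 2 := mul_nonneg (nearConst_nonneg hδ) (sq_nonneg ρ)
    rw [integral_eq_lintegral_of_nonneg_ae
      (ae_of_all _ fun y => Set.indicator_nonneg (fun _ _ => newtonKer_nonneg _) _)
      hnear.aestronglyMeasurable]
    exact ENNReal.toReal_le_of_le_ofReal h0
      (lintegral_newtonKer_near_le hδ hρ hA (fun y hy => (hAδ y hy).1) hx)
  rw [hswap]
  have hswap_int : Integrable (fun y => ringWeight y *
      ∫ p in eBall ρ, newtonKer (c + p - ringPt y.1 y.2)) (ringMeasure A) := by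
    have := hprod.integral_prod_right
    simpa only [integral_const_mul] using this
  calc 4 * π / 3 * ρ ^ 3 * ringPotential A c
      = ∫ y, 4 * π / 3 * ρ ^ 3 * (ringWeight y * newtonKer (c - ringPt y.1 y.2))
          ∂ringMeasure A := by rw [integral_const_mul]; rfl
    _ ≤ ∫ y, (ringWeight y * (∫ p in eBall ρ, newtonKer (c + p - ringPt y.1 y.2))
          + 4 * π / 3 * ρ ^ 3 * (1 / δ ^ 2 *
            (eBall ρ).indicator newtonKer (c - ringPt y.1 y.2))) ∂ringMeasure A := by
        refine integral_mono_ae ((integrable_ringWeight_mul hδ hA hAδ hker).const_mul _)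
          (hswap_int.add ((hnear.const_mul _).const_mul _)) ?_
        filter_upwards [ae_ringMeasure hA] with y hy
        have hcomm : ∀ p : ℂ × ℝ, c + p - ringPt y.1 y.2 = p - (ringPt y.1 y.2 - c) := by
          intro p; abel
        by_cases h : c - ringPt y.1 y.2 ∈ eBall ρ
        · rw [Set.indicator_of_mem h]
          have hlt : ‖(x 0 : ℂ) - y.1 0 * Complex.exp (y.2 * Complex.I)‖ ^ 2
              + (x 1 - y.1 1) ^ 2 < ρ ^ 2 := h
          have hy0 : 0 < y.1 0 := hδ.trans_le (hAδ _ hy.1).1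
          have hcos : 0 ≤ Real.cos y.2 := by
            rw [norm_sq_sub_mul_exp] at hlt
            by_contra! hneg
            nlinarith [mul_pos (mul_pos (hδ.trans_le hx) hy0) (neg_pos.2 hneg),
              sq_nonneg (x 1 - y.1 1)]
          have hw0 : 0 ≤ ringWeight y := by unfold ringWeight; positivity
          have h1 : 0 ≤ ringWeight y * ∫ p in eBall ρ, newtonKer (c + p - ringPt y.1 y.2) :=
            mul_nonneg hw0 (integral_nonneg fun p => newtonKer_nonneg _)
          have h2 : ringWeight y ≤ 1 / δ ^ 2 :=
            (le_abs_self _).trans (abs_ringWeight_le hδ (hAδ _ hy.1))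
          have h3 := mul_le_mul_of_nonneg_left
            (mul_le_mul_of_nonneg_right h2 (newtonKer_nonneg (c - ringPt y.1 y.2))) hV
          linarith
        · rw [Set.indicator_of_notMem h]
          have hge : ρ ^ 2 ≤ ‖(ringPt y.1 y.2 - c).1‖ ^ 2 + (ringPt y.1 y.2 - c).2 ^ 2 := by
            rw [← neg_sub c, Prod.fst_neg, Prod.snd_neg, norm_neg, neg_sq]
            exact not_lt.1 h
          simp_rw [hcomm]
          rw [integral_newtonKer_sub hρ _ hge]
          have : newtonKer (ringPt y.1 y.2 - c) = newtonKer (c - ringPt y.1 y.2) := by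
            unfold newtonKer
            rw [← neg_sub c, Prod.fst_neg, Prod.snd_neg, norm_neg, neg_sq]
          rw [this]
          apply le_of_eq; ring
    _ ≤ _ := by
        rw [integral_add hswap_int ((hnear.const_mul _).const_mul _), integral_const_mul,
          integral_const_mul]
        gcongr

end Mean

section Excess

variable {δ : ℝ} {A : Set Plane}

lemma ringPotential_div_sub_eq (hA : MeasurableSet A) (hA0 : ∀ y ∈ A, 0 < y 0) {ε a b : ℝ}
    {Ψ : Plane → ℝ}
    (hΨ : ∀ y : Plane, 0 < y 0 → Ψ y = (∫ x in A, Gstar y x) / ε ^ 2 - a * (y 0) ^ 2 - b)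
    {w : ℂ} (hw : w ≠ 0) (z : ℝ)
    (hint : Integrable (fun y => ringWeight y * newtonKer ((w, z) - ringPt y.1 y.2))
      (ringMeasure A)) :
    ringPotential A (w, z) / ε ^ 2 - a * w.re - b * (w⁻¹).re
      = w.re / ‖w‖ ^ 2 * Ψ (mk2 ‖w‖ z) := by
  have hr : 0 < ‖w‖ := norm_pos_iff.2 hw
  rw [ringPotential_eq hA hA0 hw z hint, hΨ _ hr, Complex.inv_re, Complex.normSq_eq_norm_sq,
    mk2_zero]
  field_simp

lemma ringPotential_ofReal (hδ : 0 < δ) (hA : MeasurableSet A) (hfin : volume A < ⊤)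
    (hAδ : ∀ y ∈ A, δ ≤ y 0 ∧ y 0 ≤ 1 / δ) {x : Plane} (hx : δ ≤ x 0) :
    ∫ y in A, Gstar x y = x 0 * ringPotential A ((x 0 : ℂ), x 1) := by
  have hx0 : 0 < x 0 := hδ.trans_le hx
  have h := ringPotential_eq hA (fun y hy => hδ.trans_le (hAδ y hy).1)
    (Complex.ofReal_ne_zero.2 hx0.ne') (x 1)
    (integrable_ringWeight_mul hδ hA hAδ (integrable_newtonKer_ring hδ hA hfin hAδ hx))
  rw [Complex.norm_real, Real.norm_of_nonneg hx0.le, mk2_self, Complex.ofReal_re] at h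
  rw [h]; field_simp

lemma ringPotential_ofReal_le (hδ : 0 < δ) (hA : MeasurableSet A) (hfin : volume A < ⊤)
    (hAδ : ∀ y ∈ A, δ ≤ y 0 ∧ y 0 ≤ 1 / δ) {x : Plane} (hx : δ ≤ x 0) :
    ringPotential A ((x 0 : ℂ), x 1) ≤ 1 / δ ^ 2 * (nearConst δ + volume.real A * (2 * π)) := by
  have hint := integrable_newtonKer_ring hδ hA hfin hAδ hx
  calc ringPotential A ((x 0 : ℂ), x 1)
      ≤ ∫ y, 1 / δ ^ 2 * newtonKer (((x 0 : ℂ), x 1) - ringPt y.1 y.2) ∂ringMeasure A := by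
        refine integral_mono_ae (integrable_ringWeight_mul hδ hA hAδ hint) (hint.const_mul _) ?_
        filter_upwards [ae_ringMeasure hA] with y hy
        exact mul_le_mul_of_nonneg_right
          ((le_abs_self _).trans (abs_ringWeight_le hδ (hAδ _ hy.1))) (newtonKer_nonneg _)
    _ ≤ _ := by
        rw [integral_const_mul]
        gcongr
        rw [integral_eq_lintegral_of_nonneg_ae (ae_of_all _ fun y => newtonKer_nonneg _)
          hint.aestronglyMeasurable]
        refine ENNReal.toReal_le_of_le_ofReal
          (add_nonneg (nearConst_nonneg hδ) (by positivity)) ?_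
        refine (lintegral_newtonKer_ring_le hδ hA (fun y hy => (hAδ y hy).1) hx).trans ?_
        rw [ENNReal.ofReal_add (nearConst_nonneg hδ) (by positivity),
          ENNReal.ofReal_mul measureReal_nonneg, ofReal_measureReal hfin.ne]

/-- An upper bound for `Ψ` on `A` improves itself by the mean value inequality. -/
lemma excess_le_of_le (hδ : 0 < δ) (hA : MeasurableSet A) (hfin : volume A < ⊤)
    (hAδ : ∀ y ∈ A, δ ≤ y 0 ∧ y 0 ≤ 1 / δ) {ε a b M ρ : ℝ} (hρ : 0 < ρ)
    (hρδ : ρ < δ) {Ψ : Plane → ℝ}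
    (hΨ : ∀ y : Plane, 0 < y 0 → Ψ y = (∫ x in A, Gstar y x) / ε ^ 2 - a * (y 0) ^ 2 - b)
    (hout : ∀ y : Plane, 0 < y 0 → y ∉ A → Ψ y ≤ 0) (hM0 : 0 ≤ M) (hM : ∀ y ∈ A, Ψ y ≤ M)
    {x : Plane} (hx : x ∈ A) :
    Ψ x ≤ M * volume.real A / (δ ^ 4 * ρ ^ 2) + nearConst δ * ρ ^ 2 / (δ ^ 3 * ε ^ 2) := by
  have hxδ := hAδ x hx
  have hx0 : 0 < x 0 := hδ.trans_le hxδ.1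
  have hρx : ρ < x 0 := hρδ.trans_le hxδ.1
  have hA0 : ∀ y ∈ A, 0 < y 0 := fun y hy => hδ.trans_le (hAδ y hy).1
  have := isFiniteMeasure_ringMeasure hfin
  set c : ℂ × ℝ := ((x 0 : ℂ), x 1) with hc
  set V : ℝ := 4 * π / 3 * ρ ^ 3 with hV
  have hVpos : 0 < V := by positivity
  set S : Set (ℂ × ℝ) := {p ∈ eBall ρ | mk2 ‖c.1 + p.1‖ (c.2 + p.2) ∈ A}
  have hmk : Measurable fun q : ℂ × ℝ => mk2 ‖c.1 + q.1‖ (c.2 + q.2) :=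
    measurePreserving_mk2.measurable.comp
      (by fun_prop : Measurable fun q : ℂ × ℝ => (‖c.1 + q.1‖, c.2 + q.2))
  have hSm : MeasurableSet S := (measurableSet_eBall ρ).inter (hA.preimage hmk)
  have hSvol : volume.real S ≤ π * ρ / δ ^ 2 * volume.real A := by
    refine ENNReal.toReal_le_of_le_ofReal (by positivity) ?_
    refine (volume_eBall_inter_revolution_le hδ hρ hA hAδ hxδ.1).trans ?_
    rw [ENNReal.ofReal_mul (by positivity), ofReal_measureReal hfin.ne]
  have h1 := ringPotential_le_mean hρ hδ hA hfin hAδ hxδ.1 hρδ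
  have hI1 := integrableOn_ringPotential hρ hδ hA hfin hAδ c
  have hd2 : DifferentiableOn ℂ (fun w : ℂ => (x 0 : ℂ) + w) (Metric.ball 0 (x 0)) := by fun_prop
  have h2 := integral_eBall_re hρ hρx hd2
  have hI2 := integrableOn_eBall_re hρ hρx hd2.continuousOn
  have hd3 := differentiableOn_inv_add (x 0)
  have h3 := integral_eBall_re hρ hρx hd3
  have hI3 := integrableOn_eBall_re hρ hρx hd3.continuousOn
  simp only [add_zero, Complex.ofReal_re] at h2
  simp only [add_zero, ← Complex.ofReal_inv, Complex.ofReal_re] at h3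
  have hI12 : IntegrableOn
      (fun p : ℂ × ℝ => ringPotential A (c + p) / ε ^ 2 - a * ((x 0 : ℂ) + p.1).re) (eBall ρ) :=
    (hI1.div_const _).sub (hI2.const_mul _)
  have hmean : ∫ p in eBall ρ, (ringPotential A (c + p) / ε ^ 2 - a * ((x 0 : ℂ) + p.1).re
        - b * (((x 0 : ℂ) + p.1)⁻¹).re)
      = (∫ p in eBall ρ, ringPotential A (c + p)) / ε ^ 2 - a * (V * x 0) - b * (V * (x 0)⁻¹) := by
    rw [integral_sub hI12 (hI3.const_mul _),
      integral_sub (hI1.div_const _) (hI2.const_mul _), integral_div, integral_const_mul,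
      integral_const_mul, h2, h3]
  have hle : ∫ p in eBall ρ, (ringPotential A (c + p) / ε ^ 2 - a * ((x 0 : ℂ) + p.1).re
        - b * (((x 0 : ℂ) + p.1)⁻¹).re) ≤ M / δ * (π * ρ / δ ^ 2 * volume.real A) := by
    calc _ ≤ ∫ p in eBall ρ, S.indicator (fun _ => M / δ) p := by
          refine integral_mono_ae (hI12.sub (hI3.const_mul _)) (((integrable_const_iff.2 (Or.inr ?_)).indicator hSm)) ?_
          · exact ⟨by rw [Measure.restrict_apply_univ]; exact volume_eBall_lt_top hρ⟩
          filter_upwards [ae_restrict_mem (measurableSet_eBall ρ),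
            (integrable_prod_newtonKer_ring hρ hδ hA hfin hAδ c).prod_right_ae] with p hp hint
          have hp1 := norm_fst_lt_of_mem_eBall hρ hp
          have hre : 0 < ((x 0 : ℂ) + p.1).re := by
            have := (abs_le.1 (Complex.abs_re_le_norm p.1)).1
            simp only [Complex.add_re, Complex.ofReal_re]; linarith
          have hw : (x 0 : ℂ) + p.1 ≠ 0 := fun h => by simp [h] at hre
          have hr : 0 < ‖(x 0 : ℂ) + p.1‖ := norm_pos_iff.2 hw
          have h := ringPotential_div_sub_eq hA hA0 hΨ hw (x 1 + p.2) hint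
          refine (le_of_eq h).trans ?_
          by_cases hpS : mk2 ‖(x 0 : ℂ) + p.1‖ (x 1 + p.2) ∈ A
          · rw [Set.indicator_of_mem (show p ∈ S from ⟨hp, hpS⟩)]
            have hrδ := (hAδ _ hpS).1
            rw [mk2_zero] at hrδ
            calc ((x 0 : ℂ) + p.1).re / ‖(x 0 : ℂ) + p.1‖ ^ 2
                  * Ψ (mk2 ‖(x 0 : ℂ) + p.1‖ (x 1 + p.2))
                ≤ ((x 0 : ℂ) + p.1).re / ‖(x 0 : ℂ) + p.1‖ ^ 2 * M := by
                  gcongr; exact hM _ hpS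
              _ ≤ ‖(x 0 : ℂ) + p.1‖ / ‖(x 0 : ℂ) + p.1‖ ^ 2 * M := by
                  gcongr; exact Complex.re_le_norm _
              _ = 1 / ‖(x 0 : ℂ) + p.1‖ * M := by field_simp
              _ ≤ 1 / δ * M := by gcongr
              _ = M / δ := by ring
          · rw [Set.indicator_of_notMem (fun h : p ∈ S => hpS h.2)]
            exact mul_nonpos_of_nonneg_of_nonpos (by positivity) (hout _ hr hpS)
      _ = M / δ * volume.real S := by
          rw [integral_indicator_const _ hSm, measureReal_restrict_apply hSm,
            Set.inter_eq_left.2 (Set.sep_subset _ _), smul_eq_mul, mul_comm]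
      _ ≤ _ := by gcongr
  have hval : Ψ x = x 0 * (ringPotential A c / ε ^ 2 - a * x 0 - b * (x 0)⁻¹) := by
    rw [hΨ x hx0, ringPotential_ofReal hδ hA hfin hAδ hxδ.1, ← hc]
    field_simp
  have hkey : V * (ringPotential A c / ε ^ 2 - a * x 0 - b * (x 0)⁻¹)
      ≤ M / δ * (π * ρ / δ ^ 2 * volume.real A)
        + V * (1 / δ ^ 2 * (nearConst δ * ρ ^ 2)) / ε ^ 2 := by
    have h4 := div_le_div_of_nonneg_right h1 (sq_nonneg ε)
    rw [add_div] at h4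
    rw [hmean] at hle
    have h5 : V * ringPotential A c / ε ^ 2 = V * (ringPotential A c / ε ^ 2) := mul_div_assoc _ _ _
    linarith
  have hkey2 : ringPotential A c / ε ^ 2 - a * x 0 - b * (x 0)⁻¹
      ≤ M * volume.real A / (δ ^ 3 * ρ ^ 2) + nearConst δ * ρ ^ 2 / (δ ^ 2 * ε ^ 2) := by
    rw [← le_div_iff₀' hVpos] at hkey
    refine hkey.trans ?_
    rw [add_div]
    refine add_le_add ?_ (le_of_eq ?_)
    · have : M / δ * (π * ρ / δ ^ 2 * volume.real A) / V
          = 3 / 4 * (M * volume.real A / (δ ^ 3 * ρ ^ 2)) := by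
        rw [hV]; field_simp
      rw [this]
      have : 0 ≤ M * volume.real A / (δ ^ 3 * ρ ^ 2) := by positivity
      linarith
    · field_simp
  have hN := nearConst_nonneg hδ
  rw [hval]
  calc _ ≤ x 0 * (M * volume.real A / (δ ^ 3 * ρ ^ 2) + nearConst δ * ρ ^ 2 / (δ ^ 2 * ε ^ 2)) := by
        gcongr
    _ ≤ 1 / δ * (M * volume.real A / (δ ^ 3 * ρ ^ 2)
          + nearConst δ * ρ ^ 2 / (δ ^ 2 * ε ^ 2)) := by
        gcongr; exact hxδ.2
    _ = _ := by rw [mul_add]; congr 1 <;> rw [one_div_mul_eq_div, div_div] <;> congr 1 <;> ring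

/-- The constant in the bound of `Ψ` on the core. -/
def excessConst (κ δ : ℝ) : ℝ :=
  2 * (nearConst δ * (2 * κ / δ ^ 5) / δ ^ 3)
    + 1 / δ ^ 3 * (nearConst δ * (2 * κ / δ ^ 7) + 2 * π * κ / δ)

/-- `Ψ` is bounded on the core, uniformly in `ε`. -/
lemma excess_le (hδ : 0 < δ) (hA : MeasurableSet A) (hfin : volume A < ⊤)
    (hAδ : ∀ y ∈ A, δ ≤ y 0 ∧ y 0 ≤ 1 / δ) {ε a b κ : ℝ} (hε : 0 < ε) (ha : 0 ≤ a) (hb : 0 ≤ b)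
    (hκ : 0 < κ) (hvol : volume.real A ≤ κ * ε ^ 2 / δ) {Ψ : Plane → ℝ}
    (hΨ : ∀ y : Plane, 0 < y 0 → Ψ y = (∫ x in A, Gstar y x) / ε ^ 2 - a * (y 0) ^ 2 - b)
    (hout : ∀ y : Plane, 0 < y 0 → y ∉ A → Ψ y ≤ 0) (hin : ∀ y ∈ A, 0 ≤ Ψ y)
    {x : Plane} (hx : x ∈ A) :
    Ψ x ≤ excessConst κ δ := by
  have hN := nearConst_nonneg hδ
  set T2 : ℝ := 2 * κ / δ ^ 5 with hT2
  have hT2pos : 0 < T2 := by positivity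
  have hdir : ∀ y ∈ A, Ψ y ≤ 1 / δ ^ 3 * (nearConst δ / ε ^ 2 + 2 * π * κ / δ) := by
    intro y hy
    have hy0 : 0 < y 0 := hδ.trans_le (hAδ y hy).1
    rw [hΨ y hy0, ringPotential_ofReal hδ hA hfin hAδ (hAδ y hy).1]
    have h1 := ringPotential_ofReal_le hδ hA hfin hAδ (hAδ y hy).1
    calc _ ≤ y 0 * ringPotential A ((y 0 : ℂ), y 1) / ε ^ 2 := by
          have : 0 ≤ a * (y 0) ^ 2 := by positivity
          linarith
      _ ≤ y 0 * (1 / δ ^ 2 * (nearConst δ + volume.real A * (2 * π))) / ε ^ 2 := by gcongr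
      _ ≤ 1 / δ * (1 / δ ^ 2 * (nearConst δ + κ * ε ^ 2 / δ * (2 * π))) / ε ^ 2 := by
          gcongr; exact (hAδ y hy).2
      _ = _ := by field_simp
  have hE1 : 0 ≤ 2 * (nearConst δ * T2 / δ ^ 3) := by positivity
  have hE2 : 0 ≤ 1 / δ ^ 3 * (nearConst δ * (2 * κ / δ ^ 7) + 2 * π * κ / δ) := by positivity
  unfold excessConst
  rw [← hT2]
  by_cases hcase : √T2 * ε < δ
  · have hρ : 0 < √T2 * ε := by positivity
    have hbdd : BddAbove (Ψ '' A) :=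
      ⟨_, by rintro _ ⟨y, hy, rfl⟩; exact hdir y hy⟩
    set M : ℝ := sSup (Ψ '' A)
    have hMle : ∀ y ∈ A, Ψ y ≤ M := fun y hy => le_csSup hbdd ⟨y, hy, rfl⟩
    have hM0 : 0 ≤ M := (hin x hx).trans (hMle x hx)
    have hstep : ∀ y ∈ A, Ψ y ≤ M / 2 + nearConst δ * T2 / δ ^ 3 := by
      intro y hy
      refine (excess_le_of_le hδ hA hfin hAδ hρ hcase hΨ hout hM0 hMle hy).trans ?_
      rw [mul_pow, Real.sq_sqrt hT2pos.le]
      refine add_le_add ?_ (le_of_eq (by field_simp))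
      calc M * volume.real A / (δ ^ 4 * (T2 * ε ^ 2))
          ≤ M * (κ * ε ^ 2 / δ) / (δ ^ 4 * (T2 * ε ^ 2)) := by gcongr
        _ = M / 2 := by rw [hT2]; field_simp
    have hMsup : M ≤ M / 2 + nearConst δ * T2 / δ ^ 3 := by
      refine csSup_le ⟨_, x, hx, rfl⟩ ?_
      rintro _ ⟨y, hy, rfl⟩
      exact hstep y hy
    linarith [hMle x hx]
  · refine (hdir x hx).trans ?_
    have hle : 1 / ε ^ 2 ≤ 2 * κ / δ ^ 7 := by
      have h2 : δ ^ 2 ≤ T2 * ε ^ 2 := by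
        rw [← Real.sq_sqrt hT2pos.le, ← mul_pow]
        gcongr; exact not_lt.1 hcase
      have h3 : 2 * κ / δ ^ 7 = T2 / δ ^ 2 := by rw [hT2]; field_simp
      rw [h3, div_le_div_iff₀ (by positivity) (by positivity)]
      linarith
    have : 1 / δ ^ 3 * (nearConst δ / ε ^ 2 + 2 * π * κ / δ)
        ≤ 1 / δ ^ 3 * (nearConst δ * (2 * κ / δ ^ 7) + 2 * π * κ / δ) := by
      rw [div_eq_mul_one_div (nearConst δ)]
      gcongr
    linarith

end Excess

lemma isOpen_halfPlane : IsOpen halfPlane :=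
  isOpen_lt continuous_const (by fun_prop)

lemma IsVortexRingStream.isOpen_crossSection {ψ : Plane → ℝ} {ε W μ : ℝ}
    (h : IsVortexRingStream ψ ε W μ) : IsOpen (crossSection ψ ε W μ) := by
  have hc : ContinuousOn (fun x : Plane => ψ x - W / 2 * (x 0) ^ 2 * Real.log (1 / ε)) halfPlane :=
    h.continuousOn.sub (Continuous.continuousOn (by fun_prop))
  exact hc.isOpen_inter_preimage isOpen_halfPlane isOpen_Ioi

/-- **Uniform bound on the kinetic energy of the vortex core** (Lemma 3.7). For any steady
vortex ring stream function with cross-section contained in `{δ₀ ≤ x₁ ≤ 1/δ₀}` and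
circulation at most `κ₀`, the core energy `ε⁻² ∫_A x₁ (ψ − (W/2)x₁² ln(1/ε) − μ)` is
bounded by a constant depending only on `κ₀` and `δ₀`. -/
theorem core_energy_bound (κ₀ δ₀ : ℝ) (hκ₀ : 0 < κ₀) (hδ₀ : 0 < δ₀) :
    ∃ C > (0 : ℝ), ∀ ε ∈ Set.Ioc (0 : ℝ) 1, ∀ W > (0 : ℝ), ∀ μ > (0 : ℝ),
      ∀ ψ : Plane → ℝ,
        IsVortexRingStream ψ ε W μ →
        crossSection ψ ε W μ ⊆ {x : Plane | δ₀ ≤ x 0 ∧ x 0 ≤ 1 / δ₀} →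
        circulation ψ ε W μ ≤ κ₀ →
        (∫ x in crossSection ψ ε W μ,
            x 0 * (ψ x - W / 2 * (x 0) ^ 2 * Real.log (1 / ε) - μ)) / ε ^ 2 ≤ C := by
  have hN := nearConst_nonneg hδ₀
  have hE : 0 < excessConst κ₀ δ₀ := by unfold excessConst; positivity
  refine ⟨excessConst κ₀ δ₀ * κ₀, by positivity, ?_⟩
  intro ε hε W hW μ hμ ψ hψ hsub hcirc
  have hε0 := hε.1
  unfold circulation at hcirc
  set A := crossSection ψ ε W μ
  have hA : MeasurableSet A := hψ.isOpen_crossSection.measurableSet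
  have hfin : volume A < ⊤ := hψ.bounded.measure_lt_top
  have hAδ : ∀ y ∈ A, δ₀ ≤ y 0 ∧ y 0 ≤ 1 / δ₀ := fun y hy => hsub hy
  rw [div_le_iff₀ (by positivity)] at hcirc
  have hint : IntegrableOn (fun x : Plane => x 0) A := by
    refine Measure.integrableOn_of_bounded (M := 1 / δ₀) hfin.ne
      (Measurable.aestronglyMeasurable (by fun_prop)) ?_
    filter_upwards [ae_restrict_mem hA] with y hy
    rw [Real.norm_of_nonneg (hδ₀.le.trans (hAδ y hy).1)]
    exact (hAδ y hy).2
  have hvol : volume.real A ≤ κ₀ * ε ^ 2 / δ₀ := by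
    rw [le_div_iff₀ hδ₀]
    refine le_trans ?_ hcirc
    rw [mul_comm]
    exact setIntegral_ge_of_const_le_real hA hfin.ne (fun y hy => (hAδ y hy).1) hint
  have hlog : 0 ≤ Real.log (1 / ε) := Real.log_nonneg (by rw [le_div_iff₀ hε0]; linarith [hε.2])
  have hbound : ∀ y ∈ A, ψ y - W / 2 * (y 0) ^ 2 * Real.log (1 / ε) - μ ≤ excessConst κ₀ δ₀ := by
    intro y hy
    refine excess_le (Ψ := fun y => ψ y - W / 2 * (y 0) ^ 2 * Real.log (1 / ε) - μ)
      (a := W / 2 * Real.log (1 / ε)) (b := μ) hδ₀ hA hfin hAδ hε0 (by positivity) hμ.le hκ₀ hvol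
      ?_ ?_ ?_ hy
    · intro y hy
      simp only [hψ.repr y hy]
      ring
    · intro y hy hyA
      by_contra! h
      exact hyA ⟨hy, by linarith⟩
    · intro y hy
      linarith [hy.2]
  rw [div_le_iff₀ (by positivity)]
  calc _ ≤ ∫ x in A, excessConst κ₀ δ₀ * x 0 := by
        refine integral_mono_of_nonneg ?_ (hint.const_mul _) ?_
        · filter_upwards [ae_restrict_mem hA] with y hy
          exact mul_nonneg (hδ₀.le.trans (hAδ y hy).1) (by linarith [hy.2])
        · filter_upwards [ae_restrict_mem hA] with y hy
          rw [mul_comm]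
          exact mul_le_mul_of_nonneg_right (hbound y hy) (hδ₀.le.trans (hAδ y hy).1)
    _ ≤ excessConst κ₀ δ₀ * κ₀ * ε ^ 2 := by
        rw [integral_const_mul, mul_assoc]
        gcongr
end
end

section
/- For every κ > 0, W > 0 and every δ₀ ∈ (0, κ/(4πW)) there exists ε₀ ∈ (0, 1) such that for every ε ∈ (0, ε₀] the function g_ε(x) := W x ln(1/ε) − (κ/(4π)) (ln(8x/s₀(x)) − 1/4), defined for x > 0 with s₀(x) := ε √(κ/(π x)), has exactly one zero x*(ε) in the interval [δ₀, ∞); moreover x*(ε) → κ/(4πW) as ε → 0⁺. -/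
open MeasureTheory Real Filter
open scoped RealInnerProductSpace

noncomputable section

/-- `kelvinHicksAux c K L x = L (x - c) - c (3/2 ln x + K)`; with `L = ln (1/ε)` and
`c = κ/(4πW)` this is the Kelvin–Hicks function divided by `W`. -/
def kelvinHicksAux (c K L x : ℝ) : ℝ := L * (x - c) - c * (3 / 2 * Real.log x + K)

theorem kelvinHicks_eq_mul_aux {κ W ε x : ℝ} (hκ : 0 < κ) (hW : 0 < W) (hε : 0 < ε)
    (hx : 0 < x) :
    W * x * Real.log (1 / ε)
        - κ / (4 * π) * (Real.log (8 * x / (ε * Real.sqrt (κ / (π * x)))) - 1 / 4) =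
      W * kelvinHicksAux (κ / (4 * π * W))
        (Real.log 8 - (Real.log κ - Real.log π) / 2 - 1 / 4) (Real.log (1 / ε)) x := by
  have hπ := Real.pi_pos
  have hlog : Real.log (8 * x / (ε * Real.sqrt (κ / (π * x)))) =
      Real.log 8 + Real.log x - (Real.log ε + (Real.log κ - (Real.log π + Real.log x)) / 2) := by
    rw [Real.log_div (by positivity) (by positivity), Real.log_mul (by positivity) hx.ne',
      Real.log_mul hε.ne' (by positivity), Real.log_sqrt (by positivity),
      Real.log_div hκ.ne' (by positivity), Real.log_mul hπ.ne' hx.ne']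
  rw [hlog, one_div ε, Real.log_inv, kelvinHicksAux]
  field_simp
  ring

theorem kelvinHicksAux_strictMonoOn {c K L δ : ℝ} (hc : 0 < c) (hδ : 0 < δ)
    (hL : 3 / 2 * c / δ < L) : StrictMonoOn (kelvinHicksAux c K L) (Set.Ici δ) := by
  intro x hx y _ hxy
  have hx : δ ≤ x := hx
  have hx0 : 0 < x := hδ.trans_le hx
  have hy0 : 0 < y := hx0.trans hxy
  have hlog : Real.log y - Real.log x ≤ (y - x) / δ := by
    rw [← Real.log_div hy0.ne' hx0.ne']
    calc Real.log (y / x) ≤ y / x - 1 := Real.log_le_sub_one_of_pos (by positivity)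
      _ = (y - x) / x := by field_simp
      _ ≤ (y - x) / δ := div_le_div_of_nonneg_left (by linarith) hδ hx
  have h₁ : 3 / 2 * c * (Real.log y - Real.log x) ≤ 3 / 2 * c * ((y - x) / δ) := by gcongr
  have h₂ : 3 / 2 * c / δ * (y - x) < L * (y - x) := by
    have : 0 < y - x := by linarith
    gcongr
  have h₃ : 3 / 2 * c * ((y - x) / δ) = 3 / 2 * c / δ * (y - x) := by ring
  simp only [kelvinHicksAux]
  linarith

theorem kelvinHicksAux_eventually_exists_zero {c K η : ℝ} (hη : 0 < η) (hηc : η < c) :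
    ∀ᶠ L in atTop, ∃ x ∈ Set.Icc (c - η) (c + η), kelvinHicksAux c K L x = 0 := by
  have hlin : Tendsto (fun L : ℝ => L * η) atTop atTop := tendsto_id.atTop_mul_const hη
  filter_upwards [hlin.eventually_ge_atTop (-(c * (3 / 2 * Real.log (c - η) + K))),
    hlin.eventually_ge_atTop (c * (3 / 2 * Real.log (c + η) + K))] with L h₁ h₂
  have hcont : ContinuousOn (kelvinHicksAux c K L) (Set.Icc (c - η) (c + η)) := by
    have hlog : ContinuousOn Real.log (Set.Icc (c - η) (c + η)) :=
      Real.continuousOn_log.mono fun x hx => by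
        have : 0 < x := by linarith [hx.1]
        simpa using this.ne'
    unfold kelvinHicksAux
    fun_prop
  have hmem : (0 : ℝ) ∈
      Set.Icc (kelvinHicksAux c K L (c - η)) (kelvinHicksAux c K L (c + η)) := by
    simp only [kelvinHicksAux]
    constructor <;> linarith
  exact intermediate_value_Icc (by linarith) hcont hmem

/-- **The Kelvin–Hicks function has a unique zero** (Lemma 3.15). For small `ε`, the function
`g_ε(x) = W x ln(1/ε) − (κ/4π)(ln(8x/s₀(x)) − 1/4)`, with `s₀(x) = ε √(κ/(πx))`, has exactly
one zero `x*(ε)` in `[δ₀, ∞)`, and `x*(ε) → κ/(4πW)` as `ε → 0⁺`. -/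
theorem kelvin_hicks_unique_zero (κ W δ₀ : ℝ)
    (hκ : 0 < κ) (hW : 0 < W) (hδ₀ : 0 < δ₀) (hδ₀' : δ₀ < κ / (4 * π * W)) :
    ∃ ε₀ : ℝ, 0 < ε₀ ∧ ε₀ < 1 ∧ ∃ xstar : ℝ → ℝ,
      (∀ ε ∈ Set.Ioc (0 : ℝ) ε₀,
        xstar ε ∈ Set.Ici δ₀ ∧
        W * xstar ε * Real.log (1 / ε)
            - κ / (4 * π) *
              (Real.log (8 * xstar ε / (ε * Real.sqrt (κ / (π * xstar ε)))) - 1 / 4) = 0 ∧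
        ∀ y ∈ Set.Ici δ₀,
          W * y * Real.log (1 / ε)
              - κ / (4 * π) *
                (Real.log (8 * y / (ε * Real.sqrt (κ / (π * y)))) - 1 / 4) = 0 →
          y = xstar ε) ∧
      Filter.Tendsto xstar (nhdsWithin 0 (Set.Ioc 0 ε₀)) (nhds (κ / (4 * π * W))) := by
  set c := κ / (4 * π * W)
  set K := Real.log 8 - (Real.log κ - Real.log π) / 2 - 1 / 4
  have hc : 0 < c := hδ₀.trans hδ₀'
  obtain ⟨L₁, hL₁⟩ := eventually_atTop.1 ((eventually_gt_atTop (3 / 2 * c / δ₀)).and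
    (kelvinHicksAux_eventually_exists_zero (c := c) (K := K) (η := c - δ₀)
      (by linarith) (by linarith)))
  set L₀ := max L₁ 1
  have hlog_ge : ∀ ε ∈ Set.Ioc (0 : ℝ) (Real.exp (-L₀)), L₁ ≤ Real.log (1 / ε) := by
    intro ε hε
    have h := (Real.log_le_iff_le_exp hε.1).2 hε.2
    rw [one_div, Real.log_inv]
    linarith [le_max_left L₁ 1]
  have hzero_iff : ∀ {ε x : ℝ}, 0 < ε → δ₀ ≤ x →
      (W * x * Real.log (1 / ε)
        - κ / (4 * π) * (Real.log (8 * x / (ε * Real.sqrt (κ / (π * x)))) - 1 / 4) = 0 ↔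
      kelvinHicksAux c K (Real.log (1 / ε)) x = 0) := by
    intro ε x hε hx
    rw [kelvinHicks_eq_mul_aux hκ hW hε (hδ₀.trans_le hx), mul_eq_zero]
    simp [hW.ne', c, K]
  have hexists : ∀ ε ∈ Set.Ioc (0 : ℝ) (Real.exp (-L₀)),
      ∃ x, δ₀ ≤ x ∧ kelvinHicksAux c K (Real.log (1 / ε)) x = 0 := by
    intro ε hε
    obtain ⟨x, hx, hx0⟩ := (hL₁ _ (hlog_ge ε hε)).2
    exact ⟨x, by linarith [hx.1], hx0⟩
  have hunique : ∀ ε ∈ Set.Ioc (0 : ℝ) (Real.exp (-L₀)), ∀ x y : ℝ, δ₀ ≤ x → δ₀ ≤ y →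
      kelvinHicksAux c K (Real.log (1 / ε)) x = 0 →
      kelvinHicksAux c K (Real.log (1 / ε)) y = 0 → x = y := by
    intro ε hε x y hx hy hx0 hy0
    exact (kelvinHicksAux_strictMonoOn hc hδ₀ (hL₁ _ (hlog_ge ε hε)).1).injOn hx hy
      (hx0.trans hy0.symm)
  choose! xstar hxstar_ge hxstar_zero using hexists
  refine ⟨Real.exp (-L₀), Real.exp_pos _, ?_, xstar, fun ε hε => ⟨hxstar_ge ε hε, ?_, ?_⟩, ?_⟩
  · rw [Real.exp_lt_one_iff]
    linarith [le_max_right L₁ 1]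
  · exact (hzero_iff hε.1 (hxstar_ge ε hε)).2 (hxstar_zero ε hε)
  · intro y hy hy0
    exact hunique ε hε y _ hy (hxstar_ge ε hε) ((hzero_iff hε.1 hy).1 hy0) (hxstar_zero ε hε)
  · have hlog : Tendsto (fun ε : ℝ => Real.log (1 / ε))
        (nhdsWithin 0 (Set.Ioc 0 (Real.exp (-L₀)))) atTop := by
      have h : Tendsto (fun ε : ℝ => Real.log (1 / ε)) (nhdsWithin 0 (Set.Ioi 0)) atTop := by
        simpa only [one_div, Function.comp_def] using
          Real.tendsto_log_atTop.comp (tendsto_inv_nhdsGT_zero (𝕜 := ℝ))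
      exact h.mono_left (nhdsWithin_mono 0 fun ε hε => hε.1)
    rw [Metric.tendsto_nhds]
    intro r hr
    have hη : 0 < min (r / 2) (c - δ₀) := lt_min (by linarith) (by linarith)
    have hη_le : min (r / 2) (c - δ₀) ≤ c - δ₀ := min_le_right _ _
    have hη_r : min (r / 2) (c - δ₀) ≤ r / 2 := min_le_left _ _
    filter_upwards [hlog.eventually
      (kelvinHicksAux_eventually_exists_zero (c := c) (K := K) hη (hη_le.trans_lt (by linarith))),
      self_mem_nhdsWithin] with ε hex hε
    obtain ⟨x, hx, hx0⟩ := hex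
    rw [← hunique ε hε x _ (by linarith [hx.1]) (hxstar_ge ε hε) hx0 (hxstar_zero ε hε),
      Real.dist_eq, abs_lt]
    constructor <;> linarith [hx.1, hx.2]
end
end

section
/- (Symmetry of the cross-section by the method of moving planes.) Let R > 0 and W, μ ∈ ℝ. Suppose A is a bounded measurable set whose closure is contained in Π, and that A = {x ∈ B_R(0) : x₁ > 0 and ψ(x) + (W/2) x₁² > μ}, where ψ(x) := (1/(4π)) ∫_Π G_*(x,x') 1_A(x') dx'. Then there exists h ∈ ℝ such that A is symmetric with respect to the horizontal line {x₂ = h}, i.e. (x₁, x₂) ∈ A if and only if (x₁, 2h − x₂) ∈ A. -/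
open MeasureTheory Real Filter
open scoped RealInnerProductSpace

noncomputable section

/-! ### The ring kernel -/

/-- The angular integral in the definition of `Gstar`. -/
def ringKer (r r' s : ℝ) : ℝ :=
  ∫ θ in (-π)..π, cos θ / √(s ^ 2 + r ^ 2 + r' ^ 2 - 2 * r * r' * cos θ)

/-- The model singularity `|z|^(-2/3)`. -/
def sing (z : ℝ) : ℝ := |z| ^ (-(2 / 3) : ℝ)

lemma sing_nonneg (z : ℝ) : 0 ≤ sing z := by unfold sing; positivity

lemma sing_neg (z : ℝ) : sing (-z) = sing z := by simp [sing]

lemma ringKer_neg (r r' s : ℝ) : ringKer r r' (-s) = ringKer r r' s := by simp [ringKer]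

/-- Quantitative strict convexity of `x ↦ x^(-1/2)`, as a mixed second difference. -/
lemma inv_sqrt_mixed_diff {X α β N : ℝ} (hX : 0 < X) (hα : 0 ≤ α) (hβ : 0 ≤ β)
    (hN : X + α + β ≤ N) :
    α * β / (4 * √N ^ 5) ≤ 1 / √X - 1 / √(X + α) - (1 / √(X + β) - 1 / √(X + α + β)) := by
  have hp : 0 < √X := sqrt_pos.2 hX
  have hpq : √X ≤ √(X + β) := sqrt_le_sqrt (by linarith)
  have hpu : √X ≤ √(X + α) := sqrt_le_sqrt (by linarith)
  have huv : √(X + α) ≤ √(X + α + β) := sqrt_le_sqrt (by linarith)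
  have hqv : √(X + β) ≤ √(X + α + β) := sqrt_le_sqrt (by linarith)
  have hvn : √(X + α + β) ≤ √N := sqrt_le_sqrt hN
  have hp2 : √X ^ 2 = X := sq_sqrt hX.le
  have hq2 : √(X + β) ^ 2 = X + β := sq_sqrt (by linarith)
  have hu2 : √(X + α) ^ 2 = X + α := sq_sqrt (by linarith)
  have hv2 : √(X + α + β) ^ 2 = X + α + β := sq_sqrt (by linarith)
  generalize √X = p at *
  generalize √(X + β) = q at *
  generalize √(X + α) = u at *
  generalize √(X + α + β) = v at *
  generalize √N = n at *
  have hq : 0 < q := by linarith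
  have hu : 0 < u := by linarith
  have hv : 0 < v := by linarith
  have hn : 0 < n := by linarith
  have e1 : 1 / p - 1 / q = β / (p * q * (p + q)) := by
    have : β = (q - p) * (p + q) := by nlinarith
    rw [this]; field_simp
  have e2 : 1 / u - 1 / v = β / (u * v * (u + v)) := by
    have : β = (v - u) * (u + v) := by nlinarith
    rw [this]; field_simp
  have e3 : 1 / p - 1 / u - (1 / q - 1 / v) =
      β * (u * v * (u + v) - p * q * (p + q)) / (p * q * (p + q) * (u * v * (u + v))) := by
    have : 1 / p - 1 / u - (1 / q - 1 / v) = (1 / p - 1 / q) - (1 / u - 1 / v) := by ring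
    rw [this, e1, e2]; field_simp
  rw [e3]
  have hnum : α * q ≤ u * v * (u + v) - p * q * (p + q) := by
    have h1 : p * q * q ≤ u * v * v := by gcongr
    have h2 : u ^ 2 * q ≤ u ^ 2 * v := by gcongr
    have h3 : α * q = u ^ 2 * q - p ^ 2 * q := by rw [hu2, hp2]; ring
    nlinarith
  have hden1 : p * q * (p + q) ≤ 2 * n ^ 2 * q := by
    have : p * q * (p + q) ≤ n * q * (n + n) := by gcongr <;> linarith
    linarith
  have hden2 : u * v * (u + v) ≤ 2 * n ^ 3 := by
    have : u * v * (u + v) ≤ n * n * (n + n) := by gcongr <;> linarith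
    linarith
  calc α * β / (4 * n ^ 5) = β * (α * q) / ((2 * n ^ 2 * q) * (2 * n ^ 3)) := by
        field_simp; ring
    _ ≤ _ := by
        have : 0 ≤ u * v * (u + v) - p * q * (p + q) := le_trans (by positivity) hnum
        gcongr

lemma ringDen_pos {r r' s : ℝ} (hr : 0 < r) (hr' : 0 < r') (h : 0 < s ^ 2 + (r - r') ^ 2)
    (θ : ℝ) : 0 < s ^ 2 + r ^ 2 + r' ^ 2 - 2 * r * r' * cos θ := by
  have : 2 * r * r' * cos θ ≤ 2 * r * r' * 1 := by gcongr; exact cos_le_one θ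
  nlinarith

lemma continuous_ringIntegrand {r r' s : ℝ} (hr : 0 < r) (hr' : 0 < r')
    (h : 0 < s ^ 2 + (r - r') ^ 2) :
    Continuous fun θ => cos θ / √(s ^ 2 + r ^ 2 + r' ^ 2 - 2 * r * r' * cos θ) := by
  refine continuous_cos.div (by fun_prop) fun θ => ?_
  exact (sqrt_pos.2 (ringDen_pos hr hr' h θ)).ne'

/-- The ring kernel decreases in the axial distance, quantitatively. -/
lemma ringKer_sub_lower {r r' s₁ s₂ N : ℝ} (hr : 0 < r) (hr' : 0 < r')
    (h : 0 < s₁ ^ 2 + (r - r') ^ 2) (hs : s₁ ^ 2 ≤ s₂ ^ 2) (hN : s₂ ^ 2 + (r + r') ^ 2 ≤ N) :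
    (s₂ ^ 2 - s₁ ^ 2) * (2 * r * r') / (4 * √N ^ 5) * π ≤ ringKer r r' s₁ - ringKer r r' s₂ := by
  have h2 : 0 < s₂ ^ 2 + (r - r') ^ 2 := by linarith
  have c1 := continuous_ringIntegrand hr hr' h
  have c2 := continuous_ringIntegrand hr hr' h2
  unfold ringKer
  rw [← intervalIntegral.integral_sub (c1.intervalIntegrable _ _) (c2.intervalIntegrable _ _)]
  set κ : ℝ := (s₂ ^ 2 - s₁ ^ 2) * (2 * r * r') / (4 * √N ^ 5) with hκ
  set φ : ℝ := 1 / √(s₁ ^ 2 + r ^ 2 + r' ^ 2) - 1 / √(s₂ ^ 2 + r ^ 2 + r' ^ 2) with hφ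
  have e : κ * π = ∫ θ in (-π)..π, (φ * cos θ + κ * cos θ ^ 2) := by
    rw [intervalIntegral.integral_add (by apply Continuous.intervalIntegrable; fun_prop)
      (by apply Continuous.intervalIntegrable; fun_prop), intervalIntegral.integral_const_mul,
      intervalIntegral.integral_const_mul, integral_cos, integral_cos_sq]
    simp
  rw [e]
  refine intervalIntegral.integral_mono_on (by linarith [pi_pos])
    (by apply Continuous.intervalIntegrable; fun_prop) ((c1.sub c2).intervalIntegrable _ _)
    fun θ _ => ?_
  have hm : 0 < 2 * r * r' := by positivity
  have hd1 := ringDen_pos hr hr' h θ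
  have hw1 := cos_le_one θ
  have hw2 := neg_one_le_cos θ
  generalize cos θ = w at *
  rcases le_total 0 w with hw | hw
  · have hmw : 2 * r * r' * w ≤ 2 * r * r' * 1 := by gcongr
    have key := inv_sqrt_mixed_diff (X := s₁ ^ 2 + r ^ 2 + r' ^ 2 - 2 * r * r' * w)
      (α := s₂ ^ 2 - s₁ ^ 2) (β := 2 * r * r' * w) (N := N) hd1 (by linarith) (by positivity)
      (by nlinarith)
    have a1 : s₁ ^ 2 + r ^ 2 + r' ^ 2 - 2 * r * r' * w + (s₂ ^ 2 - s₁ ^ 2) =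
      s₂ ^ 2 + r ^ 2 + r' ^ 2 - 2 * r * r' * w := by ring
    rw [a1, sub_add_cancel, sub_add_cancel] at key
    have := mul_le_mul_of_nonneg_left key hw
    have e1 : w * ((s₂ ^ 2 - s₁ ^ 2) * (2 * r * r' * w) / (4 * √N ^ 5)) = κ * w ^ 2 := by
      rw [hκ]; ring
    rw [e1, ← hφ] at this
    simp only [div_eq_mul_inv, one_mul] at this ⊢
    linarith
  · have hmw : 2 * r * r' * (-w) ≤ 2 * r * r' * 1 := by gcongr; linarith
    have key := inv_sqrt_mixed_diff (X := s₁ ^ 2 + r ^ 2 + r' ^ 2)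
      (α := s₂ ^ 2 - s₁ ^ 2) (β := 2 * r * r' * (-w)) (N := N) (by positivity) (by linarith)
      (mul_nonneg hm.le (by linarith)) (by nlinarith)
    have a1 : s₁ ^ 2 + r ^ 2 + r' ^ 2 + (s₂ ^ 2 - s₁ ^ 2) = s₂ ^ 2 + r ^ 2 + r' ^ 2 := by ring
    have a2 : ∀ z, z + 2 * r * r' * (-w) = z - 2 * r * r' * w := fun z => by ring
    rw [a1, a2, a2, ← hφ] at key
    have := mul_le_mul_of_nonneg_left key (neg_nonneg.2 hw)
    have e1 : -w * ((s₂ ^ 2 - s₁ ^ 2) * (2 * r * r' * (-w)) / (4 * √N ^ 5)) = κ * w ^ 2 := by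
      rw [hκ]; ring
    rw [e1] at this
    simp only [div_eq_mul_inv, one_mul] at this ⊢
    linarith

/-- Product bound for the inverse square of the distance in three dimensions. -/
lemma inv_sq_le_sing {s u v a : ℝ} (hs : s ≠ 0) (hu : u ≠ 0) (hv : v ≠ 0)
    (h : s ^ 2 + u ^ 2 + v ^ 2 ≤ a ^ 2) : 1 / a ^ 2 ≤ sing s * sing u * sing v := by
  have hs' : 0 < |s| := abs_pos.2 hs
  have hu' : 0 < |u| := abs_pos.2 hu
  have hv' : 0 < |v| := abs_pos.2 hv
  have ha : 0 < |a| := by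
    have : 0 < s ^ 2 := by positivity
    rw [abs_pos]; rintro rfl; nlinarith [sq_nonneg u, sq_nonneg v]
  have key : ∀ z, z ^ 2 ≤ a ^ 2 → z ≠ 0 → |a| ^ (-(2 / 3) : ℝ) ≤ sing z := fun z hz hz0 =>
    rpow_le_rpow_of_nonpos (abs_pos.2 hz0) (sq_le_sq.1 hz) (by norm_num)
  have e : 1 / a ^ 2 = |a| ^ (-(2 / 3) : ℝ) * |a| ^ (-(2 / 3) : ℝ) * |a| ^ (-(2 / 3) : ℝ) := by
    rw [← rpow_add ha, ← rpow_add ha, ← sq_abs, one_div, ← rpow_natCast, ← rpow_neg ha.le]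
    norm_num
  rw [e]
  have := key s (by nlinarith [sq_nonneg u, sq_nonneg v]) hs
  have := key u (by nlinarith [sq_nonneg s, sq_nonneg v]) hu
  have := key v (by nlinarith [sq_nonneg u, sq_nonneg s]) hv
  gcongr
  · exact mul_nonneg (sing_nonneg _) (sing_nonneg _)
  · exact sing_nonneg _

lemma intervalIntegrable_sing (a b : ℝ) : IntervalIntegrable sing volume a b := by
  have key : ∀ c : ℝ, 0 ≤ c → IntervalIntegrable sing volume 0 c := fun c hc => by
    refine (intervalIntegral.intervalIntegrable_rpow' (r := -(2 / 3)) (a := 0) (b := c)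
      (by norm_num)).congr ?_
    intro x hx
    rw [Set.uIoc_of_le hc] at hx
    simp [sing, abs_of_pos hx.1]
  have key2 : ∀ c : ℝ, IntervalIntegrable sing volume 0 c := fun c => by
    rcases le_total 0 c with hc | hc
    · exact key c hc
    · have := (key (-c) (by linarith)).comp_sub_left 0
      simpa [sing_neg] using this
  exact (key2 a).symm.trans (key2 b)

lemma integral_sing {τ : ℝ} (hτ : 0 ≤ τ) :
    ∫ z in Set.Ioc (-τ) τ, sing z = 6 * τ ^ (1 / 3 : ℝ) := by
  rw [← intervalIntegral.integral_of_le (by linarith),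
    ← intervalIntegral.integral_add_adjacent_intervals (intervalIntegrable_sing _ 0)
      (intervalIntegrable_sing 0 _)]
  have e1 : ∫ z in (-τ)..0, sing z = ∫ z in (0 : ℝ)..τ, sing z := by
    have := intervalIntegral.integral_comp_neg (a := 0) (b := τ) sing
    simp only [sing_neg, neg_zero] at this
    exact this.symm
  have e2 : ∫ z in (0 : ℝ)..τ, sing z = 3 * τ ^ (1 / 3 : ℝ) := by
    have : ∫ z in (0 : ℝ)..τ, sing z = ∫ z in (0 : ℝ)..τ, z ^ (-(2 / 3) : ℝ) := by
      refine intervalIntegral.integral_congr fun x hx => ?_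
      rw [Set.uIcc_of_le hτ] at hx
      simp [sing, abs_of_nonneg hx.1]
    rw [this, integral_rpow (Or.inl (by norm_num))]
    norm_num
    ring
  rw [e1, e2]; ring

lemma integrableOn_sing_sub (x : ℝ) (a b : ℝ) :
    IntegrableOn (fun y => sing (x - y)) (Set.Icc a b) := by
  rw [integrableOn_Icc_iff_integrableOn_Ioc]
  by_cases hab : a ≤ b
  · rw [← intervalIntegrable_iff_integrableOn_Ioc_of_le hab]
    have := (intervalIntegrable_sing (x - a) (x - b)).comp_sub_left x
    simpa using this
  · simp [Set.Ioc_eq_empty (fun h => hab h.le)]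

lemma setIntegral_sing_sub_le (x : ℝ) {a b : ℝ} (hab : a < b) :
    ∫ y in Set.Icc a b, sing (x - y) ≤ 7 * (b - a) ^ (1 / 3 : ℝ) := by
  set τ := b - a with hτd
  have hτ : 0 < τ := by linarith
  have hi : Integrable (fun y => (Set.Ioc (-τ) τ).indicator sing (x - y)) := by
    have : Integrable ((Set.Ioc (-τ) τ).indicator sing) := by
      rw [integrable_indicator_iff measurableSet_Ioc,
        ← intervalIntegrable_iff_integrableOn_Ioc_of_le (by linarith)]
      exact intervalIntegrable_sing _ _
    exact this.comp_sub_left x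
  calc ∫ y in Set.Icc a b, sing (x - y)
      ≤ ∫ y in Set.Icc a b, ((Set.Ioc (-τ) τ).indicator sing (x - y) + τ ^ (-(2 / 3) : ℝ)) := by
        refine setIntegral_mono_on (integrableOn_sing_sub x a b) ?_ measurableSet_Icc
          fun y _ => ?_
        · exact hi.integrableOn.add (integrableOn_const (by simp))
        · by_cases hy : x - y ∈ Set.Ioc (-τ) τ
          · rw [Set.indicator_of_mem hy]
            linarith [rpow_nonneg hτ.le (-(2 / 3))]
          · rw [Set.indicator_of_notMem hy, zero_add]
            refine rpow_le_rpow_of_nonpos hτ ?_ (by norm_num)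
            by_contra! hlt
            exact hy ⟨(abs_lt.1 hlt).1, (abs_lt.1 hlt).2.le⟩
    _ = (∫ y in Set.Icc a b, (Set.Ioc (-τ) τ).indicator sing (x - y))
          + τ * τ ^ (-(2 / 3) : ℝ) := by
        rw [integral_add hi.integrableOn (integrableOn_const (by simp))]
        simp [← hτd, hτ.le]
    _ ≤ (∫ y, (Set.Ioc (-τ) τ).indicator sing (x - y)) + τ * τ ^ (-(2 / 3) : ℝ) := by
        gcongr
        · exact Eventually.of_forall fun y => Set.indicator_nonneg (fun z _ => sing_nonneg z) _
        · exact Measure.restrict_le_self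
    _ = 7 * τ ^ (1 / 3 : ℝ) := by
        rw [integral_sub_left_eq_self ((Set.Ioc (-τ) τ).indicator sing) volume x,
          integral_indicator measurableSet_Ioc, integral_sing hτ.le]
        have : τ * τ ^ (-(2 / 3) : ℝ) = τ ^ (1 / 3 : ℝ) := by
          nth_rewrite 1 [← rpow_one τ]
          rw [← rpow_add hτ]; norm_num
        rw [this]; ring

/-- The angular factor of the product bound on the ring kernel. -/
def angConst (δ : ℝ) : ℝ := ∫ θ in (-π)..π, sing (2 * δ / π * θ)

lemma angConst_nonneg (δ : ℝ) : 0 ≤ angConst δ :=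
  intervalIntegral.integral_nonneg (by linarith [pi_pos]) fun _ _ => sing_nonneg _

lemma intervalIntegrable_sing_mul {δ : ℝ} (hδ : 0 < δ) :
    IntervalIntegrable (fun θ => sing (2 * δ / π * θ)) volume (-π) π := by
  have hc : 2 * δ / π ≠ 0 := by positivity
  have := (intervalIntegrable_sing (2 * δ / π * (-π)) (2 * δ / π * π)).comp_mul_left
    (c := 2 * δ / π)
  rwa [mul_div_cancel_left₀ _ hc, mul_div_cancel_left₀ _ hc] at this

lemma inv_ringDen_le {δ r r' s θ : ℝ} (hδ : 0 < δ) (hr : δ ≤ r) (hr' : δ ≤ r') (hs : s ≠ 0)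
    (hu : r - r' ≠ 0) (hθ : |θ| ≤ π) (hθ0 : θ ≠ 0) :
    1 / √(s ^ 2 + r ^ 2 + r' ^ 2 - 2 * r * r' * cos θ) ^ 2 ≤
      sing s * sing (r - r') * sing (2 * δ / π * θ) := by
  refine inv_sq_le_sing hs hu (by positivity) ?_
  have hpos := ringDen_pos (s := s) (hδ.trans_le hr) (hδ.trans_le hr') (by positivity) θ
  rw [sq_sqrt hpos.le]
  have hcos := cos_le_one_sub_mul_cos_sq hθ
  have h1 : δ * δ ≤ r * r' := mul_le_mul hr hr' hδ.le (hδ.le.trans hr)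
  have h2 : 0 ≤ 2 / π ^ 2 * θ ^ 2 := by positivity
  have h3 : (δ * δ) * (2 / π ^ 2 * θ ^ 2) ≤ (r * r') * (1 - cos θ) :=
    mul_le_mul h1 (by linarith) h2 ((by positivity : 0 ≤ δ * δ).trans h1)
  have h4 : (2 * δ / π * θ) ^ 2 = 2 * (δ * δ) * (2 / π ^ 2 * θ ^ 2) := by
    field_simp
  rw [h4]
  nlinarith

lemma ae_ne_zero_and_abs_le_pi :
    ∀ᵐ θ : ℝ, θ ∈ Set.uIoc (-π) π → θ ≠ 0 ∧ |θ| ≤ π := by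
  filter_upwards [Measure.ae_ne volume (0 : ℝ)] with θ h0 hθ
  rw [Set.uIoc_of_le (by linarith [pi_pos])] at hθ
  exact ⟨h0, abs_le.2 ⟨hθ.1.le, hθ.2⟩⟩

lemma abs_ringKer_le {δ r r' s : ℝ} (hδ : 0 < δ) (hr : δ ≤ r) (hr' : δ ≤ r') (hs : s ≠ 0)
    (hu : r - r' ≠ 0) :
    |ringKer r r' s| ≤ π + angConst δ / 2 * (sing s * sing (r - r')) := by
  have hg : IntervalIntegrable (fun θ => 1 / 2 +
      (sing s * sing (r - r') / 2) * sing (2 * δ / π * θ)) volume (-π) π :=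
    intervalIntegrable_const.add ((intervalIntegrable_sing_mul hδ).const_mul _)
  have key : ‖ringKer r r' s‖ ≤ ∫ θ in (-π)..π, (1 / 2 +
      (sing s * sing (r - r') / 2) * sing (2 * δ / π * θ)) := by
    refine intervalIntegral.norm_integral_le_of_norm_le (by linarith [pi_pos]) ?_ hg
    filter_upwards [ae_ne_zero_and_abs_le_pi] with θ hθ hmem
    rw [← Set.uIoc_of_le (by linarith [pi_pos])] at hmem
    obtain ⟨h0, h1⟩ := hθ hmem
    have := inv_ringDen_le hδ hr hr' hs hu h1 h0
    rw [← one_div_pow] at this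
    set a := √(s ^ 2 + r ^ 2 + r' ^ 2 - 2 * r * r' * cos θ)
    have ha : 0 ≤ 1 / a := by positivity
    have : |cos θ| * (1 / a) ≤ 1 * (1 / a) := by gcongr; exact abs_cos_le_one θ
    rw [div_eq_mul_one_div, norm_mul, Real.norm_eq_abs, Real.norm_eq_abs, abs_of_nonneg ha]
    nlinarith [sq_nonneg (1 / a - 1)]
  rw [← Real.norm_eq_abs]
  refine key.trans (le_of_eq ?_)
  rw [intervalIntegral.integral_add intervalIntegrable_const
    ((intervalIntegrable_sing_mul hδ).const_mul _), intervalIntegral.integral_const,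
    intervalIntegral.integral_const_mul, ← angConst, smul_eq_mul]
  ring

lemma abs_inv_sub_inv_le {a b d : ℝ} (ha : 0 < a) (hb : 0 < b) (h : |a - b| ≤ d) :
    |1 / a - 1 / b| ≤ d / 2 * (1 / a ^ 2 + 1 / b ^ 2) := by
  have e : 1 / a - 1 / b = -((a - b) * (1 / a * (1 / b))) := by field_simp; ring
  have hp : 0 ≤ 1 / a * (1 / b) := by positivity
  rw [e, abs_neg, abs_mul, abs_of_nonneg hp, ← one_div_pow, ← one_div_pow]
  have h1 : 1 / a * (1 / b) ≤ ((1 / a) ^ 2 + (1 / b) ^ 2) / 2 := by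
    nlinarith [sq_nonneg (1 / a - 1 / b)]
  calc _ ≤ d * (((1 / a) ^ 2 + (1 / b) ^ 2) / 2) :=
        mul_le_mul h h1 hp ((abs_nonneg _).trans h)
    _ = _ := by ring

lemma abs_sqrt_ringDen_sub_le {r₁ r₂ r' s₁ s₂ w : ℝ} (hw : w ^ 2 ≤ 1)
    (h₁ : 0 < s₁ ^ 2 + r₁ ^ 2 + r' ^ 2 - 2 * r₁ * r' * w)
    (h₂ : 0 < s₂ ^ 2 + r₂ ^ 2 + r' ^ 2 - 2 * r₂ * r' * w) :
    |√(s₁ ^ 2 + r₁ ^ 2 + r' ^ 2 - 2 * r₁ * r' * w) -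
      √(s₂ ^ 2 + r₂ ^ 2 + r' ^ 2 - 2 * r₂ * r' * w)| ≤ |s₁ - s₂| + |r₁ - r₂| := by
  have hcomp : ∀ s r : ℝ, 0 < s ^ 2 + r ^ 2 + r' ^ 2 - 2 * r * r' * w →
      |s| ≤ √(s ^ 2 + r ^ 2 + r' ^ 2 - 2 * r * r' * w) ∧
      |r - r' * w| ≤ √(s ^ 2 + r ^ 2 + r' ^ 2 - 2 * r * r' * w) := fun s r _ => by
    have : r' ^ 2 * w ^ 2 ≤ r' ^ 2 * 1 := by gcongr
    constructor
    · exact abs_le_sqrt (by nlinarith [sq_nonneg (r - r' * w)])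
    · exact abs_le_sqrt (by nlinarith [sq_nonneg s])
  obtain ⟨a1, a2⟩ := hcomp s₁ r₁ h₁
  obtain ⟨b1, b2⟩ := hcomp s₂ r₂ h₂
  have ha := sqrt_pos.2 h₁
  have hb := sqrt_pos.2 h₂
  have ha2 := sq_sqrt h₁.le
  have hb2 := sq_sqrt h₂.le
  generalize √(s₁ ^ 2 + r₁ ^ 2 + r' ^ 2 - 2 * r₁ * r' * w) = a at *
  generalize √(s₂ ^ 2 + r₂ ^ 2 + r' ^ 2 - 2 * r₂ * r' * w) = b at *
  have e : (a - b) * (a + b) = (s₁ - s₂) * (s₁ + s₂) +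
      (r₁ - r₂) * ((r₁ - r' * w) + (r₂ - r' * w)) := by nlinarith
  have hab : 0 < a + b := by linarith
  refine le_of_mul_le_mul_right ?_ hab
  calc |a - b| * (a + b) = |(a - b) * (a + b)| := by rw [abs_mul, abs_of_pos hab]
    _ ≤ |s₁ - s₂| * |s₁ + s₂| + |r₁ - r₂| * |(r₁ - r' * w) + (r₂ - r' * w)| := by
        rw [e, ← abs_mul, ← abs_mul]; exact abs_add_le _ _
    _ ≤ |s₁ - s₂| * (a + b) + |r₁ - r₂| * (a + b) := by
        gcongr
        · exact (abs_add_le _ _).trans (by linarith)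
        · exact (abs_add_le _ _).trans (by linarith)
    _ = _ := by ring

lemma abs_ringKer_sub_le {δ r₁ r₂ r' s₁ s₂ : ℝ} (hδ : 0 < δ) (hr₁ : δ ≤ r₁) (hr₂ : δ ≤ r₂)
    (hr' : δ ≤ r') (hs₁ : s₁ ≠ 0) (hs₂ : s₂ ≠ 0) (hu₁ : r₁ - r' ≠ 0) (hu₂ : r₂ - r' ≠ 0) :
    |ringKer r₁ r' s₁ - ringKer r₂ r' s₂| ≤ (|s₁ - s₂| + |r₁ - r₂|) * (angConst δ / 2) *
      (sing s₁ * sing (r₁ - r') + sing s₂ * sing (r₂ - r')) := by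
  have p1 : 0 < s₁ ^ 2 + (r₁ - r') ^ 2 := by positivity
  have p2 : 0 < s₂ ^ 2 + (r₂ - r') ^ 2 := by positivity
  have q0 := hδ.trans_le hr'
  have q1 := hδ.trans_le hr₁
  have q2 := hδ.trans_le hr₂
  have c1 := continuous_ringIntegrand q1 q0 p1
  have c2 := continuous_ringIntegrand q2 q0 p2
  set d := |s₁ - s₂| + |r₁ - r₂| with hd
  have hd0 : 0 ≤ d := by positivity
  set S := sing s₁ * sing (r₁ - r') + sing s₂ * sing (r₂ - r')
  rw [ringKer, ringKer,
    ← intervalIntegral.integral_sub (c1.intervalIntegrable _ _) (c2.intervalIntegrable _ _),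
    ← Real.norm_eq_abs]
  have hg : IntervalIntegrable (fun θ => d / 2 * S * sing (2 * δ / π * θ)) volume (-π) π :=
    (intervalIntegrable_sing_mul hδ).const_mul _
  refine (intervalIntegral.norm_integral_le_of_norm_le (by linarith [pi_pos]) ?_ hg).trans
    (le_of_eq ?_)
  · filter_upwards [ae_ne_zero_and_abs_le_pi] with θ hθ hmem
    rw [← Set.uIoc_of_le (by linarith [pi_pos])] at hmem
    obtain ⟨h0, h1⟩ := hθ hmem
    have k1 := inv_ringDen_le hδ hr₁ hr' hs₁ hu₁ h1 h0
    have k2 := inv_ringDen_le hδ hr₂ hr' hs₂ hu₂ h1 h0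
    have d1 := ringDen_pos q1 q0 p1 θ
    have d2 := ringDen_pos q2 q0 p2 θ
    have := abs_inv_sub_inv_le (sqrt_pos.2 d1) (sqrt_pos.2 d2)
      (abs_sqrt_ringDen_sub_le (cos_sq_le_one θ) d1 d2)
    rw [← hd] at this
    rw [div_eq_mul_one_div, div_eq_mul_one_div (cos θ), ← mul_sub, norm_mul, Real.norm_eq_abs,
      Real.norm_eq_abs]
    calc _ ≤ 1 * |1 / √(s₁ ^ 2 + r₁ ^ 2 + r' ^ 2 - 2 * r₁ * r' * cos θ) -
            1 / √(s₂ ^ 2 + r₂ ^ 2 + r' ^ 2 - 2 * r₂ * r' * cos θ)| := by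
          gcongr; exact abs_cos_le_one θ
      _ ≤ d / 2 * (sing s₁ * sing (r₁ - r') * sing (2 * δ / π * θ) +
            sing s₂ * sing (r₂ - r') * sing (2 * δ / π * θ)) := by
          rw [one_mul]
          refine this.trans ?_
          gcongr
      _ = _ := by ring
  · rw [intervalIntegral.integral_const_mul, ← angConst]; ring

/-! ### The potential of a planar set -/

lemma measurable_ringKer : Measurable fun p : ℝ × ℝ × ℝ => ringKer p.1 p.2.1 p.2.2 := by
  have : StronglyMeasurable fun q : (ℝ × ℝ × ℝ) × ℝ => cos q.2 /
      √(q.1.2.2 ^ 2 + q.1.1 ^ 2 + q.1.2.1 ^ 2 - 2 * q.1.1 * q.1.2.1 * cos q.2) := by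
    apply Measurable.stronglyMeasurable; fun_prop
  have h := this.integral_prod_right' (ν := volume.restrict (Set.Ioc (-π) π))
  have e : (fun p : ℝ × ℝ × ℝ => ringKer p.1 p.2.1 p.2.2) = fun p => ∫ θ, cos θ /
      √(p.2.2 ^ 2 + p.1 ^ 2 + p.2.1 ^ 2 - 2 * p.1 * p.2.1 * cos θ)
        ∂(volume.restrict (Set.Ioc (-π) π)) := by
    ext p
    rw [ringKer, intervalIntegral.integral_of_le (by linarith [pi_pos])]
  rw [e]
  exact h.measurable

/-- The integrand of the potential. -/
def potKer (x y : ℝ × ℝ) : ℝ := y.1 ^ 2 * ringKer x.1 y.1 (x.2 - y.2)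

/-- The model singularity of the potential. -/
def singKer (x y : ℝ × ℝ) : ℝ := sing (x.1 - y.1) * sing (x.2 - y.2)

/-- The ring potential of a planar set. -/
def potential (A : Set (ℝ × ℝ)) (x : ℝ × ℝ) : ℝ := ∫ y in A, potKer x y

lemma singKer_nonneg (x y : ℝ × ℝ) : 0 ≤ singKer x y := mul_nonneg (sing_nonneg _) (sing_nonneg _)

lemma measurable_potKer (x : ℝ × ℝ) : Measurable (potKer x) := by
  unfold potKer
  have : Measurable fun y : ℝ × ℝ => ringKer x.1 y.1 (x.2 - y.2) :=
    measurable_ringKer.comp (g := fun p : ℝ × ℝ × ℝ => ringKer p.1 p.2.1 p.2.2)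
      (f := fun y : ℝ × ℝ => (x.1, y.1, x.2 - y.2)) (by fun_prop)
  fun_prop

lemma ae_coords_ne (x : ℝ × ℝ) : ∀ᵐ y : ℝ × ℝ, x.1 - y.1 ≠ 0 ∧ x.2 - y.2 ≠ 0 := by
  have h1 : ∀ᵐ y : ℝ × ℝ, y.1 ≠ x.1 :=
    (Measure.quasiMeasurePreserving_fst (μ := (volume : Measure ℝ)) (ν := (volume : Measure ℝ))).ae
      (Measure.ae_ne volume x.1)
  have h2 : ∀ᵐ y : ℝ × ℝ, y.2 ≠ x.2 :=
    (Measure.quasiMeasurePreserving_snd (μ := (volume : Measure ℝ)) (ν := (volume : Measure ℝ))).ae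
      (Measure.ae_ne volume x.2)
  filter_upwards [h1, h2] with y a b
  exact ⟨sub_ne_zero.2 a.symm, sub_ne_zero.2 b.symm⟩

lemma integrableOn_singKer (x : ℝ × ℝ) (a b c d : ℝ) :
    IntegrableOn (singKer x) (Set.Icc a b ×ˢ Set.Icc c d) := by
  rw [IntegrableOn, Measure.volume_eq_prod, ← Measure.prod_restrict]
  exact (integrableOn_sing_sub x.1 a b).mul_prod (integrableOn_sing_sub x.2 c d)

lemma setIntegral_singKer_le (x : ℝ × ℝ) {a b c d : ℝ} (hab : a < b) (hcd : c < d) :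
    ∫ y in Set.Icc a b ×ˢ Set.Icc c d, singKer x y ≤
      49 * (b - a) ^ (1 / 3 : ℝ) * (d - c) ^ (1 / 3 : ℝ) := by
  have e : ∫ y in Set.Icc a b ×ˢ Set.Icc c d, singKer x y =
      (∫ y in Set.Icc a b, sing (x.1 - y)) * ∫ y in Set.Icc c d, sing (x.2 - y) := by
    rw [Measure.volume_eq_prod]
    exact setIntegral_prod_mul (fun y => sing (x.1 - y)) (fun y => sing (x.2 - y)) _ _
  rw [e]
  calc _ ≤ (7 * (b - a) ^ (1 / 3 : ℝ)) * (7 * (d - c) ^ (1 / 3 : ℝ)) := by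
        refine mul_le_mul (setIntegral_sing_sub_le _ hab) (setIntegral_sing_sub_le _ hcd)
          (integral_nonneg fun _ => sing_nonneg _) ?_
        have : 0 ≤ b - a := by linarith
        positivity
    _ = _ := by ring

lemma abs_potKer_le {δ R : ℝ} {x y : ℝ × ℝ} (hδ : 0 < δ) (hx : δ ≤ x.1) (hy : δ ≤ y.1)
    (hyR : y.1 ≤ R) (h : x.1 - y.1 ≠ 0 ∧ x.2 - y.2 ≠ 0) :
    |potKer x y| ≤ R ^ 2 * (π + angConst δ / 2 * singKer x y) := by
  have h0 : 0 ≤ y.1 := hδ.le.trans hy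
  rw [potKer, abs_mul, abs_of_nonneg (sq_nonneg _), singKer, mul_comm (sing (x.1 - y.1))]
  exact mul_le_mul (by gcongr) (abs_ringKer_le hδ hx hy h.2 h.1) (abs_nonneg _) (sq_nonneg _)

lemma abs_potKer_sub_le {δ R : ℝ} {x z y : ℝ × ℝ} (hδ : 0 < δ) (hx : δ ≤ x.1) (hz : δ ≤ z.1)
    (hy : δ ≤ y.1) (hyR : y.1 ≤ R) (h : x.1 - y.1 ≠ 0 ∧ x.2 - y.2 ≠ 0)
    (h' : z.1 - y.1 ≠ 0 ∧ z.2 - y.2 ≠ 0) :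
    |potKer x y - potKer z y| ≤ R ^ 2 * (angConst δ / 2) * (|x.2 - z.2| + |x.1 - z.1|) *
      (singKer x y + singKer z y) := by
  have h0 : 0 ≤ y.1 := hδ.le.trans hy
  have key := abs_ringKer_sub_le hδ hx hz hy h.2 h'.2 h.1 h'.1
  rw [sub_sub_sub_cancel_right] at key
  rw [potKer, potKer, ← mul_sub, abs_mul, abs_of_nonneg (sq_nonneg _), singKer, singKer,
    mul_comm (sing (x.1 - y.1)), mul_comm (sing (z.1 - y.1))]
  calc _ ≤ R ^ 2 * _ := mul_le_mul (by gcongr) key (abs_nonneg _) (sq_nonneg _)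
    _ = _ := by ring

lemma integrableOn_potKer {δ a b c d : ℝ} {x : ℝ × ℝ} {A : Set (ℝ × ℝ)} (hδ : 0 < δ)
    (hx : δ ≤ x.1) (hA : MeasurableSet A) (hAδ : ∀ y ∈ A, δ ≤ y.1)
    (hbox : A ⊆ Set.Icc a b ×ˢ Set.Icc c d) : IntegrableOn (potKer x) A := by
  have hg : IntegrableOn (fun y => b ^ 2 * (π + angConst δ / 2 * singKer x y)) A := by
    refine IntegrableOn.mono_set (Integrable.const_mul (Integrable.add ?_
      ((integrableOn_singKer x a b c d).const_mul _)) _) hbox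
    exact integrableOn_const (isCompact_Icc.prod isCompact_Icc).measure_lt_top.ne
  refine Integrable.mono' hg (measurable_potKer x).aestronglyMeasurable ?_
  rw [ae_restrict_iff' hA]
  filter_upwards [ae_coords_ne x] with y hy hyA
  exact abs_potKer_le hδ hx (hAδ y hyA) (hbox hyA).1.2 hy

lemma abs_setIntegral_potKer_sub_le {δ a b c d : ℝ} {x z : ℝ × ℝ} {A : Set (ℝ × ℝ)}
    (hδ : 0 < δ) (hx : δ ≤ x.1) (hz : δ ≤ z.1) (hA : MeasurableSet A) (hAδ : ∀ y ∈ A, δ ≤ y.1)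
    (hab : a < b) (hcd : c < d) (hbox : A ⊆ Set.Icc a b ×ˢ Set.Icc c d) :
    |∫ y in A, (potKer x y - potKer z y)| ≤ 49 * b ^ 2 * angConst δ * (b - a) ^ (1 / 3 : ℝ) *
      (d - c) ^ (1 / 3 : ℝ) * (|x.2 - z.2| + |x.1 - z.1|) := by
  set D := |x.2 - z.2| + |x.1 - z.1| with hD
  have hD0 : 0 ≤ D := by positivity
  have hang := angConst_nonneg δ
  have hi : IntegrableOn (fun y => singKer x y + singKer z y) (Set.Icc a b ×ˢ Set.Icc c d) :=
    (integrableOn_singKer x a b c d).add (integrableOn_singKer z a b c d)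
  calc |∫ y in A, (potKer x y - potKer z y)|
      ≤ ∫ y in A, b ^ 2 * (angConst δ / 2) * D * (singKer x y + singKer z y) := by
        rw [← Real.norm_eq_abs]
        refine norm_integral_le_of_norm_le ((hi.mono_set hbox).const_mul _) ?_
        rw [ae_restrict_iff' hA]
        filter_upwards [ae_coords_ne x, ae_coords_ne z] with y hy hy' hyA
        exact abs_potKer_sub_le hδ hx hz (hAδ y hyA) (hbox hyA).1.2 hy hy'
    _ = b ^ 2 * (angConst δ / 2) * D * ∫ y in A, (singKer x y + singKer z y) :=
        integral_const_mul _ _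
    _ ≤ b ^ 2 * (angConst δ / 2) * D *
          ∫ y in Set.Icc a b ×ˢ Set.Icc c d, (singKer x y + singKer z y) := by
        gcongr
        · exact Eventually.of_forall fun y => add_nonneg (singKer_nonneg _ _) (singKer_nonneg _ _)
    _ ≤ b ^ 2 * (angConst δ / 2) * D * (49 * (b - a) ^ (1 / 3 : ℝ) * (d - c) ^ (1 / 3 : ℝ) +
          49 * (b - a) ^ (1 / 3 : ℝ) * (d - c) ^ (1 / 3 : ℝ)) := by
        rw [integral_add (integrableOn_singKer x a b c d) (integrableOn_singKer z a b c d)]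
        gcongr
        · exact setIntegral_singKer_le x hab hcd
        · exact setIntegral_singKer_le z hab hcd
    _ = _ := by ring

/-! ### Reflection in horizontal lines -/

/-- Reflection in the horizontal line at height `l`. -/
def hrefl (l : ℝ) (x : ℝ × ℝ) : ℝ × ℝ := (x.1, 2 * l - x.2)

@[simp] lemma hrefl_fst (l : ℝ) (x : ℝ × ℝ) : (hrefl l x).1 = x.1 := rfl

@[simp] lemma hrefl_snd (l : ℝ) (x : ℝ × ℝ) : (hrefl l x).2 = 2 * l - x.2 := rfl

@[simp] lemma hrefl_hrefl (l : ℝ) (x : ℝ × ℝ) : hrefl l (hrefl l x) = x := by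
  ext <;> simp

lemma measurePreserving_hrefl (l : ℝ) : MeasurePreserving (hrefl l) := by
  rw [Measure.volume_eq_prod]
  exact (MeasurePreserving.id volume).prod (Measure.measurePreserving_sub_left volume (2 * l))

lemma continuous_hrefl (l : ℝ) : Continuous (hrefl l) := by unfold hrefl; fun_prop

lemma measurableEmbedding_hrefl (l : ℝ) : MeasurableEmbedding (hrefl l) :=
  (MeasurableEquiv.mk ⟨hrefl l, hrefl l, hrefl_hrefl l, hrefl_hrefl l⟩
    (continuous_hrefl l).measurable (continuous_hrefl l).measurable).measurableEmbedding

lemma potKer_hrefl_left (l : ℝ) (x y : ℝ × ℝ) : potKer (hrefl l x) y = potKer x (hrefl l y) := by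
  simp only [potKer, hrefl_fst, hrefl_snd]
  rw [← ringKer_neg]
  ring_nf

/-- The points of `A` below the line whose reflection is missing from `A`. -/
def lowerDefect (A : Set (ℝ × ℝ)) (l : ℝ) : Set (ℝ × ℝ) := {y | y ∈ A ∧ hrefl l y ∉ A ∧ y.2 < l}

/-- The points of `A` above the line whose reflection is missing from `A`. -/
def upperDefect (A : Set (ℝ × ℝ)) (l : ℝ) : Set (ℝ × ℝ) := {y | y ∈ A ∧ hrefl l y ∉ A ∧ l < y.2}

lemma measurableSet_lowerDefect {A : Set (ℝ × ℝ)} (hA : MeasurableSet A) (l : ℝ) :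
    MeasurableSet (lowerDefect A l) :=
  hA.inter (((continuous_hrefl l).measurable hA).compl.inter
    (measurableSet_lt measurable_snd measurable_const))

lemma measurableSet_upperDefect {A : Set (ℝ × ℝ)} (hA : MeasurableSet A) (l : ℝ) :
    MeasurableSet (upperDefect A l) :=
  hA.inter (((continuous_hrefl l).measurable hA).compl.inter
    (measurableSet_lt measurable_const measurable_snd))

lemma potential_hrefl_sub {δ a b c d l : ℝ} {x : ℝ × ℝ} {A : Set (ℝ × ℝ)} (hδ : 0 < δ)
    (hx : δ ≤ x.1) (hA : MeasurableSet A) (hAδ : ∀ y ∈ A, δ ≤ y.1)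
    (hbox : A ⊆ Set.Icc a b ×ˢ Set.Icc c d) :
    potential A (hrefl l x) - potential A x =
      (∫ y in lowerDefect A l, (potKer (hrefl l x) y - potKer x y)) +
        ∫ y in upperDefect A l, (potKer (hrefl l x) y - potKer x y) := by
  have i1 := integrableOn_potKer (x := hrefl l x) hδ hx hA hAδ hbox
  have i2 := integrableOn_potKer hδ hx hA hAδ hbox
  have hi : IntegrableOn (fun y => potKer (hrefl l x) y - potKer x y) A := i1.sub i2
  set f := fun y => potKer (hrefl l x) y - potKer x y with hf
  rw [potential, potential, ← integral_sub i1 i2]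
  set C := A ∩ hrefl l ⁻¹' A with hC
  have hCm : MeasurableSet C := hA.inter ((continuous_hrefl l).measurable hA)
  have hrC : hrefl l ⁻¹' C = C := by
    ext y; simp [hC, and_comm]
  have hanti : ∀ y, f (hrefl l y) = -f y := fun y => by
    simp [hf, potKer_hrefl_left]
  have hzero : ∫ y in C, f y = 0 := by
    have h1 := (measurePreserving_hrefl l).setIntegral_preimage_emb
      (measurableEmbedding_hrefl l) f C
    rw [hrC] at h1
    simp only [hanti, integral_neg] at h1
    linarith
  have hAU : A = C ∪ (lowerDefect A l ∪ upperDefect A l) := by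
    ext y
    simp only [hC, lowerDefect, upperDefect, Set.mem_union, Set.mem_inter_iff, Set.mem_preimage,
      Set.mem_ofPred_eq]
    constructor
    · intro hy
      by_cases h : hrefl l y ∈ A
      · exact Or.inl ⟨hy, h⟩
      · rcases lt_trichotomy y.2 l with h' | h' | h'
        · exact Or.inr (Or.inl ⟨hy, h, h'⟩)
        · refine absurd ?_ h
          have : hrefl l y = y := by ext <;> simp; linarith
          rwa [this]
        · exact Or.inr (Or.inr ⟨hy, h, h'⟩)
    · tauto
  have hd1 : Disjoint C (lowerDefect A l ∪ upperDefect A l) := by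
    rw [Set.disjoint_left]
    rintro y hy (h | h)
    · exact h.2.1 hy.2
    · exact h.2.1 hy.2
  have hd2 : Disjoint (lowerDefect A l) (upperDefect A l) := by
    rw [Set.disjoint_left]
    intro y h h'
    exact lt_asymm h.2.2 h'.2.2
  have hsub := hAU.symm.subset
  rw [Set.union_subset_iff, Set.union_subset_iff] at hsub
  have hm1 := measurableSet_lowerDefect hA l
  have hm2 := measurableSet_upperDefect hA l
  calc ∫ y in A, f y = ∫ y in C ∪ (lowerDefect A l ∪ upperDefect A l), f y := by rw [← hAU]
    _ = _ := by
      rw [setIntegral_union hd1 (hm1.union hm2) (hi.mono_set hsub.1)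
        ((hi.mono_set hsub.2.1).union (hi.mono_set hsub.2.2)), hzero, zero_add,
        setIntegral_union hd2 hm2 (hi.mono_set hsub.2.1) (hi.mono_set hsub.2.2)]

/-- The constant in the lower bound for the reflected difference of the potential kernel. -/
def lowerConst (δ R : ℝ) : ℝ := δ ^ 2 * (2 * (δ * δ) / √(20 * R ^ 2) ^ 5 * π)

lemma lowerConst_pos {δ R : ℝ} (hδ : 0 < δ) (hR : 0 < R) : 0 < lowerConst δ R := by
  unfold lowerConst
  have : 0 < √(20 * R ^ 2) := sqrt_pos.2 (by positivity)
  positivity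

lemma potKer_hrefl_sub_ge {δ R l : ℝ} {x y : ℝ × ℝ} (hδ : 0 < δ) (hR : 0 < R) (hx : δ ≤ x.1)
    (hxR : x.1 ≤ R) (hx2 : |x.2| ≤ R) (hy : δ ≤ y.1) (hyR : y.1 ≤ R) (hy2 : |y.2| ≤ R)
    (hlx : l ≤ x.2) (hly : y.2 ≤ l) (hne : x.1 - y.1 ≠ 0 ∧ x.2 - y.2 ≠ 0) :
    lowerConst δ R * (x.2 - l) * (l - y.2) ≤ potKer (hrefl l x) y - potKer x y := by
  have hx0 := hδ.trans_le hx
  have hy0 := hδ.trans_le hy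
  have hrel : (x.2 - y.2) ^ 2 - (2 * l - x.2 - y.2) ^ 2 = 4 * ((x.2 - l) * (l - y.2)) := by ring
  have hp : 0 ≤ (x.2 - l) * (l - y.2) := mul_nonneg (by linarith) (by linarith)
  have hu : 0 < (x.1 - y.1) ^ 2 := by have := hne.1; positivity
  rw [abs_le] at hx2 hy2
  have hs : (x.2 - y.2) ^ 2 ≤ (4 * R) ^ 2 := by
    rw [sq_le_sq₀ (by linarith) (by linarith)]; linarith
  have hr : (x.1 + y.1) ^ 2 ≤ (2 * R) ^ 2 := by
    rw [sq_le_sq₀ (by linarith) (by linarith)]; linarith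
  have key := ringKer_sub_lower (s₁ := 2 * l - x.2 - y.2) (s₂ := x.2 - y.2) (N := 20 * R ^ 2)
    hx0 hy0 (by positivity) (by linarith) (by nlinarith)
  rw [hrel] at key
  have hN : 0 < √(20 * R ^ 2) := sqrt_pos.2 (by positivity)
  have hlow : (2 * (δ * δ) / √(20 * R ^ 2) ^ 5 * π) * ((x.2 - l) * (l - y.2)) ≤
      ringKer x.1 y.1 (2 * l - x.2 - y.2) - ringKer x.1 y.1 (x.2 - y.2) := by
    refine le_trans ?_ key
    have h1 : δ * δ ≤ x.1 * y.1 := mul_le_mul hx hy hδ.le hx0.le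
    calc _ = (δ * δ) * (2 / √(20 * R ^ 2) ^ 5 * π * ((x.2 - l) * (l - y.2))) := by ring
      _ ≤ (x.1 * y.1) * (2 / √(20 * R ^ 2) ^ 5 * π * ((x.2 - l) * (l - y.2))) := by gcongr
      _ = _ := by ring
  rw [potKer, potKer, ← mul_sub]
  calc lowerConst δ R * (x.2 - l) * (l - y.2) =
        δ ^ 2 * ((2 * (δ * δ) / √(20 * R ^ 2) ^ 5 * π) * ((x.2 - l) * (l - y.2))) := by
        rw [lowerConst]; ring
    _ ≤ y.1 ^ 2 * _ := by
        refine mul_le_mul (by gcongr) hlow ?_ (sq_nonneg _)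
        positivity

/-! ### The method of moving planes -/

/-- A planar set given as a superlevel set, inside a half ball, of its own ring potential. -/
structure IsRingSection (R W μ c δ : ℝ) (A : Set (ℝ × ℝ)) : Prop where
  R_pos : 0 < R
  c_pos : 0 < c
  δ_pos : 0 < δ
  meas : MeasurableSet A
  le_fst : ∀ x ∈ A, δ ≤ x.1
  mem_iff : ∀ x, x ∈ A ↔ x.1 ^ 2 + x.2 ^ 2 < R ^ 2 ∧ 0 < x.1 ∧
    μ < c * x.1 * potential A x + W / 2 * x.1 ^ 2

/-- The weighted mass of the points below the line whose reflection is missing. -/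
def defectMass (A : Set (ℝ × ℝ)) (l : ℝ) : ℝ := ∫ y in lowerDefect A l, (l - y.2)

/-- A Lipschitz constant for the potential on `{δ ≤ x₁}`. -/
def lipConst (δ R : ℝ) : ℝ :=
  49 * R ^ 2 * angConst δ * (R - 0) ^ (1 / 3 : ℝ) * (R - -R) ^ (1 / 3 : ℝ)

lemma lipConst_nonneg {δ R : ℝ} (hR : 0 < R) : 0 ≤ lipConst δ R := by
  have := angConst_nonneg δ
  have h2 : 0 ≤ R - 0 := by linarith
  have h3 : 0 ≤ R - -R := by linarith
  unfold lipConst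
  positivity

lemma defectMass_nonneg {A : Set (ℝ × ℝ)} (hA : MeasurableSet A) (l : ℝ) :
    0 ≤ defectMass A l :=
  setIntegral_nonneg (measurableSet_lowerDefect hA l) fun y hy => by linarith [hy.2.2]

namespace IsRingSection

variable {R W μ c δ : ℝ} {A : Set (ℝ × ℝ)}

lemma abs_snd_le (h : IsRingSection R W μ c δ A) {x : ℝ × ℝ} (hx : x ∈ A) : |x.2| ≤ R :=
  abs_le_of_sq_le_sq (by nlinarith [((h.mem_iff x).1 hx).1, sq_nonneg x.1]) h.R_pos.le

lemma fst_le (h : IsRingSection R W μ c δ A) {x : ℝ × ℝ} (hx : x ∈ A) : x.1 ≤ R :=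
  le_of_abs_le
    (abs_le_of_sq_le_sq (by nlinarith [((h.mem_iff x).1 hx).1, sq_nonneg x.2]) h.R_pos.le)

lemma subset_box (h : IsRingSection R W μ c δ A) :
    A ⊆ Set.Icc 0 R ×ˢ Set.Icc (-R) R := fun x hx =>
  ⟨⟨((h.mem_iff x).1 hx).2.1.le, h.fst_le hx⟩, abs_le.1 (h.abs_snd_le hx)⟩

lemma abs_potential_sub_le (h : IsRingSection R W μ c δ A) {ε : ℝ} (hε : 0 < ε) (hεδ : ε ≤ δ)
    {x z : ℝ × ℝ} (hx : ε ≤ x.1) (hz : ε ≤ z.1) :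
    |potential A x - potential A z| ≤ lipConst ε R * (|x.2 - z.2| + |x.1 - z.1|) := by
  have hAε : ∀ y ∈ A, ε ≤ y.1 := fun y hy => hεδ.trans (h.le_fst y hy)
  rw [potential, potential, ← integral_sub (integrableOn_potKer hε hx h.meas hAε h.subset_box)
    (integrableOn_potKer hε hz h.meas hAε h.subset_box)]
  exact abs_setIntegral_potKer_sub_le hε hx hz h.meas hAε h.R_pos (by linarith [h.R_pos])
    h.subset_box

lemma potential_hrefl_ge (h : IsRingSection R W μ c δ A) {x : ℝ × ℝ} (hx : δ ≤ x.1) (l m : ℝ) :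
    potential A (hrefl m x) - lipConst δ R * (2 * |l - m|) ≤ potential A (hrefl l x) := by
  have := h.abs_potential_sub_le h.δ_pos le_rfl (x := hrefl m x) (z := hrefl l x) hx hx
  have e : |(hrefl m x).2 - (hrefl l x).2| + |(hrefl m x).1 - (hrefl l x).1| = 2 * |l - m| := by
    simp only [hrefl_fst, hrefl_snd, sub_self, abs_zero, add_zero]
    rw [sub_sub_sub_cancel_right, ← mul_sub, abs_mul, abs_two, abs_sub_comm]
  rw [e] at this
  linarith [(abs_le.1 this).2]

lemma continuousAt_potential (h : IsRingSection R W μ c δ A) {x : ℝ × ℝ} (hx : 0 < x.1) :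
    ContinuousAt (potential A) x := by
  have hε : 0 < min δ (x.1 / 2) := lt_min h.δ_pos (by linarith)
  set ε := min δ (x.1 / 2) with hεd
  have hεx : ε < x.1 := (min_le_right _ _).trans_lt (by linarith)
  have hev : ∀ᶠ z : ℝ × ℝ in nhds x, ε ≤ z.1 :=
    (continuous_fst.continuousAt.eventually (lt_mem_nhds hεx)).mono fun z hz => le_of_lt hz
  rw [ContinuousAt, tendsto_iff_norm_sub_tendsto_zero]
  refine squeeze_zero' (Eventually.of_forall fun _ => norm_nonneg _)
    (g := fun z => lipConst ε R * (|z.2 - x.2| + |z.1 - x.1|))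
    (hev.mono fun z hz => h.abs_potential_sub_le hε (min_le_left _ _) hz hεx.le) ?_
  have : Continuous fun z : ℝ × ℝ => lipConst ε R * (|z.2 - x.2| + |z.1 - x.1|) := by fun_prop
  simpa using this.tendsto x

lemma isOpen (h : IsRingSection R W μ c δ A) : IsOpen A := by
  set U : Set (ℝ × ℝ) := {x | x.1 ^ 2 + x.2 ^ 2 < R ^ 2 ∧ 0 < x.1} with hU
  have hUo : IsOpen U :=
    (isOpen_lt (f := fun x : ℝ × ℝ => x.1 ^ 2 + x.2 ^ 2) (by fun_prop) continuous_const).inter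
      (isOpen_lt continuous_const continuous_fst)
  have hc : ContinuousOn (fun x : ℝ × ℝ => c * x.1 * potential A x + W / 2 * x.1 ^ 2) U := by
    intro x hx
    have := h.continuousAt_potential hx.2
    exact ContinuousAt.continuousWithinAt (by fun_prop)
  have e : A = U ∩ (fun x : ℝ × ℝ => c * x.1 * potential A x + W / 2 * x.1 ^ 2) ⁻¹' Set.Ioi μ := by
    ext x
    rw [h.mem_iff x]
    simp [hU, and_assoc]
  rw [e]
  exact hc.isOpen_inter_preimage hUo isOpen_Ioi

lemma hrefl_mem (h : IsRingSection R W μ c δ A) {x : ℝ × ℝ} {l : ℝ} (hx : x ∈ A)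
    (hb : (2 * l - x.2) ^ 2 ≤ x.2 ^ 2 ∨ x.1 ^ 2 + (2 * l - x.2) ^ 2 < R ^ 2)
    (hp : potential A x ≤ potential A (hrefl l x)) : hrefl l x ∈ A := by
  obtain ⟨h1, h2, h3⟩ := (h.mem_iff x).1 hx
  refine (h.mem_iff _).2 ⟨?_, h2, h3.trans_le ?_⟩
  · simp only [hrefl_fst, hrefl_snd]
    rcases hb with hb | hb <;> linarith
  · have := mul_le_mul_of_nonneg_left hp (mul_nonneg h.c_pos.le h2.le)
    simp only [hrefl_fst]
    linarith

lemma hrefl_mem_of_le (h : IsRingSection R W μ c δ A) {x : ℝ × ℝ} {l : ℝ} (hx : x ∈ A)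
    (hl : 0 ≤ l) (hlx : l ≤ x.2) (hp : potential A x ≤ potential A (hrefl l x)) :
    hrefl l x ∈ A :=
  h.hrefl_mem hx (Or.inl (by nlinarith)) hp

lemma integrableOn_sub_snd (h : IsRingSection R W μ c δ A) (l : ℝ) :
    IntegrableOn (fun y : ℝ × ℝ => l - y.2) (lowerDefect A l) := by
  have : IntegrableOn (fun y : ℝ × ℝ => l - y.2) (Set.Icc 0 R ×ˢ Set.Icc (-R) R) :=
    ContinuousOn.integrableOn_compact (isCompact_Icc.prod isCompact_Icc) (by fun_prop)
  exact this.mono_set (Set.Subset.trans (fun y hy => hy.1) h.subset_box)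

lemma integrableOn_potKer_sub (h : IsRingSection R W μ c δ A) {x z : ℝ × ℝ} (hx : δ ≤ x.1)
    (hz : δ ≤ z.1) : IntegrableOn (fun y => potKer x y - potKer z y) A :=
  (integrableOn_potKer h.δ_pos hx h.meas h.le_fst h.subset_box).sub
    (integrableOn_potKer h.δ_pos hz h.meas h.le_fst h.subset_box)

lemma setIntegral_lowerDefect_ge (h : IsRingSection R W μ c δ A) {x : ℝ × ℝ} {l : ℝ}
    (hx : x ∈ A) (hl : l ≤ x.2) :
    lowerConst δ R * (x.2 - l) * defectMass A l ≤
      ∫ y in lowerDefect A l, (potKer (hrefl l x) y - potKer x y) := by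
  have hsub : lowerDefect A l ⊆ A := fun y hy => hy.1
  have hxδ := h.le_fst x hx
  rw [defectMass, ← integral_const_mul]
  refine setIntegral_mono_on_ae ((h.integrableOn_sub_snd l).const_mul _)
    ((h.integrableOn_potKer_sub (x := hrefl l x) hxδ hxδ).mono_set hsub)
    (measurableSet_lowerDefect h.meas l) ?_
  filter_upwards [ae_coords_ne x] with y hne hy
  exact potKer_hrefl_sub_ge h.δ_pos h.R_pos hxδ (h.fst_le hx) (h.abs_snd_le hx)
    (h.le_fst y hy.1) (h.fst_le hy.1) (h.abs_snd_le hy.1) hl hy.2.2.le hne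

lemma potential_hrefl_sub_ge (h : IsRingSection R W μ c δ A) {x : ℝ × ℝ} {l : ℝ}
    (hx : x ∈ A) (hl : l ≤ x.2) (hu : upperDefect A l = ∅) :
    lowerConst δ R * (x.2 - l) * defectMass A l ≤
      potential A (hrefl l x) - potential A x := by
  rw [potential_hrefl_sub h.δ_pos (h.le_fst x hx) h.meas h.le_fst h.subset_box, hu,
    setIntegral_empty, add_zero]
  exact h.setIntegral_lowerDefect_ge hx hl

lemma upperDefect_eq_empty_of_approx (h : IsRingSection R W μ c δ A) {l : ℝ} (hl : 0 ≤ l)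
    (happ : ∀ ε > 0, ∃ m, l ≤ m ∧ m < l + ε ∧ upperDefect A m = ∅) : upperDefect A l = ∅ := by
  rw [Set.eq_empty_iff_forall_notMem]
  rintro x ⟨hx, hxr, hlx⟩
  refine hxr (h.hrefl_mem_of_le hx hl hlx.le ?_)
  refine le_of_forall_pos_le_add fun ε hε => ?_
  have hL := lipConst_nonneg (δ := δ) h.R_pos
  obtain ⟨m, hlm, hm, hmu⟩ := happ (min (x.2 - l) (ε / (2 * lipConst δ R + 1)))
    (lt_min (by linarith) (by positivity))
  have hm1 : m < x.2 := by linarith [min_le_left (x.2 - l) (ε / (2 * lipConst δ R + 1))]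
  have hm2 : m - l < ε / (2 * lipConst δ R + 1) := by
    linarith [min_le_right (x.2 - l) (ε / (2 * lipConst δ R + 1))]
  rw [lt_div_iff₀ (by positivity)] at hm2
  have h1 := h.potential_hrefl_sub_ge hx hm1.le hmu
  have h2 := h.potential_hrefl_ge (h.le_fst x hx) l m
  have h3 : 0 ≤ lowerConst δ R * (x.2 - m) * defectMass A m :=
    mul_nonneg (mul_nonneg (lowerConst_pos h.δ_pos h.R_pos).le (by linarith))
      (defectMass_nonneg h.meas m)
  rw [abs_sub_comm, abs_of_nonneg (by linarith : 0 ≤ m - l)] at h2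
  nlinarith

lemma volume_ne_top (h : IsRingSection R W μ c δ A) : volume A ≠ ⊤ :=
  ne_top_of_le_ne_top (isCompact_Icc.prod isCompact_Icc).measure_lt_top.ne
    (measure_mono h.subset_box)

lemma tendsto_volume_symmDiff_hrefl (h : IsRingSection R W μ c δ A) (l : ℝ) :
    Tendsto (fun m => volume (symmDiff (hrefl m ⁻¹' A) (hrefl l ⁻¹' A))) (nhds l) (nhds 0) := by
  let F : ℝ → C(ℝ × ℝ, ℝ × ℝ) := fun m => ⟨hrefl m, continuous_hrefl m⟩
  have hF : Continuous F := by
    refine ContinuousMap.continuous_of_continuous_uncurry _ ?_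
    change Continuous fun p : ℝ × ℝ × ℝ => hrefl p.1 p.2
    unfold hrefl
    fun_prop
  exact tendsto_measure_symmDiff_preimage_nhds_zero (f := F) (g := F l) hF.continuousAt
    (Eventually.of_forall fun m => measurePreserving_hrefl m) (measurePreserving_hrefl l)
    h.meas.nullMeasurableSet h.volume_ne_top

lemma exists_defectMass_ge (h : IsRingSection R W μ c δ A) {l : ℝ}
    (hpos : volume (lowerDefect A l) ≠ 0) :
    ∃ η > 0, ∃ g > 0, ∀ m, l - η < m → m ≤ l → g ≤ defectMass A m := by
  have hU : lowerDefect A l = ⋃ n : ℕ, lowerDefect A l ∩ {y | y.2 < l - 2 * (1 / (n + 1 : ℝ))} := by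
    rw [← Set.inter_iUnion, eq_comm, Set.inter_eq_left]
    intro y hy
    obtain ⟨n, hn⟩ := exists_nat_one_div_lt (show 0 < (l - y.2) / 2 by linarith [hy.2.2])
    exact Set.mem_iUnion.2 ⟨n, by change y.2 < _; linarith⟩
  rw [hU] at hpos
  obtain ⟨n, hn⟩ := exists_measure_pos_of_not_measure_iUnion_null hpos
  have hη : (0 : ℝ) < 1 / (n + 1 : ℝ) := by positivity
  generalize (1 / (n + 1 : ℝ)) = η at hn hη
  set G := lowerDefect A l ∩ {y | y.2 < l - 2 * η} with hG
  have hGA : G ⊆ A := fun y hy => hy.1.1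
  have hGtop : volume G ≠ ⊤ := ne_top_of_le_ne_top h.volume_ne_top (measure_mono hGA)
  have hhalf : volume G / 2 ≠ 0 := by simpa using hn.ne'
  have hev := (h.tendsto_volume_symmDiff_hrefl l).eventually
    (gt_mem_nhds (pos_iff_ne_zero.2 hhalf))
  obtain ⟨η', hη', hball⟩ := Metric.eventually_nhds_iff.1 hev
  have htop : volume G / 2 ≠ ⊤ := ENNReal.div_ne_top hGtop (by norm_num)
  refine ⟨min η η', lt_min hη hη', η * (volume G / 2).toReal,
    mul_pos hη (ENNReal.toReal_pos hhalf htop), fun m hm hml => ?_⟩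
  have hm1 : l - η < m := by linarith [min_le_left η η']
  have hm2 : l - η' < m := by linarith [min_le_right η η']
  have hsd := hball (y := m) (by rw [Real.dist_eq, abs_sub_lt_iff]; constructor <;> linarith)
  set H := lowerDefect A m ∩ {y | y.2 < m - η} with hH
  have hHm : MeasurableSet H := (measurableSet_lowerDefect h.meas m).inter
    (measurableSet_lt measurable_snd measurable_const)
  have hHtop : volume H ≠ ⊤ :=
    ne_top_of_le_ne_top h.volume_ne_top (measure_mono fun y hy => hy.1.1)
  have hsub : G ⊆ H ∪ symmDiff (hrefl m ⁻¹' A) (hrefl l ⁻¹' A) := by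
    intro y hy
    by_cases hys : y ∈ symmDiff (hrefl m ⁻¹' A) (hrefl l ⁻¹' A)
    · exact Or.inr hys
    · have hy2 : y.2 < l - 2 * η := hy.2
      refine Or.inl ⟨⟨hGA hy, fun hc => hys (Or.inl ⟨hc, hy.1.2.1⟩), by linarith⟩, ?_⟩
      change y.2 < m - η
      linarith
  have hvol : volume G / 2 ≤ volume H := by
    have h1 : volume G ≤ volume H + volume G / 2 :=
      (measure_mono hsub).trans ((measure_union_le _ _).trans (by gcongr))
    rwa [← ENNReal.add_le_add_iff_right htop, ENNReal.add_halves]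
  calc η * (volume G / 2).toReal ≤ η * volume.real H := by
        gcongr
        exact ENNReal.toReal_mono hHtop hvol
    _ = ∫ y in H, η := by rw [setIntegral_const, smul_eq_mul, mul_comm]
    _ ≤ ∫ y in H, (m - y.2) := by
        refine setIntegral_mono_on (integrableOn_const hHtop)
          ((h.integrableOn_sub_snd m).mono_set Set.inter_subset_left) hHm fun y hy => ?_
        have : y.2 < m - η := hy.2
        linarith
    _ ≤ defectMass A m := by
        refine setIntegral_mono_set (h.integrableOn_sub_snd m) ?_
          (LE.le.eventuallyLE Set.inter_subset_left)
        filter_upwards [ae_restrict_mem (measurableSet_lowerDefect h.meas m)] with y hy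
        have := hy.2.2
        simp only [Pi.zero_apply]
        linarith

lemma exists_upperDefect_eq_empty_below (h : IsRingSection R W μ c δ A) {l : ℝ}
    (hu : upperDefect A l = ∅) (hpos : volume (lowerDefect A l) ≠ 0) :
    ∃ η > 0, ∀ m, 0 ≤ m → l - η < m → m ≤ l → upperDefect A m = ∅ := by
  obtain ⟨η₁, hη₁, g, hg, hmass⟩ := h.exists_defectMass_ge hpos
  have hL := lipConst_nonneg (δ := δ) h.R_pos
  have hc := lowerConst_pos h.δ_pos h.R_pos
  have hang := angConst_nonneg δ
  have hR := h.R_pos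
  set C := lowerConst δ R with hC
  set L := lipConst δ R with hLd
  set K := 49 * R ^ 2 * angConst δ * (R - 0) ^ (1 / 3 : ℝ) with hK
  have hK0 : 0 ≤ K := by
    have : 0 ≤ R - 0 := by linarith
    positivity
  set q := C * g / (2 * K + 1) with hq
  have hq0 : 0 < q := by positivity
  have hqK : 2 * K * q ≤ C * g := by
    have : q * (2 * K + 1) = C * g := by rw [hq]; field_simp
    nlinarith
  set τ := q ^ 3 with hτ
  have hτ0 : 0 < τ := by positivity
  have hτq : τ ^ (1 / 3 : ℝ) = q := by
    rw [hτ, ← rpow_natCast, ← rpow_mul hq0.le]; norm_num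
  have hη₂ : 0 < C * τ * g / (4 * L + 1) := by positivity
  refine ⟨min η₁ (min (τ / 2) (C * τ * g / (4 * L + 1))),
    lt_min hη₁ (lt_min (by linarith) hη₂), fun m hm0 hm hml => ?_⟩
  have hd : l - m < min η₁ (min (τ / 2) (C * τ * g / (4 * L + 1))) := by linarith
  rw [lt_min_iff, lt_min_iff] at hd
  obtain ⟨hd1, hd2, hd3⟩ := hd
  rw [lt_div_iff₀ (by positivity)] at hd3
  have hfar : ∀ x ∈ upperDefect A m, x.2 < m + τ := by
    rintro x ⟨hx, hxr, hmx⟩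
    by_contra! hfar
    refine hxr (h.hrefl_mem_of_le hx hm0 hmx.le ?_)
    have h1 := h.potential_hrefl_sub_ge hx (by linarith : l ≤ x.2) hu
    have h2 := h.potential_hrefl_ge (h.le_fst x hx) m l
    rw [abs_sub_comm, abs_of_nonneg (by linarith : 0 ≤ l - m)] at h2
    have h3 : C * (τ / 2) * g ≤ C * (x.2 - l) * defectMass A l := by
      gcongr
      · exact mul_nonneg hc.le (by linarith)
      · linarith
      · exact hmass l (by linarith) le_rfl
    nlinarith
  rw [Set.eq_empty_iff_forall_notMem]
  rintro x ⟨hx, hxr, hmx⟩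
  refine hxr (h.hrefl_mem_of_le hx hm0 hmx.le ?_)
  have hxδ := h.le_fst x hx
  have hsplit := potential_hrefl_sub (l := m) h.δ_pos hxδ h.meas h.le_fst h.subset_box
  have hlow := h.setIntegral_lowerDefect_ge hx hmx.le
  have hup := abs_setIntegral_potKer_sub_le (x := hrefl m x) (z := x) (a := 0) (b := R) (c := m)
    (d := m + τ) h.δ_pos hxδ hxδ (measurableSet_upperDefect h.meas m)
    (fun y hy => h.le_fst y hy.1) h.R_pos (by linarith)
    (fun y hy => ⟨(h.subset_box hy.1).1, hy.2.2.le, (hfar y hy).le⟩)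
  have e : |(hrefl m x).2 - x.2| + |(hrefl m x).1 - x.1| = 2 * (x.2 - m) := by
    have : (hrefl m x).2 - x.2 = -(2 * (x.2 - m)) := by simp only [hrefl_snd]; ring
    rw [this, hrefl_fst, sub_self, abs_zero, add_zero, abs_neg, abs_of_nonneg (by linarith)]
  rw [e, add_sub_cancel_left, hτq, ← hK] at hup
  have hge : C * (x.2 - m) * g ≤ C * (x.2 - m) * defectMass A m :=
    mul_le_mul_of_nonneg_left (hmass m (by linarith) hml) (mul_nonneg hc.le (by linarith))
  have hcmp : 2 * K * q * (x.2 - m) ≤ C * g * (x.2 - m) :=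
    mul_le_mul_of_nonneg_right hqK (by linarith)
  have := (abs_le.1 hup).1
  nlinarith

lemma hrefl_mem_of_null (h : IsRingSection R W μ c δ A) {l : ℝ} (hl : 0 < l)
    (hu : upperDefect A l = ∅) (hnull : volume (lowerDefect A l) = 0) :
    ∀ x ∈ A, hrefl l x ∈ A := by
  intro x hx
  by_contra hxr
  have hxl : x.2 < l := by
    rcases lt_trichotomy x.2 l with h' | h' | h'
    · exact h'
    · refine absurd hx ?_
      have : hrefl l x = x := by ext <;> simp; linarith
      rwa [this] at hxr
    · exact absurd (show x ∈ upperDefect A l from ⟨hx, hxr, h'⟩) (by simp [hu])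
  have heq : potential A (hrefl l x) = potential A x := by
    have := potential_hrefl_sub (l := l) h.δ_pos (h.le_fst x hx) h.meas h.le_fst h.subset_box
    rw [hu, setIntegral_empty, setIntegral_measure_zero _ hnull] at this
    linarith
  have hout : R ^ 2 ≤ x.1 ^ 2 + (2 * l - x.2) ^ 2 := by
    by_contra! hin
    exact hxr (h.hrefl_mem hx (Or.inr hin) heq.ge)
  set V : Set (ℝ × ℝ) := A ∩ ({y | y.2 < l} ∩ {y | R ^ 2 < y.1 ^ 2 + (2 * l - y.2) ^ 2}) with hV
  have hVo : IsOpen V := by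
    refine h.isOpen.inter ?_
    exact (isOpen_lt continuous_snd continuous_const).inter
      (isOpen_lt (f := fun _ : ℝ × ℝ => R ^ 2)
        (g := fun y : ℝ × ℝ => y.1 ^ 2 + (2 * l - y.2) ^ 2) continuous_const (by fun_prop))
  have hVsub : V ⊆ lowerDefect A l := fun y hy =>
    ⟨hy.1, fun hc => absurd ((h.mem_iff _).1 hc).1 (not_lt.2 hy.2.2.le), hy.2.1⟩
  have hVne : V.Nonempty := by
    have hpath : Tendsto (fun t : ℝ => (x.1, x.2 - t)) (nhdsWithin 0 (Set.Ioi 0)) (nhds x) := by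
      have : Continuous fun t : ℝ => (x.1, x.2 - t) := by fun_prop
      have h0 := (this.tendsto 0).mono_left (nhdsWithin_le_nhds (s := Set.Ioi 0))
      simpa using h0
    obtain ⟨t, htA, ht⟩ := ((hpath.eventually (h.isOpen.mem_nhds hx)).and
      self_mem_nhdsWithin).exists
    have ht0 : 0 < t := ht
    refine ⟨(x.1, x.2 - t), htA, ?_, ?_⟩
    · change x.2 - t < l
      linarith
    · change R ^ 2 < x.1 ^ 2 + (2 * l - (x.2 - t)) ^ 2
      have : 0 < 2 * l - x.2 := by linarith
      nlinarith [mul_pos ht0 this]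
  exact (hVo.measure_pos volume hVne).ne' (measure_mono_null hVsub hnull)

lemma symmetric_or_upperDefect_zero (h : IsRingSection R W μ c δ A) :
    (∃ l, ∀ x ∈ A, hrefl l x ∈ A) ∨ upperDefect A 0 = ∅ := by
  set S : Set ℝ := {l | 0 ≤ l ∧ upperDefect A l = ∅} with hS
  have hSR : R ∈ S := by
    refine ⟨h.R_pos.le, Set.eq_empty_iff_forall_notMem.2 fun x hx => ?_⟩
    exact absurd hx.2.2 (not_lt.2 (le_of_abs_le (h.abs_snd_le hx.1)))
  have hSb : BddBelow S := ⟨0, fun l hl => hl.1⟩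
  have hl0 : 0 ≤ sInf S := le_csInf ⟨R, hSR⟩ fun l hl => hl.1
  have hlu : upperDefect A (sInf S) = ∅ := by
    refine h.upperDefect_eq_empty_of_approx hl0 fun ε hε => ?_
    obtain ⟨m, hm, hmε⟩ := exists_lt_of_csInf_lt ⟨R, hSR⟩ (lt_add_of_pos_right (sInf S) hε)
    exact ⟨m, csInf_le hSb hm, hmε, hm.2⟩
  rcases hl0.eq_or_lt with h0 | hpos
  · exact Or.inr (h0 ▸ hlu)
  · left
    by_cases hnull : volume (lowerDefect A (sInf S)) = 0
    · exact ⟨_, h.hrefl_mem_of_null hpos hlu hnull⟩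
    · obtain ⟨η, hη, hbelow⟩ := h.exists_upperDefect_eq_empty_below hlu hnull
      have hm1 : max 0 (sInf S - η / 2) < sInf S := max_lt hpos (by linarith)
      have hmS : max 0 (sInf S - η / 2) ∈ S := ⟨le_max_left _ _, hbelow _ (le_max_left _ _)
        (lt_of_lt_of_le (by linarith) (le_max_right _ _)) hm1.le⟩
      exact absurd (csInf_le hSb hmS) (not_le.2 hm1)

lemma mirror (h : IsRingSection R W μ c δ A) :
    IsRingSection R W μ c δ (hrefl 0 ⁻¹' A) where
  R_pos := h.R_pos
  c_pos := h.c_pos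
  δ_pos := h.δ_pos
  meas := (continuous_hrefl 0).measurable h.meas
  le_fst x hx := h.le_fst (hrefl 0 x) hx
  mem_iff x := by
    have e : potential (hrefl 0 ⁻¹' A) x = potential A (hrefl 0 x) := by
      have := (measurePreserving_hrefl 0).setIntegral_preimage_emb (measurableEmbedding_hrefl 0)
        (fun y => potKer (hrefl 0 x) y) A
      simpa only [potKer_hrefl_left, hrefl_hrefl, potential] using this
    rw [Set.mem_preimage, h.mem_iff, e]
    simp

theorem exists_symmetric (h : IsRingSection R W μ c δ A) : ∃ l, ∀ x ∈ A, hrefl l x ∈ A := by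
  rcases h.symmetric_or_upperDefect_zero with hs | h1
  · exact hs
  rcases h.mirror.symmetric_or_upperDefect_zero with ⟨l, hs⟩ | h2
  · refine ⟨-l, fun x hx => ?_⟩
    have := hs (hrefl 0 x) (by simpa using hx)
    have e : hrefl 0 (hrefl l (hrefl 0 x)) = hrefl (-l) x := by
      ext <;> simp; ring
    rwa [Set.mem_preimage, e] at this
  · refine ⟨0, fun x hx => ?_⟩
    by_contra hxr
    rcases lt_trichotomy x.2 0 with h' | h' | h'
    · have : hrefl 0 x ∈ upperDefect (hrefl 0 ⁻¹' A) 0 :=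
        ⟨by simpa using hx, by simpa using hxr, by simpa using h'⟩
      simp [h2] at this
    · have e : hrefl 0 x = x := by ext <;> simp [h']
      rw [e] at hxr
      exact hxr hx
    · have : x ∈ upperDefect A 0 := ⟨hx, hxr, h'⟩
      simp [h1] at this

end IsRingSection

/-! ### Transfer to `Plane` -/

/-- Cartesian coordinates on `Plane`, as a measurable equivalence. -/
def planeEquiv : Plane ≃ᵐ ℝ × ℝ :=
  (MeasurableEquiv.toLp 2 (Fin 2 → ℝ)).symm.trans MeasurableEquiv.finTwoArrow

lemma planeEquiv_apply (x : Plane) : planeEquiv x = (x 0, x 1) := rfl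

lemma planeEquiv_symm_apply (p : ℝ × ℝ) : planeEquiv.symm p = mk2 p.1 p.2 := by
  rw [MeasurableEquiv.symm_apply_eq]
  rfl

lemma measurePreserving_planeEquiv : MeasurePreserving planeEquiv :=
  (EuclideanSpace.volume_preserving_symm_measurableEquiv_toLp (Fin 2)).trans
    (volume_preserving_finTwoArrow ℝ)

lemma setIntegral_Gstar (A : Set Plane) (x : Plane) :
    ∫ x' in A, Gstar x x' =
      x 0 / (4 * π) * potential (planeEquiv.symm ⁻¹' A) (planeEquiv x) := by
  have e : A = planeEquiv ⁻¹' (planeEquiv.symm ⁻¹' A) := by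
    ext; simp
  have hG : ∀ x', Gstar x x' = x 0 / (4 * π) * potKer (planeEquiv x) (planeEquiv x') := fun x' => by
    simp only [Gstar, potKer, ringKer, planeEquiv_apply]
    ring
  simp only [hG]
  rw [integral_const_mul, potential]
  conv_lhs => rw [e]
  rw [measurePreserving_planeEquiv.setIntegral_preimage_emb planeEquiv.measurableEmbedding]

lemma exists_le_fst_of_closure_subset {A : Set Plane} (hbdd : Bornology.IsBounded A)
    (hcl : closure A ⊆ halfPlane) : ∃ δ > 0, ∀ x ∈ A, δ ≤ x 0 := by
  rcases A.eq_empty_or_nonempty with rfl | hne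
  · exact ⟨1, one_pos, by simp⟩
  · obtain ⟨z, hz, hmin⟩ := hbdd.isCompact_closure.exists_isMinOn hne.closure
      (f := fun x : Plane => x 0) (by fun_prop)
    exact ⟨z 0, hcl hz, fun x hx => hmin (subset_closure hx)⟩

/-- **Symmetry of the cross-section by the method of moving planes** (Proposition A.1).
If `A = {x ∈ B_R(0) : x₁ > 0, ψ(x) + (W/2)x₁² > μ}` where `ψ` is the `G_*`-potential of `A`
and the closure of `A` lies in the open half plane, then `A` is symmetric with respect to
some horizontal line `{x₂ = h}`. -/
theorem moving_planes_symmetry (R W μ : ℝ) (hR : 0 < R) (A : Set Plane)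
    (hmeas : MeasurableSet A) (hbdd : Bornology.IsBounded A)
    (hcl : closure A ⊆ halfPlane)
    (hA : A = {x : Plane | x ∈ Metric.ball (0 : Plane) R ∧ 0 < x 0 ∧
      μ < (1 / (4 * π)) * (∫ x' in A, Gstar x x') + W / 2 * (x 0) ^ 2}) :
    ∃ h : ℝ, ∀ a b : ℝ, mk2 a b ∈ A ↔ mk2 a (2 * h - b) ∈ A := by
  obtain ⟨δ, hδ, hAδ⟩ := exists_le_fst_of_closure_subset hbdd hcl
  have hsec : IsRingSection R W μ (1 / (4 * π) * (1 / (4 * π))) δ (planeEquiv.symm ⁻¹' A) := by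
    refine ⟨hR, by positivity, hδ, planeEquiv.symm.measurable hmeas, fun x hx => ?_, fun x => ?_⟩
    · rw [Set.mem_preimage, planeEquiv_symm_apply] at hx
      exact hAδ _ hx
    · rw [Set.mem_preimage]
      conv_lhs => rw [hA]
      rw [Set.mem_ofPred_eq, setIntegral_Gstar, planeEquiv.apply_symm_apply,
        planeEquiv_symm_apply, mem_ball_zero_iff, EuclideanSpace.norm_eq, Real.sqrt_lt' hR,
        Fin.sum_univ_two, Real.norm_eq_abs, Real.norm_eq_abs, sq_abs, sq_abs]
      have h0 : mk2 x.1 x.2 0 = x.1 := rfl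
      have h1 : mk2 x.1 x.2 1 = x.2 := rfl
      rw [h0, h1]
      ring_nf
  obtain ⟨l, hl⟩ := hsec.exists_symmetric
  have hstep : ∀ a b, mk2 a b ∈ A → mk2 a (2 * l - b) ∈ A := fun a b hab => by
    have := hl (a, b) (by rwa [Set.mem_preimage, planeEquiv_symm_apply])
    rwa [Set.mem_preimage, planeEquiv_symm_apply] at this
  refine ⟨l, fun a b => ⟨hstep a b, fun hab => ?_⟩⟩
  have := hstep a _ hab
  rwa [sub_sub_cancel] at this
end
end
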